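/- Let I(t) = ∫₀^∞∫₀^∞∫₀^∞ [ (1+x₁+x₂+x₃)(1+x₁⁻¹+x₂⁻¹+x₃⁻¹) − t ]⁻¹ (dx₁/x₁)(dx₂/x₂)(dx₃/x₃). Then I(−32) + I(16) = (36π/√12)·L(g,2), where g is the weight 3, level 12 cusp form g(τ) = η(2τ)³η(6τ)³ and L(g,2) = 4π² ∫₀^∞ g(iy)·y dy. -/

import Mathlib

open MeasureTheory

/-- The Dedekind eta function `η(τ) = e^{πiτ/12} ∏_{n≥1} (1 - e^{2πinτ})`. -/
noncomputable def dedekindEta (τ : ℂ) : ℂ :=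
  Complex.exp (Real.pi * Complex.I * τ / 12) *
    ∏' n : ℕ, (1 - Complex.exp (2 * Real.pi * Complex.I * ((n : ℂ) + 1) * τ))

/-- The three-banana Feynman integral `I(t)`. -/
noncomputable def feynmanI (t : ℝ) : ℝ :=
  ∫ x₁ in Set.Ioi (0 : ℝ), ∫ x₂ in Set.Ioi (0 : ℝ), ∫ x₃ in Set.Ioi (0 : ℝ),
    ((1 + x₁ + x₂ + x₃) * (1 + x₁⁻¹ + x₂⁻¹ + x₃⁻¹) - t)⁻¹ / (x₁ * x₂ * x₃)

/-- The weight 3, level 12 cusp form `g(τ) = η(2τ)³η(6τ)³`. -/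
noncomputable def cuspFormG (τ : ℂ) : ℂ :=
  dedekindEta (2 * τ) ^ 3 * dedekindEta (6 * τ) ^ 3

/-- The critical L-value `L(g,2) = 4π² ∫₀^∞ g(iy) y dy`. -/
noncomputable def Lg2 : ℂ :=
  4 * (Real.pi : ℂ) ^ 2 * ∫ y in Set.Ioi (0 : ℝ), cuspFormG (Complex.I * y) * y

namespace ThreeBanana

open Complex Filter Topology Set

/-- Polynomially bounded coefficient sequences. -/
def PolyBdd (c : ℕ → ℂ) : Prop := ∃ (C : ℝ) (k : ℕ), ∀ n, ‖c n‖ ≤ C * ((n : ℝ) + 1) ^ k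

/-- The nome `e^{2πiτ}`. -/
noncomputable def nome (τ : ℂ) : ℂ := exp (2 * Real.pi * I * τ)

/-- The Fourier series with coefficients `c`. -/
noncomputable def qSer (c : ℕ → ℂ) (τ : ℂ) : ℂ := ∑' n : ℕ, c n * nome τ ^ n

lemma norm_nome (τ : ℂ) : ‖nome τ‖ = Real.exp (-(2 * Real.pi * τ.im)) := by
  rw [nome, Complex.norm_exp]; congr 1; simp

lemma norm_nome_lt_one {τ : ℂ} (h : 0 < τ.im) : ‖nome τ‖ < 1 := by
  rw [norm_nome, Real.exp_lt_one_iff]; have := Real.pi_pos; nlinarith [mul_pos this h]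

lemma nome_ne_zero (τ : ℂ) : nome τ ≠ 0 := exp_ne_zero _

lemma hasDerivAt_nome (τ : ℂ) : HasDerivAt nome (2 * Real.pi * I * nome τ) τ := by
  have := ((hasDerivAt_id τ).const_mul (2 * Real.pi * I)).cexp
  refine this.congr_deriv ?_
  simp only [nome, id]; ring

lemma nome_add_int (τ : ℂ) (n : ℤ) : nome (τ + n) = nome τ := by
  rw [nome, nome, Complex.exp_eq_exp_iff_exists_int]
  exact ⟨n, by ring⟩

lemma nome_add_half (τ : ℂ) : nome (τ + 1 / 2) = -nome τ := by
  rw [nome, nome, show (2 * Real.pi * I * (τ + 1 / 2) : ℂ) = 2 * Real.pi * I * τ + Real.pi * I by ring,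
    exp_add, exp_pi_mul_I]; ring

lemma nome_nat_mul (d : ℕ) (τ : ℂ) : nome (d * τ) = nome τ ^ d := by
  rw [nome, nome, ← exp_nat_mul]; congr 1; ring

lemma PolyBdd.summable_bound {C : ℝ} (k : ℕ) {r : ℝ} (hr0 : 0 ≤ r) (hr : r < 1) :
    Summable fun n : ℕ => C * ((n : ℝ) + 1) ^ k * r ^ n := by
  have h1 : Summable fun n : ℕ => ((n : ℝ) + 1) ^ k * r ^ n := by
    have : (fun n : ℕ => ((n : ℝ) + 1) ^ k) =O[atTop] fun n : ℕ => ((n ^ k : ℕ) : ℝ) := by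
      refine Asymptotics.IsBigO.of_bound (2 ^ k) ?_
      filter_upwards [eventually_ge_atTop 1] with n hn
      have : (1 : ℝ) ≤ n := by exact_mod_cast hn
      rw [Real.norm_of_nonneg (by positivity), Real.norm_of_nonneg (by positivity)]
      push_cast
      rw [← mul_pow]
      gcongr
      linarith
    refine summable_of_isBigO_nat (summable_pow_mul_geometric_of_norm_lt_one k
      (r := r) (by rwa [Real.norm_of_nonneg hr0])) ?_
    refine Asymptotics.IsBigO.mul ?_ (Asymptotics.isBigO_refl _ _)
    simpa using this
  simpa [mul_assoc] using h1.mul_left C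

lemma PolyBdd.summable_norm {c : ℕ → ℂ} (hc : PolyBdd c) {z : ℂ} (hz : ‖z‖ < 1) :
    Summable fun n => ‖c n * z ^ n‖ := by
  obtain ⟨C, k, h⟩ := hc
  refine Summable.of_nonneg_of_le (fun _ => norm_nonneg _) (fun n => ?_)
    (PolyBdd.summable_bound (C := C) k (norm_nonneg z) hz)
  rw [norm_mul, norm_pow]
  gcongr
  exact h n

lemma PolyBdd.summable {c : ℕ → ℂ} (hc : PolyBdd c) {z : ℂ} (hz : ‖z‖ < 1) :
    Summable fun n => c n * z ^ n := (hc.summable_norm hz).of_norm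

lemma PolyBdd.hasSum {c : ℕ → ℂ} (hc : PolyBdd c) {τ : ℂ} (h : 0 < τ.im) :
    HasSum (fun n => c n * nome τ ^ n) (qSer c τ) := (hc.summable (norm_nome_lt_one h)).hasSum

lemma PolyBdd.nat_mul {c : ℕ → ℂ} (hc : PolyBdd c) : PolyBdd fun n => n * c n := by
  obtain ⟨C, k, h⟩ := hc
  refine ⟨C, k + 1, fun n => ?_⟩
  have h0 := h n
  have : 0 ≤ C * ((n : ℝ) + 1) ^ k := (norm_nonneg _).trans h0
  rw [norm_mul, Complex.norm_natCast]
  calc (n : ℝ) * ‖c n‖ ≤ (n + 1) * (C * ((n : ℝ) + 1) ^ k) := by gcongr; linarith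
    _ = _ := by ring

lemma hasDerivAt_qSer {c : ℕ → ℂ} (hc : PolyBdd c) {τ : ℂ} (h : 0 < τ.im) :
    HasDerivAt (qSer c) (2 * Real.pi * I * qSer (fun n => n * c n) τ) τ := by
  set y := τ.im / 2 with hy
  have hy0 : 0 < y := by positivity
  set r := Real.exp (-(2 * Real.pi * y)) with hr
  have hr1 : r < 1 := by
    rw [hr, Real.exp_lt_one_iff]; have := Real.pi_pos; nlinarith [mul_pos this hy0]
  obtain ⟨C, k, hb⟩ := hc.nat_mul
  have key := hasDerivAt_tsum_of_isPreconnected (𝕜 := ℂ)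
    (u := fun n : ℕ => 2 * Real.pi * (C * ((n : ℝ) + 1) ^ k * r ^ n))
    (t := {z : ℂ | y < z.im}) (g := fun n z => c n * nome z ^ n)
    (g' := fun n z => 2 * Real.pi * I * ((n * c n) * nome z ^ n)) (y₀ := τ) (y := τ)
    ((PolyBdd.summable_bound (C := C) k (Real.exp_pos _).le hr1).mul_left _)
    (isOpen_lt continuous_const Complex.continuous_im)
    ((convex_halfSpace_im_gt y).isPreconnected) ?_ ?_ ?_ ?_ ?_
  · rw [tsum_mul_left] at key
    exact key
  · intro n z _
    have := ((hasDerivAt_nome z).pow n).const_mul (c n)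
    refine this.congr_deriv ?_
    rcases n with _ | n
    · simp
    · simp only [Nat.add_sub_cancel, pow_succ]
      push_cast; ring
  · intro n z hz
    rw [norm_mul, norm_mul (n * c n : ℂ), norm_pow]
    have e1 : ‖(2 * Real.pi * I : ℂ)‖ = 2 * Real.pi := by
      simp [abs_of_pos Real.pi_pos]
    rw [e1]
    have e2 : ‖nome z‖ ≤ r := by
      rw [norm_nome, hr]; apply Real.exp_le_exp.mpr
      have : y < z.im := hz
      have := Real.pi_pos; nlinarith
    have := hb n
    have : 0 ≤ C * ((n : ℝ) + 1) ^ k := (norm_nonneg _).trans this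
    gcongr
  · change y < τ.im; rw [hy]; linarith
  · exact hc.summable (norm_nome_lt_one h)
  · change y < τ.im; rw [hy]; linarith

lemma qSer_add_one (c : ℕ → ℂ) (τ : ℂ) : qSer c (τ + 1) = qSer c τ := by
  have := nome_add_int τ 1
  simp only [qSer]
  push_cast at this; rw [this]

/-- Convergence of a Fourier series to its constant term. -/
lemma norm_qSer_sub_le {c : ℕ → ℂ} (hc : PolyBdd c) :
    ∃ K : ℝ, 0 < K ∧ ∀ τ : ℂ, 1 ≤ τ.im → ‖qSer c τ - c 0‖ ≤ K * ‖nome τ‖ := by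
  obtain ⟨C, k, hb⟩ := hc
  set r := Real.exp (-(2 * Real.pi)) with hr
  have hr1 : r < 1 := by
    rw [hr, Real.exp_lt_one_iff]; have := Real.pi_pos; linarith
  have hs : Summable fun n : ℕ => C * (((n + 1 : ℕ) : ℝ) + 1) ^ k * r ^ n := by
    have := (summable_nat_add_iff 1).mpr
      (PolyBdd.summable_bound (C := C) k (Real.exp_pos _).le hr1)
    have h2 := this.mul_right r⁻¹
    refine h2.congr fun n => ?_
    have : r ≠ 0 := (Real.exp_pos _).ne'
    rw [← hr, pow_succ]; field_simp
  refine ⟨(∑' n : ℕ, C * (((n + 1 : ℕ) : ℝ) + 1) ^ k * r ^ n) + 1, ?_, fun τ hτ => ?_⟩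
  · have : 0 ≤ ∑' n : ℕ, C * (((n + 1 : ℕ) : ℝ) + 1) ^ k * r ^ n :=
      tsum_nonneg fun n => by
        have := (norm_nonneg _).trans (hb (n+1))
        have hr0 : 0 ≤ r := (Real.exp_pos _).le
        positivity
    linarith
  have him : 0 < τ.im := by linarith
  have hS := (PolyBdd.hasSum (c := c) ⟨C, k, hb⟩ him)
  have e : qSer c τ - c 0 = ∑' n : ℕ, c (n + 1) * nome τ ^ (n + 1) := by
    rw [qSer, hS.summable.tsum_eq_zero_add]; simp
  have hq : ‖nome τ‖ ≤ r := by
    rw [norm_nome, hr]; apply Real.exp_le_exp.mpr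
    have := Real.pi_pos; nlinarith
  have hle : ∀ n : ℕ, ‖c (n + 1) * nome τ ^ (n + 1)‖ ≤
      (C * (((n + 1 : ℕ) : ℝ) + 1) ^ k * r ^ n) * ‖nome τ‖ := fun n => by
    rw [norm_mul, norm_pow, pow_succ, ← mul_assoc]
    have h1 := hb (n + 1)
    have := (norm_nonneg _).trans h1
    gcongr
  rw [e]
  refine (tsum_of_norm_bounded (hs.mul_right _).hasSum hle).trans ?_
  rw [tsum_mul_right]
  gcongr
  linarith

lemma tendsto_qSer {c : ℕ → ℂ} (hc : PolyBdd c) {ι : Type*} {l : Filter ι} {f : ι → ℂ}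
    (hf : Tendsto (fun i => (f i).im) l atTop) : Tendsto (fun i => qSer c (f i)) l (𝓝 (c 0)) := by
  obtain ⟨K, hK, h⟩ := norm_qSer_sub_le hc
  rw [tendsto_iff_norm_sub_tendsto_zero]
  have h0 : Tendsto (fun i => K * ‖nome (f i)‖) l (𝓝 0) := by
    rw [← mul_zero K]
    refine Tendsto.const_mul _ ?_
    simp_rw [norm_nome]
    refine Real.tendsto_exp_atBot.comp (tendsto_neg_atTop_atBot.comp ?_)
    exact hf.const_mul_atTop (by positivity)
  refine squeeze_zero' (Eventually.of_forall fun _ => norm_nonneg _) ?_ h0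
  filter_upwards [hf.eventually_ge_atTop 1] with i hi using h _ hi

end ThreeBanana

namespace ThreeBanana

open UpperHalfPlane ModularForm CongruenceSubgroup Matrix.SpecialLinearGroup Filter Topology
open scoped MatrixGroups Real

/-- The congruence subgroup `Γ₀(6)` as a subgroup of `GL(2, ℝ)`. -/
noncomputable abbrev levelSix : Subgroup (GL (Fin 2) ℝ) := (Gamma0 6).map (mapGL ℝ)

lemma index_Gamma0_six_le : (Gamma0 6).index ≤ 36 := by
  let φ : (SL(2, ℤ) ⧸ Gamma0 6) → ZMod 6 × ZMod 6 := fun q => ((q.out 0 0 : ℤ), (q.out 1 0 : ℤ))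
  have hφ : Function.Injective φ := by
    intro p q h
    rw [← Quotient.out_eq' p, ← Quotient.out_eq' q]
    rw [Quotient.eq'', QuotientGroup.leftRel_apply, Gamma0_mem]
    obtain ⟨h1, h2⟩ := Prod.ext_iff.mp h
    simp only [φ] at h1 h2

    have : ((p.out)⁻¹ * q.out) 1 0 = -(p.out 1 0) * q.out 0 0 + p.out 0 0 * q.out 1 0 := by
      rw [Matrix.SpecialLinearGroup.coe_mul, Matrix.mul_apply, Fin.sum_univ_two,
        Matrix.SpecialLinearGroup.coe_inv, Matrix.adjugate_fin_two]
      simp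
    rw [this]
    push_cast
    rw [h1, h2]; ring
  have := Nat.card_le_card_of_injective φ hφ
  simpa [Subgroup.index] using this

lemma relIndex_levelSix_le : Nat.card (𝒮ℒ ⧸ levelSix.subgroupOf 𝒮ℒ) ≤ 36 := by
  have : Nat.card (𝒮ℒ ⧸ levelSix.subgroupOf 𝒮ℒ) = levelSix.relIndex 𝒮ℒ := rfl
  rw [this, MonoidHom.range_eq_map, Subgroup.relIndex_map_map_of_injective _ _ mapGL_injective,
    Subgroup.relIndex_top_right]
  exact index_Gamma0_six_le

lemma le_order_qExpansion {k : ℤ} (F : ModularForm 𝒮ℒ k) (m : ℕ)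
    (h : (F : ℍ → ℂ) =O[atImInfty] fun z => Real.exp (-(2 * π * m * z.im))) :
    (m : ℕ∞) ≤ (qExpansion 1 F).order := by
  refine PowerSeries.nat_le_order _ _ fun n hn => ?_
  obtain ⟨C, hC⟩ := h.bound
  obtain ⟨Y, hY⟩ := (atImInfty_mem _).mp hC
  have key : ∀ t : ℝ, max Y 1 ≤ t → ‖(qExpansion 1 F).coeff n‖ ≤
      C * Real.exp (-(2 * π * t)) := by
    intro t ht
    have ht0 : 0 < t := lt_of_lt_of_le one_pos ((le_max_right _ _).trans ht)
    rw [ModularFormClass.qExpansion_coeff_eq_intervalIntegral (F := ModularForm 𝒮ℒ k)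
      (Γ := 𝒮ℒ) (k := k) F one_pos (by simp) n ht0]
    rw [show (1 / ((1 : ℝ) : ℂ)) = 1 by simp, one_mul]
    refine (intervalIntegral.norm_integral_le_of_norm_le_const
      (C := C * Real.exp (-(2 * π * t))) fun u _ => ?_).trans (by simp)
    have h1 := hY ⟨u + t * Complex.I, by simpa using ht0⟩ (by
      change Y ≤ (u + t * Complex.I : ℂ).im
      simpa using (le_max_left _ _).trans ht)
    simp only [Set.mem_ofPred_eq] at h1
    rw [Real.norm_of_nonneg (Real.exp_pos _).le] at h1
    have him : (⟨u + t * Complex.I, by simpa using ht0⟩ : ℍ).im = t := by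
      change (u + t * Complex.I : ℂ).im = t
      simp
    rw [him] at h1
    have hC0 : 0 ≤ C := by
      by_contra hneg
      push Not at hneg
      have := (norm_nonneg _).trans h1
      have := mul_neg_of_neg_of_pos hneg (Real.exp_pos (-(2 * π * m * t)))
      linarith
    rw [norm_mul, norm_div, norm_pow, norm_one, Function.Periodic.norm_qParam]
    have h2 : 1 / Real.exp (-2 * π * (u + t * Complex.I : ℂ).im / 1) ^ n =
        Real.exp (2 * π * n * t) := by
      rw [← Real.exp_nat_mul, one_div, ← Real.exp_neg]
      congr 1; simp; ring
    rw [h2]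
    calc Real.exp (2 * π * n * t) * ‖F ⟨u + t * Complex.I, by simpa using ht0⟩‖
        ≤ Real.exp (2 * π * n * t) * (C * Real.exp (-(2 * π * m * t))) := by gcongr
      _ = C * Real.exp (2 * π * n * t + -(2 * π * m * t)) := by rw [Real.exp_add]; ring
      _ ≤ C * Real.exp (-(2 * π * t)) := by
        gcongr
        have : (n : ℝ) + 1 ≤ m := by exact_mod_cast hn
        have := Real.pi_pos
        have h3 : 0 ≤ 2 * π * t * (m - (n + 1)) := by
          apply mul_nonneg (by positivity); linarith
        nlinarith
  have hlim : Tendsto (fun t : ℝ => C * Real.exp (-(2 * π * t))) atTop (𝓝 (C * 0)) := by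
    refine Tendsto.const_mul _ (Real.tendsto_exp_atBot.comp (tendsto_neg_atTop_atBot.comp ?_))
    exact tendsto_id.const_mul_atTop (by positivity)
  rw [mul_zero] at hlim
  have := ge_of_tendsto hlim ((eventually_ge_atTop (max Y 1)).mono key)
  exact norm_le_zero_iff.mp this

/-- Sturm's bound for weight four and level six (with a crude constant). -/
theorem sturm_levelSix (f : ModularForm levelSix 4)
    (h : (f : ℍ → ℂ) =O[atImInfty] fun z => Real.exp (-(2 * π * 13 * z.im))) :
    (f : ℍ → ℂ) = 0 := by
  rw [← ModularForm.norm_eq_zero_iff 𝒮ℒ]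
  refine ModularForm.sturm_bound_levelOne (lt_of_lt_of_le ?_ (le_order_qExpansion _ 13 ?_))
  · have h1 := relIndex_levelSix_le
    have h2 : ((4 : ℤ) * Nat.card (𝒮ℒ ⧸ levelSix.subgroupOf 𝒮ℒ)).toNat / 12 ≤ 12 := by omega
    calc _ ≤ ((12 : ℕ) : ℕ∞) := by exact_mod_cast h2
      _ < 13 := by norm_num
  · rw [ModularForm.coe_norm]
    classical
    let := Fintype.ofFinite (𝒮ℒ ⧸ levelSix.subgroupOf 𝒮ℒ)
    have hfac : ∀ q : 𝒮ℒ ⧸ levelSix.subgroupOf 𝒮ℒ,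
        SlashInvariantForm.quotientFunc f q =O[atImInfty] (1 : ℍ → ℝ) := by
      refine Quotient.forall.mpr fun ⟨r, hr⟩ => ?_
      have h2 := (translate f r⁻¹).bdd_at_cusps' (c := OnePoint.infty) ?_ 1 (by simp)
      · rw [SlashAction.slash_one] at h2
        exact h2
      · have h3 : IsCusp OnePoint.infty 𝒮ℒ :=
          isCusp_SL2Z_iff'.mpr ⟨1, by simp⟩
        have h4 := h3.of_isFiniteRelIndex_conj (𝒢 := levelSix) hr
        simpa using h4
    have hid : SlashInvariantForm.quotientFunc f (⟦1⟧ : 𝒮ℒ ⧸ levelSix.subgroupOf 𝒮ℒ) = f := by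
      rw [SlashInvariantForm.quotientFunc_mk]; simp
    have := Fintype.prod_eq_mul_prod_compl (⟦1⟧ : 𝒮ℒ ⧸ levelSix.subgroupOf 𝒮ℒ)
      (fun q => SlashInvariantForm.quotientFunc f q)
    rw [hid] at this
    have hrest : (∏ q ∈ {(⟦1⟧ : 𝒮ℒ ⧸ levelSix.subgroupOf 𝒮ℒ)}ᶜ,
        SlashInvariantForm.quotientFunc f q) =O[atImInfty] (1 : ℍ → ℝ) := by
      rw [show (1 : ℍ → ℝ) = fun x => ∏ q ∈ {(⟦1⟧ : 𝒮ℒ ⧸ levelSix.subgroupOf 𝒮ℒ)}ᶜ, (1 : ℝ) by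
        ext; simp, Finset.prod_fn]
      exact Asymptotics.IsBigO.finsetProd fun q _ => hfac q
    have h5 := h.mul hrest
    have h6 := Asymptotics.IsBigO.congr h5 (fun x => (congrFun this x).symm)
      (g₂ := fun z : ℍ => Real.exp (-(2 * π * (13 : ℕ) * z.im))) (fun x => by simp)
    exact h6

end ThreeBanana

namespace ThreeBanana

open Complex Filter Topology Set

lemma PolyBdd.exists_nonneg {c : ℕ → ℂ} (hc : PolyBdd c) :
    ∃ (C : ℝ) (k : ℕ), 0 ≤ C ∧ ∀ n, ‖c n‖ ≤ C * ((n : ℝ) + 1) ^ k := by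
  obtain ⟨C, k, h⟩ := hc
  refine ⟨C, k, ?_, h⟩
  simpa using (norm_nonneg _).trans (h 0)

lemma PolyBdd.add {c d : ℕ → ℂ} (hc : PolyBdd c) (hd : PolyBdd d) :
    PolyBdd fun n => c n + d n := by
  obtain ⟨C, k, hC, h⟩ := hc.exists_nonneg
  obtain ⟨D, l, hD, h'⟩ := hd.exists_nonneg
  refine ⟨C + D, k + l, fun n => (norm_add_le _ _).trans ?_⟩
  have hn : (1 : ℝ) ≤ (n : ℝ) + 1 := by have := n.cast_nonneg (α := ℝ); linarith
  rw [add_mul]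
  refine add_le_add ((h n).trans ?_) ((h' n).trans ?_)
  · exact mul_le_mul_of_nonneg_left (pow_le_pow_right₀ hn (by omega)) hC
  · exact mul_le_mul_of_nonneg_left (pow_le_pow_right₀ hn (by omega)) hD

lemma PolyBdd.const_mul {c : ℕ → ℂ} (a : ℂ) (hc : PolyBdd c) : PolyBdd fun n => a * c n := by
  obtain ⟨C, k, h⟩ := hc
  refine ⟨‖a‖ * C, k, fun n => ?_⟩
  rw [norm_mul, mul_assoc]
  exact mul_le_mul_of_nonneg_left (h n) (norm_nonneg _)

/-- Cauchy product of coefficient sequences. -/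
def conv {R : Type*} [Semiring R] (c d : ℕ → R) (n : ℕ) : R :=
  ∑ p ∈ Finset.HasAntidiagonal.antidiagonal n, c p.1 * d p.2

/-- Coefficients of `∑ c n q^(d n)`. -/
def dilate {R : Type*} [Zero R] (d : ℕ) (c : ℕ → R) (n : ℕ) : R := if d ∣ n then c (n / d) else 0

lemma PolyBdd.conv {c d : ℕ → ℂ} (hc : PolyBdd c) (hd : PolyBdd d) : PolyBdd (conv c d) := by
  obtain ⟨C, k, hC, h⟩ := hc.exists_nonneg
  obtain ⟨D, l, hD, h'⟩ := hd.exists_nonneg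
  refine ⟨C * D, k + l + 1, fun n => (norm_sum_le _ _).trans ?_⟩
  have : ∀ p ∈ Finset.HasAntidiagonal.antidiagonal n, ‖c p.1 * d p.2‖ ≤ C * D * ((n : ℝ) + 1) ^ (k + l) := by
    intro p hp
    have hp' := Finset.HasAntidiagonal.mem_antidiagonal.mp hp
    have h1 : ((p.1 : ℝ) + 1) ≤ n + 1 := by
      have : (p.1 : ℝ) ≤ n := by exact_mod_cast (by omega : p.1 ≤ n)
      linarith
    have h2 : ((p.2 : ℝ) + 1) ≤ n + 1 := by
      have : (p.2 : ℝ) ≤ n := by exact_mod_cast (by omega : p.2 ≤ n)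
      linarith
    rw [norm_mul]
    calc ‖c p.1‖ * ‖d p.2‖ ≤ (C * ((p.1 : ℝ) + 1) ^ k) * (D * ((p.2 : ℝ) + 1) ^ l) :=
          mul_le_mul (h _) (h' _) (norm_nonneg _) (by positivity)
      _ ≤ (C * ((n : ℝ) + 1) ^ k) * (D * ((n : ℝ) + 1) ^ l) := by gcongr
      _ = _ := by ring
  refine (Finset.sum_le_card_nsmul _ _ _ this).trans_eq ?_
  rw [Finset.Nat.card_antidiagonal, nsmul_eq_mul]
  push_cast; ring

lemma PolyBdd.dilate {c : ℕ → ℂ} (hc : PolyBdd c) (d : ℕ) : PolyBdd (dilate d c) := by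
  obtain ⟨C, k, hC, h⟩ := hc.exists_nonneg
  refine ⟨C, k, fun n => ?_⟩
  rw [ThreeBanana.dilate]
  split_ifs
  · refine (h _).trans (mul_le_mul_of_nonneg_left (pow_le_pow_left₀ (by positivity) ?_ _) hC)
    have : ((n / d : ℕ) : ℝ) ≤ n := by exact_mod_cast Nat.div_le_self n d
    linarith
  · rw [norm_zero]; positivity

lemma qSer_add {c d : ℕ → ℂ} (hc : PolyBdd c) (hd : PolyBdd d) {τ : ℂ} (h : 0 < τ.im) :
    qSer (fun n => c n + d n) τ = qSer c τ + qSer d τ := by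
  simp only [qSer]
  rw [← (hc.hasSum h).summable.tsum_add (hd.hasSum h).summable]
  simp only [add_mul]

lemma qSer_const_mul (a : ℂ) (c : ℕ → ℂ) (τ : ℂ) :
    qSer (fun n => a * c n) τ = a * qSer c τ := by
  simp only [qSer]
  rw [← tsum_mul_left]
  simp only [mul_assoc]

lemma qSer_mul {c d : ℕ → ℂ} (hc : PolyBdd c) (hd : PolyBdd d) {τ : ℂ} (h : 0 < τ.im) :
    qSer c τ * qSer d τ = qSer (conv c d) τ := by
  have hq := norm_nome_lt_one h
  simp only [qSer]
  rw [tsum_mul_tsum_eq_tsum_sum_antidiagonal_of_summable_norm (hc.summable_norm hq)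
    (hd.summable_norm hq)]
  refine tsum_congr fun n => ?_
  rw [conv, Finset.sum_mul]
  refine Finset.sum_congr rfl fun p hp => ?_
  rw [← Finset.HasAntidiagonal.mem_antidiagonal.mp hp, pow_add]; ring

lemma qSer_dilate {d : ℕ} (hd : 0 < d) (c : ℕ → ℂ) (τ : ℂ) :
    qSer (dilate d c) τ = qSer c (d * τ) := by
  simp only [qSer, nome_nat_mul, ← pow_mul]
  have hinj : Function.Injective (fun n : ℕ => d * n) := fun a b hab => Nat.eq_of_mul_eq_mul_left hd hab
  rw [← hinj.tsum_eq (f := fun n => dilate d c n * nome τ ^ n)]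
  · refine tsum_congr fun n => ?_
    simp [dilate, Nat.mul_div_cancel_left _ hd]
  · intro n hn
    by_contra hcon
    apply hn
    have : ¬ d ∣ n := fun ⟨m, hm⟩ => hcon ⟨m, hm.symm⟩
    simp [dilate, this]

/-- Coefficients of the Eisenstein series of weight 2. -/
def coeffTwo (n : ℕ) : ℤ := if n = 0 then 1 else -24 * ∑ d ∈ n.divisors, (d : ℤ)

/-- Coefficients of the Eisenstein series of weight 4. -/
def coeffFour (n : ℕ) : ℤ := if n = 0 then 1 else 240 * ∑ d ∈ n.divisors, (d : ℤ) ^ 3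

lemma sum_divisors_pow_le (k n : ℕ) :
    ‖((∑ d ∈ n.divisors, (d : ℤ) ^ k : ℤ) : ℂ)‖ ≤ ((n : ℝ) + 1) ^ (k + 1) := by
  have h := ArithmeticFunction.sigma_le_pow_succ k n
  rw [ArithmeticFunction.sigma_apply] at h
  have e : ((∑ d ∈ n.divisors, (d : ℤ) ^ k : ℤ) : ℂ) = ((∑ d ∈ n.divisors, d ^ k : ℕ) : ℂ) := by
    push_cast; rfl
  rw [e, Complex.norm_natCast]
  calc ((∑ d ∈ n.divisors, d ^ k : ℕ) : ℝ) ≤ (n ^ (k + 1) : ℕ) := by exact_mod_cast h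
    _ ≤ _ := by push_cast; gcongr; linarith

lemma polyBdd_coeffTwo : PolyBdd fun n => (coeffTwo n : ℂ) := by
  refine ⟨24, 2, fun n => ?_⟩
  rcases eq_or_ne n 0 with rfl | hn
  · simp [coeffTwo]
  · have := sum_divisors_pow_le 1 n
    simp only [coeffTwo, hn, if_false]
    simp only [pow_one] at this
    rw [Int.cast_mul, norm_mul]
    have h2 : ‖((-24 : ℤ) : ℂ)‖ = 24 := by norm_num
    rw [h2]; gcongr

lemma polyBdd_coeffFour : PolyBdd fun n => (coeffFour n : ℂ) := by
  refine ⟨240, 4, fun n => ?_⟩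
  rcases eq_or_ne n 0 with rfl | hn
  · simp [coeffFour]
  · have := sum_divisors_pow_le 3 n
    simp only [coeffFour, hn, if_false]
    rw [Int.cast_mul, norm_mul]
    have h2 : ‖((240 : ℤ) : ℂ)‖ = 240 := by norm_num
    rw [h2]; gcongr

/-- The weight 2 Eisenstein series as a function on `ℂ`. -/
noncomputable def eisTwo (τ : ℂ) : ℂ := qSer (fun n => (coeffTwo n : ℂ)) τ

/-- The weight 4 Eisenstein series as a function on `ℂ`. -/
noncomputable def eisFour (τ : ℂ) : ℂ := qSer (fun n => (coeffFour n : ℂ)) τ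

lemma eisTwo_coe (z : UpperHalfPlane) : EisensteinSeries.E2 z = eisTwo z := by
  rw [eisTwo, qSer, ← (EisensteinSeries.hasSum_qExpansion_E2 z).tsum_eq]
  refine tsum_congr fun n => ?_
  simp only [smul_eq_mul, nome]
  congr 1
  rcases eq_or_ne n 0 with rfl | hn
  · simp [coeffTwo]
  · simp [coeffTwo, hn, ArithmeticFunction.sigma_one_apply]

lemma eisFour_coe (z : UpperHalfPlane) : ModularForm.E (show 3 ≤ 4 by norm_num) z = eisFour z := by
  have h := EisensteinSeries.q_expansion_bernoulli (k := 4) (by norm_num) (by decide) z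
  have hS := EisensteinSeries.summable_sigma_mul_cexp_pow (k := 4) (by norm_num) z
  rw [h, eisFour, qSer, (polyBdd_coeffFour.hasSum z.im_pos).summable.tsum_eq_zero_add]
  simp_rw [zpow_natCast]
  rw [tsum_pnat_eq_tsum_succ
    (f := fun n ↦ (ArithmeticFunction.sigma (4 - 1) n : ℂ) * cexp (2 * Real.pi * I * z) ^ n)]
  have hb : bernoulli 4 = -1 / 30 := by
    rw [bernoulli_eq_bernoulli'_of_ne_one (by norm_num)]; exact bernoulli'_four
  rw [hb, sub_eq_add_neg, ← neg_mul, ← tsum_mul_left]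
  simp only [coeffFour, nome]
  congr 1
  · simp
  · refine tsum_congr fun n => ?_
    simp [ArithmeticFunction.sigma_apply]
    ring

end ThreeBanana

namespace ThreeBanana

open Complex Filter Topology Set
open UpperHalfPlane hiding I
open scoped MatrixGroups Manifold ModularForm

lemma PolyBdd.shift {c : ℕ → ℂ} (hc : PolyBdd c) (m : ℕ) : PolyBdd fun n => c (n + m) := by
  obtain ⟨C, k, hC, h⟩ := hc.exists_nonneg
  refine ⟨C * ((m : ℝ) + 1) ^ k, k, fun n => (h _).trans ?_⟩
  rw [mul_assoc, ← mul_pow]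
  refine mul_le_mul_of_nonneg_left (pow_le_pow_left₀ (by positivity) ?_ _) hC
  push_cast
  have : 0 ≤ (m : ℝ) * n := by positivity
  nlinarith

lemma isBigO_qSer {c : ℕ → ℂ} (hc : PolyBdd c) (m : ℕ) (h0 : ∀ n < m, c n = 0) :
    (fun z : ℍ => qSer c z) =O[atImInfty] fun z => Real.exp (-(2 * Real.pi * m * z.im)) := by
  obtain ⟨K, hK, hb⟩ := norm_qSer_sub_le (hc.shift m)
  refine Asymptotics.IsBigO.of_bound (‖c m‖ + K) ?_
  rw [Filter.Eventually, atImInfty_mem]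
  refine ⟨1, fun z hz => ?_⟩
  have e : qSer c z = qSer (fun n => c (n + m)) z * nome z ^ m := by
    have := (hc.hasSum z.im_pos).summable.sum_add_tsum_nat_add m
    rw [qSer, ← this, Finset.sum_eq_zero, zero_add, qSer, ← tsum_mul_right]
    · exact tsum_congr fun n => by rw [pow_add]; ring
    · intro i hi; rw [h0 i (Finset.mem_range.mp hi), zero_mul]
  have h1 := hb z hz
  have hq : ‖nome z‖ ≤ 1 := (norm_nome_lt_one z.im_pos).le
  have h2 : ‖qSer (fun n => c (n + m)) z‖ ≤ ‖c m‖ + K := by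
    have h3 : ‖qSer (fun n => c (n + m)) z‖ ≤ ‖c (0 + m)‖ + K * ‖nome z‖ := by
      calc _ = ‖c (0 + m) + (qSer (fun n => c (n + m)) z - c (0 + m))‖ := by
            rw [add_sub_cancel]
        _ ≤ _ := (norm_add_le _ _).trans (by gcongr)
    rw [zero_add] at h3
    nlinarith
  change ‖qSer c z‖ ≤ _
  rw [e, norm_mul, norm_pow, Real.norm_of_nonneg (Real.exp_pos _).le]
  refine mul_le_mul h2 (le_of_eq ?_) (by positivity) (by positivity)
  rw [norm_nome, ← Real.exp_nat_mul]
  congr 1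
  change _ = -(2 * Real.pi * m * (z : ℂ).im)
  ring

lemma differentiableAt_qSer {c : ℕ → ℂ} (hc : PolyBdd c) {τ : ℂ} (h : 0 < τ.im) :
    DifferentiableAt ℂ (qSer c) τ := (hasDerivAt_qSer hc h).differentiableAt

lemma mdifferentiable_of {f : ℂ → ℂ} (h : ∀ τ : ℂ, 0 < τ.im → DifferentiableAt ℂ f τ) :
    MDiff (fun z : ℍ => f z) := by
  rw [UpperHalfPlane.mdifferentiable_iff]
  refine DifferentiableOn.congr (f := f) (fun z hz => (h z hz).differentiableWithinAt) ?_
  intro z hz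
  simp [ofComplex_apply_of_im_pos hz]

lemma eisTwo_inv {w : ℂ} (hw : 0 < w.im) :
    eisTwo (-1 / w) = w ^ 2 * eisTwo w + 6 * w / (Real.pi * I) := by
  have h := congrFun (EisensteinSeries.E2_slash_action ModularGroup.S) ⟨w, hw⟩
  have hw0 : w ≠ 0 := by rintro rfl; simp at hw
  have hpi : (Real.pi : ℂ) ≠ 0 := ofReal_ne_zero.mpr Real.pi_ne_zero
  rw [ModularForm.SL_slash_apply, Pi.sub_apply, Pi.smul_apply, EisensteinSeries.D2_S] at h
  rw [eisTwo_coe, eisTwo_coe, riemannZeta_two, UpperHalfPlane.modular_S_smul] at h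
  rw [ModularGroup.denom_S] at h
  change eisTwo ((-w)⁻¹) * w ^ (-2 : ℤ) =
    eisTwo w - (1 / (2 * ((Real.pi : ℂ) ^ 2 / 6))) * (2 * Real.pi * I / w) at h
  rw [show (-w)⁻¹ = -1 / w by rw [div_eq_mul_inv, inv_neg]; ring] at h
  have h2 : eisTwo (-1 / w) = w ^ 2 * (eisTwo (-1 / w) * w ^ (-2 : ℤ)) := by
    rw [zpow_neg]; norm_cast; field_simp
  rw [h2, h]
  field_simp
  linear_combination (-6) * I_sq

lemma eisFour_inv {w : ℂ} (hw : 0 < w.im) : eisFour (-1 / w) = w ^ 4 * eisFour w := by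
  have h : (ModularForm.E (show 3 ≤ 4 by norm_num) : ℍ → ℂ) ∣[((4 : ℕ) : ℤ)] ModularGroup.S =
      ModularForm.E (show 3 ≤ 4 by norm_num) :=
    (ModularForm.E (show 3 ≤ 4 by norm_num)).slash_action_eq' _ ⟨ModularGroup.S, rfl⟩
  have h := congrFun h ⟨w, hw⟩
  have hw0 : w ≠ 0 := by rintro rfl; simp at hw
  rw [ModularForm.SL_slash_apply, eisFour_coe, eisFour_coe, UpperHalfPlane.modular_S_smul,
    ModularGroup.denom_S] at h
  change eisFour ((-w)⁻¹) * w ^ (-((4 : ℕ) : ℤ)) = eisFour w at h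
  rw [show (-w)⁻¹ = -1 / w by rw [div_eq_mul_inv, inv_neg]; ring, zpow_neg, zpow_natCast] at h
  rw [← h]; field_simp

lemma im_inv_pos {w : ℂ} (hw : 0 < w.im) : 0 < (-1 / w).im := by
  rw [neg_div, one_div, neg_im, inv_im]
  have : 0 < normSq w := normSq_pos.mpr (by rintro rfl; simp at hw)
  rw [neg_div, neg_neg]; positivity

/-- The logarithmic derivative `q d/dq` of the weight 2 Eisenstein series. -/
noncomputable def thetaEisTwo (τ : ℂ) : ℂ := qSer (fun n => (n : ℂ) * (coeffTwo n : ℂ)) τ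

lemma hasDerivAt_eisTwo {τ : ℂ} (h : 0 < τ.im) :
    HasDerivAt eisTwo (2 * Real.pi * I * thetaEisTwo τ) τ := hasDerivAt_qSer polyBdd_coeffTwo h

lemma thetaEisTwo_inv {w : ℂ} (hw : 0 < w.im) :
    thetaEisTwo (-1 / w) = w ^ 4 * thetaEisTwo w + w ^ 3 * eisTwo w / (Real.pi * I)
      + 3 * w ^ 2 / (Real.pi * I) ^ 2 := by
  have hw0 : w ≠ 0 := by rintro rfl; simp at hw
  have hpi : (Real.pi : ℂ) ≠ 0 := ofReal_ne_zero.mpr Real.pi_ne_zero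
  have h1 : HasDerivAt (fun x : ℂ => -1 / x) (1 / w ^ 2) w := by
    have := (hasDerivAt_inv hw0).const_mul (-1)
    refine (this.congr_deriv (by field_simp)).congr_of_eventuallyEq (Eventually.of_forall fun x => ?_)
    change -1 / x = -1 * x⁻¹
    rw [div_eq_mul_inv]
  have h2 := (hasDerivAt_eisTwo (im_inv_pos hw)).comp w h1
  have h3 := (((hasDerivAt_id w).pow 2).mul (hasDerivAt_eisTwo hw)).add
    (((hasDerivAt_id w).const_mul 6).div_const (Real.pi * I))
  have hev : (fun x => eisTwo (-1 / x)) =ᶠ[𝓝 w]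
      fun x => x ^ 2 * eisTwo x + 6 * x / (Real.pi * I) := by
    filter_upwards [(isOpen_lt continuous_const Complex.continuous_im).mem_nhds hw] with x hx
    exact eisTwo_inv hx
  have h4 := (h3.congr_of_eventuallyEq hev).unique h2
  simp only [id] at h4
  have h5 : thetaEisTwo (-1 / w) = w ^ 2 / (2 * Real.pi * I) *
    (2 * Real.pi * I * thetaEisTwo (-1 / w) * (1 / w ^ 2)) := by field_simp
  rw [h5, ← h4]
  norm_num
  field_simp
  ring

/-- The difference of the two sides of Ramanujan's formula for `θ E₂`, times 12. -/
def ramanujanCoeff (n : ℕ) : ℂ :=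
  12 * ((n : ℂ) * (coeffTwo n : ℂ)) + (-1 * conv (fun n => (coeffTwo n : ℂ))
    (fun n => (coeffTwo n : ℂ)) n + (coeffFour n : ℂ))

lemma polyBdd_ramanujanCoeff : PolyBdd ramanujanCoeff :=
  (polyBdd_coeffTwo.nat_mul.const_mul 12).add
    (((polyBdd_coeffTwo.conv polyBdd_coeffTwo).const_mul (-1)).add polyBdd_coeffFour)

lemma qSer_ramanujanCoeff {τ : ℂ} (h : 0 < τ.im) :
    qSer ramanujanCoeff τ = 12 * thetaEisTwo τ - eisTwo τ ^ 2 + eisFour τ := by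
  have h1 := qSer_add (polyBdd_coeffTwo.nat_mul.const_mul 12)
    (((polyBdd_coeffTwo.conv polyBdd_coeffTwo).const_mul (-1)).add polyBdd_coeffFour) h
  have h2 := qSer_add ((polyBdd_coeffTwo.conv polyBdd_coeffTwo).const_mul (-1))
    polyBdd_coeffFour h
  rw [h2, qSer_const_mul, qSer_const_mul, ← qSer_mul polyBdd_coeffTwo polyBdd_coeffTwo h] at h1
  refine Eq.trans h1 ?_
  rw [eisTwo, thetaEisTwo, eisFour]; ring

lemma qSer_ramanujanCoeff_inv {w : ℂ} (hw : 0 < w.im) :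
    qSer ramanujanCoeff (-1 / w) = w ^ 4 * qSer ramanujanCoeff w := by
  have hpi : (Real.pi : ℂ) ≠ 0 := ofReal_ne_zero.mpr Real.pi_ne_zero
  rw [qSer_ramanujanCoeff hw, qSer_ramanujanCoeff (im_inv_pos hw), thetaEisTwo_inv hw,
    eisTwo_inv hw, eisFour_inv hw]
  field_simp
  ring

lemma slash_of_inv {c : ℕ → ℂ} {k : ℕ}
    (h : ∀ w : ℂ, 0 < w.im → qSer c (-1 / w) = w ^ k * qSer c w) (γ : SL(2, ℤ)) :
    (fun z : ℍ => qSer c z) ∣[(k : ℤ)] γ = fun z : ℍ => qSer c z := by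
  refine SlashInvariantForm.slash_action_generators_SL2Z ?_ ?_ γ
  · ext z
    rw [ModularForm.SL_slash_apply, UpperHalfPlane.modular_S_smul, ModularGroup.denom_S]
    have hz : (z : ℂ) ≠ 0 := UpperHalfPlane.ne_zero z
    rw [UpperHalfPlane.coe_mk, show (-(z : ℂ))⁻¹ = -1 / (z : ℂ) by
      rw [div_eq_mul_inv, inv_neg]; ring, h _ z.im_pos, zpow_neg, zpow_natCast]
    field_simp
  · ext z
    rw [ModularForm.SL_slash_apply, UpperHalfPlane.modular_T_smul,
      show denom (ModularGroup.T : GL (Fin 2) ℝ) z = 1 by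
        rw [ModularGroup.denom_apply]; simp [ModularGroup.T],
      one_zpow, mul_one]
    rw [UpperHalfPlane.coe_vadd, add_comm]
    push_cast
    exact qSer_add_one c z

/-- A Fourier series with the transformation behaviour of a level one modular form. -/
noncomputable def levelOneForm {c : ℕ → ℂ} (hc : PolyBdd c) {k : ℕ}
    (h : ∀ w : ℂ, 0 < w.im → qSer c (-1 / w) = w ^ k * qSer c w) : ModularForm 𝒮ℒ k where
  toFun := fun z : ℍ => qSer c z
  slash_action_eq' A hA := by
    obtain ⟨A, rfl⟩ := hA
    exact slash_of_inv h A
  holo' := mdifferentiable_of fun τ hτ => differentiableAt_qSer hc hτ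
  bdd_at_cusps' hcu := by
    rw [Subgroup.IsArithmetic.isCusp_iff_isCusp_SL2Z] at hcu
    rw [OnePoint.isBoundedAt_iff_forall_SL2Z hcu]
    intro γ _
    rw [slash_of_inv h]
    have := isBigO_qSer hc 0 (by simp)
    rw [IsBoundedAtImInfty, BoundedAtFilter]
    refine this.congr_right fun z => ?_
    simp

/-- Ramanujan's formula for the derivative of `E₂`. -/
lemma thetaEisTwo_eq {τ : ℂ} (h : 0 < τ.im) :
    thetaEisTwo τ = (eisTwo τ ^ 2 - eisFour τ) / 12 := by
  have h0 : levelOneForm polyBdd_ramanujanCoeff (fun w hw => qSer_ramanujanCoeff_inv hw) = 0 := by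
    refine ModularForm.sturm_bound_levelOne (lt_of_lt_of_le ?_ (le_order_qExpansion _ 1 ?_))
    · norm_num
    · refine isBigO_qSer polyBdd_ramanujanCoeff 1 fun n hn => ?_
      obtain rfl : n = 0 := by omega
      simp [ramanujanCoeff, conv, coeffTwo, coeffFour]
  have h1 : qSer ramanujanCoeff τ = 0 := by
    have := congrArg (fun f : ModularForm 𝒮ℒ ((4 : ℕ) : ℤ) => f ⟨τ, h⟩) h0
    exact this
  rw [qSer_ramanujanCoeff h] at h1
  linear_combination h1 / 12

end ThreeBanana

namespace ThreeBanana

open Complex Filter Topology Set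
open UpperHalfPlane hiding I
open scoped MatrixGroups Manifold ModularForm
open ModularForm CongruenceSubgroup Matrix.SpecialLinearGroup

/-- The matrix `diag(d, 1)`. -/
noncomputable def dilMat (d : ℕ) (hd : 0 < d) : GL (Fin 2) ℝ :=
  Matrix.GeneralLinearGroup.mkOfDetNeZero !![(d : ℝ), 0; 0, 1] (by
    rw [Matrix.det_fin_two_of]; simp [hd.ne'])

lemma dilMat_coe (d : ℕ) (hd : 0 < d) :
    (dilMat d hd : Matrix (Fin 2) (Fin 2) ℝ) = !![(d : ℝ), 0; 0, 1] := rfl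

lemma det_dilMat (d : ℕ) (hd : 0 < d) : (dilMat d hd).det.val = d := by
  change (dilMat d hd : Matrix (Fin 2) (Fin 2) ℝ).det = d
  rw [dilMat_coe, Matrix.det_fin_two_of]; simp

lemma slash_dilMat (f : ℍ → ℂ) (k : ℤ) (d : ℕ) (hd : 0 < d) (z : ℍ) :
    (f ∣[k] dilMat d hd) z = (d : ℂ) ^ (k - 1) * f (dilMat d hd • z) := by
  have hdet : 0 < (dilMat d hd).det.val := by rw [det_dilMat]; exact_mod_cast hd
  rw [ModularForm.slash_apply, det_dilMat]
  have h1 : denom (dilMat d hd) z = 1 := by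
    simp [denom, dilMat_coe]
  rw [h1, σ, if_pos hdet]
  simp
  ring

lemma coe_dilMat_smul (d : ℕ) (hd : 0 < d) (z : ℍ) : ((dilMat d hd • z : ℍ) : ℂ) = d * z := by
  have hdet : 0 < (dilMat d hd).det.val := by rw [det_dilMat]; exact_mod_cast hd
  rw [UpperHalfPlane.coe_smul_of_det_pos hdet]
  simp [num, denom, dilMat_coe]

lemma mapGL_entry (γ : SL(2, ℤ)) (i j : Fin 2) :
    (mapGL ℝ γ : Matrix (Fin 2) (Fin 2) ℝ) i j = ((γ i j : ℤ) : ℝ) := by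
  simp

lemma exists_commute (d : ℕ) (hd : 0 < d) (hd6 : d ∣ 6) {γ : SL(2, ℤ)} (hγ : γ ∈ Gamma0 6) :
    ∃ γ' : SL(2, ℤ), dilMat d hd * mapGL ℝ γ = mapGL ℝ γ' * dilMat d hd ∧
      γ' 1 0 * d = γ 1 0 ∧ γ' 1 1 = γ 1 1 := by
  have h6 : ((6 : ℕ) : ℤ) ∣ γ 1 0 := (ZMod.intCast_zmod_eq_zero_iff_dvd _ _).mp (Gamma0_mem.mp hγ)
  obtain ⟨c, hc⟩ := (Int.natCast_dvd_natCast.mpr hd6).trans h6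
  have hdet := γ.det_coe
  rw [Matrix.det_fin_two] at hdet
  obtain ⟨γ', h'⟩ : ∃ γ' : SL(2, ℤ), (γ' : Matrix (Fin 2) (Fin 2) ℤ) =
      !![γ 0 0, d * γ 0 1; c, γ 1 1] :=
    ⟨⟨!![γ 0 0, d * γ 0 1; c, γ 1 1], by
      rw [Matrix.det_fin_two_of]; rw [hc] at hdet; linarith⟩, rfl⟩
  have e00 : γ' 0 0 = γ 0 0 := by rw [h']; rfl
  have e01 : γ' 0 1 = d * γ 0 1 := by rw [h']; rfl
  have e10 : γ' 1 0 = c := by rw [h']; rfl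
  have e11 : γ' 1 1 = γ 1 1 := by rw [h']; rfl
  refine ⟨γ', ?_, ?_, e11⟩
  · ext i j
    simp only [Units.val_mul, dilMat_coe, Matrix.mul_apply, Fin.sum_univ_two, mapGL_entry]
    fin_cases i <;> fin_cases j <;> simp [-mapGL_coe_matrix, e00, e01, e10, e11, hc, mul_comm]
  · rw [e10, hc, mul_comm]

lemma exists_hermite (d : ℕ) (hd : 0 < d) (γ : SL(2, ℤ)) :
    ∃ (γ' : SL(2, ℤ)) (T : GL (Fin 2) ℝ), T 1 0 = 0 ∧
      dilMat d hd * mapGL ℝ γ = mapGL ℝ γ' * T := by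
  have hdet := γ.det_coe
  rw [Matrix.det_fin_two] at hdet
  have hne : ¬ (d * γ 0 0 = 0 ∧ γ 1 0 = 0) := by
    rintro ⟨h1, h2⟩
    have : γ 0 0 = 0 := by
      rcases mul_eq_zero.mp h1 with h | h
      · exact absurd (by exact_mod_cast h) hd.ne'
      · exact h
    rw [this, h2] at hdet; simp at hdet
  have hg : 0 < Int.gcd (d * γ 0 0) (γ 1 0) := by
    rw [Nat.pos_iff_ne_zero, Ne, Int.gcd_eq_zero_iff]; exact hne
  obtain ⟨a, b, hab, ha, hb⟩ := Int.exists_gcd_one hg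
  generalize ((Int.gcd (d * γ 0 0) (γ 1 0) : ℕ) : ℤ) = g at ha hb
  obtain ⟨γ', h0, h1⟩ := (Int.isCoprime_iff_gcd_eq_one.mpr hab).exists_SL2_col 0
  refine ⟨γ', (mapGL ℝ γ')⁻¹ * (dilMat d hd * mapGL ℝ γ), ?_, by group⟩
  rw [← map_inv]
  have : (((mapGL ℝ γ'⁻¹ * (dilMat d hd * mapGL ℝ γ) : GL (Fin 2) ℝ)) 1 0) =
    ((γ' 0 0 * γ 1 0 - γ' 1 0 * (d * γ 0 0) : ℤ) : ℝ) := by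
    simp only [Units.val_mul, dilMat_coe, mapGL_coe_matrix, map_apply_coe, RingHom.mapMatrix_apply,
      Matrix.mul_apply, Fin.sum_univ_two, Matrix.SpecialLinearGroup.coe_inv,
      Matrix.adjugate_fin_two]
    simp
    ring
  rw [this, h0, h1, ha, hb]
  push_cast; ring

lemma bounded_slash_dilMat {f : ℍ → ℂ} {k : ℤ}
    (h : ∀ γ : SL(2, ℤ), IsBoundedAtImInfty (f ∣[k] γ)) (d : ℕ) (hd : 0 < d) (γ : SL(2, ℤ)) :
    IsBoundedAtImInfty ((f ∣[k] dilMat d hd) ∣[k] γ) := by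
  obtain ⟨γ', T, hT, he⟩ := exists_hermite d hd γ
  rw [ModularForm.SL_slash, ← SlashAction.slash_mul]
  have e : dilMat d hd * (γ : GL (Fin 2) ℝ) = mapGL ℝ γ' * T := he
  rw [e, SlashAction.slash_mul]
  exact IsBoundedAtImInfty.slash k hT (h γ')

end ThreeBanana

namespace ThreeBanana

open Complex Filter Topology Set
open UpperHalfPlane hiding I
open scoped MatrixGroups Manifold ModularForm
open ModularForm CongruenceSubgroup Matrix.SpecialLinearGroup

/-- Modularity of weight `k` for `Γ₀(6)`. -/
structure IsModularSix (k : ℤ) (f : ℍ → ℂ) : Prop where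
  slash : ∀ γ ∈ Gamma0 6, f ∣[k] γ = f
  bounded : ∀ γ : SL(2, ℤ), IsBoundedAtImInfty (f ∣[k] γ)
  mdiff : MDiff f

namespace IsModularSix

lemma add {k : ℤ} {f g : ℍ → ℂ} (hf : IsModularSix k f) (hg : IsModularSix k g) :
    IsModularSix k (f + g) where
  slash γ hγ := by rw [SlashAction.add_slash, hf.slash γ hγ, hg.slash γ hγ]
  bounded γ := by
    rw [SlashAction.add_slash]; exact BoundedAtFilter.add (hf.bounded γ) (hg.bounded γ)
  mdiff := hf.mdiff.add hg.mdiff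

lemma smul {k : ℤ} {f : ℍ → ℂ} (a : ℂ) (hf : IsModularSix k f) : IsModularSix k (a • f) where
  slash γ hγ := by rw [SL_smul_slash, hf.slash γ hγ]
  bounded γ := by rw [SL_smul_slash]; exact BoundedAtFilter.smul a (hf.bounded γ)
  mdiff := hf.mdiff.const_smul a

lemma mul {k l : ℤ} {f g : ℍ → ℂ} (hf : IsModularSix k f) (hg : IsModularSix l g) :
    IsModularSix (k + l) (f * g) where
  slash γ hγ := by rw [mul_slash_SL2, hf.slash γ hγ, hg.slash γ hγ]
  bounded γ := by rw [mul_slash_SL2]; exact BoundedAtFilter.mul (hf.bounded γ) (hg.bounded γ)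
  mdiff := hf.mdiff.mul hg.mdiff

/-- The bundled modular form. -/
noncomputable def toForm {k : ℤ} {f : ℍ → ℂ} (hf : IsModularSix k f) : ModularForm levelSix k where
  toFun := f
  slash_action_eq' A hA := by
    obtain ⟨A, hA, rfl⟩ := hA
    exact hf.slash A hA
  holo' := hf.mdiff
  bdd_at_cusps' hcu := by
    rw [Subgroup.IsArithmetic.isCusp_iff_isCusp_SL2Z] at hcu
    rw [OnePoint.isBoundedAt_iff_forall_SL2Z hcu]
    exact fun γ _ => hf.bounded γ

lemma eq_zero {f : ℍ → ℂ} (hf : IsModularSix 4 f)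
    (h : f =O[atImInfty] fun z => Real.exp (-(2 * Real.pi * 13 * z.im))) : f = 0 :=
  sturm_levelSix hf.toForm h

end IsModularSix

lemma isBoundedAtImInfty_D2 (γ : SL(2, ℤ)) : IsBoundedAtImInfty (EisensteinSeries.D2 γ) := by
  rw [isBoundedAtImInfty_iff]
  refine ⟨2 * Real.pi, 1, fun z hz => ?_⟩
  have hpi := Real.pi_pos
  rw [EisensteinSeries.D2, norm_div, norm_mul, norm_mul, norm_mul]
  simp only [norm_I, mul_one, norm_intCast]
  have h1 : |(γ 1 0 : ℝ)| ≤ ‖denom γ z‖ := by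
    have h2 : (denom γ z).im = γ 1 0 * z.im := by
      rw [ModularGroup.denom_apply]; simp
    refine le_trans ?_ (abs_im_le_norm _)
    rw [h2, abs_mul]
    have : 1 ≤ |z.im| := hz.trans (le_abs_self _)
    have := abs_nonneg (γ 1 0 : ℝ)
    nlinarith
  have h3 : 0 < ‖denom γ z‖ := norm_pos_iff.mpr (denom_ne_zero _ _)
  rw [div_le_iff₀ h3]
  have : ‖(2 : ℂ)‖ = 2 := by norm_num
  have h4 : ‖(Real.pi : ℂ)‖ = Real.pi := by
    rw [norm_real, Real.norm_of_nonneg hpi.le]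
  rw [this, h4]
  gcongr

lemma bounded_E2_slash (γ : SL(2, ℤ)) :
    IsBoundedAtImInfty (EisensteinSeries.E2 ∣[(2 : ℤ)] γ) := by
  rw [EisensteinSeries.E2_slash_action, sub_eq_add_neg]
  exact BoundedAtFilter.add EisensteinSeries.isBoundedAtImInfty_E2
    (BoundedAtFilter.neg (BoundedAtFilter.smul _ (isBoundedAtImInfty_D2 γ)))

/-- `d E₂(dz)` -/
noncomputable def eisTwoDil (d : ℕ) (τ : ℂ) : ℂ := d * eisTwo (d * τ)

lemma E2_slash_dilMat (d : ℕ) (hd : 0 < d) :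
    EisensteinSeries.E2 ∣[(2 : ℤ)] dilMat d hd = fun z : ℍ => eisTwoDil d z := by
  ext z
  rw [slash_dilMat, eisTwo_coe, coe_dilMat_smul, eisTwoDil]
  norm_num

lemma D2_slash_dilMat (d : ℕ) (hd : 0 < d) {γ γ' : SL(2, ℤ)} (h1 : γ' 1 0 * d = γ 1 0)
    (h2 : γ' 1 1 = γ 1 1) :
    EisensteinSeries.D2 γ' ∣[(2 : ℤ)] dilMat d hd = EisensteinSeries.D2 γ := by
  ext z
  rw [slash_dilMat, EisensteinSeries.D2, EisensteinSeries.D2, ModularGroup.denom_apply,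
    ModularGroup.denom_apply, coe_dilMat_smul, ← h1, h2]
  push_cast
  norm_num
  ring

lemma mdiff_eisTwoDil (d : ℕ) (hd : 0 < d) : MDiff (fun z : ℍ => eisTwoDil d z) := by
  refine mdifferentiable_of fun τ hτ => ?_
  have hd' : (0 : ℝ) < d := by exact_mod_cast hd
  have him : 0 < ((d : ℂ) * τ).im := by simp; positivity
  exact (((hasDerivAt_eisTwo him).comp τ ((hasDerivAt_id τ).const_mul (d : ℂ))).const_mul
    (d : ℂ)).differentiableAt

lemma isModularSix_eisTwo (d : ℕ) (hd : 0 < d) (hd6 : d ∣ 6) :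
    IsModularSix 2 ((fun z : ℍ => eisTwoDil d z) + (-1 : ℂ) • (fun z : ℍ => eisTwo z)) where
  slash γ hγ := by
    have hE : (fun z : ℍ => eisTwo z) = EisensteinSeries.E2 := by ext z; rw [eisTwo_coe]
    obtain ⟨γ', he, h1, h2⟩ := exists_commute d hd hd6 hγ
    have e : dilMat d hd * (γ : GL (Fin 2) ℝ) = mapGL ℝ γ' * dilMat d hd := he
    rw [SlashAction.add_slash, SL_smul_slash, hE, ← E2_slash_dilMat d hd,
      EisensteinSeries.E2_slash_action]
    rw [ModularForm.SL_slash, ← SlashAction.slash_mul, e, SlashAction.slash_mul]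
    have h3 : EisensteinSeries.E2 ∣[(2 : ℤ)] (mapGL ℝ γ') = _ :=
      EisensteinSeries.E2_slash_action γ'
    rw [h3]
    ext z
    have h4 := congrFun (D2_slash_dilMat d hd h1 h2) z
    rw [slash_dilMat] at h4
    simp only [Pi.add_apply, Pi.smul_apply, Pi.sub_apply, smul_eq_mul, slash_dilMat]
    rw [← h4]; ring
  bounded γ := by
    have hE : (fun z : ℍ => eisTwo z) = EisensteinSeries.E2 := by ext z; rw [eisTwo_coe]
    rw [SlashAction.add_slash, SL_smul_slash, hE, ← E2_slash_dilMat d hd]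
    exact BoundedAtFilter.add (bounded_slash_dilMat bounded_E2_slash d hd γ)
      (BoundedAtFilter.smul _ (bounded_E2_slash γ))
  mdiff := (mdiff_eisTwoDil d hd).add
    ((mdifferentiable_of fun _ h => (hasDerivAt_eisTwo h).differentiableAt).const_smul _)

lemma isModularSix_eisFour (d : ℕ) (hd : 0 < d) (hd6 : d ∣ 6) :
    IsModularSix 4 (fun z : ℍ => eisFour (d * z)) := by
  have h0 : ∀ γ : SL(2, ℤ), (fun z : ℍ => eisFour z) ∣[(4 : ℤ)] γ = fun z : ℍ => eisFour z :=
    slash_of_inv (k := 4) (fun w hw => eisFour_inv hw)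
  have hb : IsBoundedAtImInfty (fun z : ℍ => eisFour z) := by
    have := isBigO_qSer polyBdd_coeffFour 0 (by simp)
    rw [IsBoundedAtImInfty, BoundedAtFilter]
    exact this.congr_right fun z => by simp
  have hd0 : (d : ℂ) ≠ 0 := by exact_mod_cast hd.ne'
  have hs : (fun z : ℍ => eisFour z) ∣[(4 : ℤ)] dilMat d hd =
      ((d : ℂ) ^ 3) • fun z : ℍ => eisFour (d * z) := by
    ext z
    rw [slash_dilMat, coe_dilMat_smul]; norm_num
  have hs' : (fun z : ℍ => eisFour (d * z)) =
      (((d : ℂ) ^ 3)⁻¹) • ((fun z : ℍ => eisFour z) ∣[(4 : ℤ)] dilMat d hd) := by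
    rw [hs, smul_smul, inv_mul_cancel₀ (pow_ne_zero _ hd0), one_smul]
  rw [hs']
  refine IsModularSix.smul _ ⟨fun γ hγ => ?_, fun γ => ?_, ?_⟩
  · obtain ⟨γ', he, h1, h2⟩ := exists_commute d hd hd6 hγ
    have e : dilMat d hd * (γ : GL (Fin 2) ℝ) = mapGL ℝ γ' * dilMat d hd := he
    rw [ModularForm.SL_slash, ← SlashAction.slash_mul, e, SlashAction.slash_mul]
    have h3 : (fun z : ℍ => eisFour z) ∣[(4 : ℤ)] (mapGL ℝ γ') = _ := h0 γ'
    rw [h3]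
  · refine bounded_slash_dilMat (fun γ' => ?_) d hd γ
    rw [h0]; exact hb
  · rw [hs]
    refine MDifferentiable.const_smul _ (mdifferentiable_of (f := fun τ => eisFour (d * τ)) ?_)
    intro τ hτ
    have hd' : (0 : ℝ) < d := by exact_mod_cast hd
    have him : 0 < ((d : ℂ) * τ).im := by simp; positivity
    exact ((hasDerivAt_qSer polyBdd_coeffFour him).comp τ
      ((hasDerivAt_id τ).const_mul (d : ℂ))).differentiableAt

end ThreeBanana

namespace ThreeBanana

open Complex Filter Topology Set
open UpperHalfPlane hiding I
open scoped MatrixGroups Manifold ModularForm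

/-- The coefficients of `d E₂(dz) - E₂(z)`. -/
def coeffDiff (d n : ℕ) : ℤ := d * dilate d coeffTwo n + -1 * coeffTwo n

lemma conv_cast (c d : ℕ → ℤ) (n : ℕ) :
    ((conv c d n : ℤ) : ℂ) = conv (fun n => (c n : ℂ)) (fun n => (d n : ℂ)) n := by
  simp [conv]

lemma dilate_cast (d : ℕ) (c : ℕ → ℤ) (n : ℕ) :
    ((dilate d c n : ℤ) : ℂ) = dilate d (fun n => (c n : ℂ)) n := by
  unfold dilate; split_ifs <;> simp

lemma coeffDiff_cast (d n : ℕ) : (coeffDiff d n : ℂ) =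
    d * dilate d (fun n => (coeffTwo n : ℂ)) n + -1 * (coeffTwo n : ℂ) := by
  simp [coeffDiff, dilate_cast]

lemma polyBdd_coeffDiff (d : ℕ) : PolyBdd fun n => (coeffDiff d n : ℂ) := by
  simp only [coeffDiff_cast]
  exact ((polyBdd_coeffTwo.dilate d).const_mul d).add (polyBdd_coeffTwo.const_mul (-1))

lemma polyBdd_dilate_coeffFour (d : ℕ) : PolyBdd fun n => ((dilate d coeffFour n : ℤ) : ℂ) := by
  simp only [dilate_cast]
  exact polyBdd_coeffFour.dilate d

lemma qSer_coeffDiff {d : ℕ} (hd : 0 < d) {τ : ℂ} (h : 0 < τ.im) :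
    qSer (fun n => (coeffDiff d n : ℂ)) τ = eisTwoDil d τ - eisTwo τ := by
  simp only [coeffDiff_cast]
  rw [qSer_add ((polyBdd_coeffTwo.dilate d).const_mul d) (polyBdd_coeffTwo.const_mul (-1)) h,
    qSer_const_mul, qSer_const_mul, qSer_dilate hd, eisTwoDil, eisTwo, eisTwo]
  ring

lemma qSer_dilate_coeffFour {d : ℕ} (hd : 0 < d) (τ : ℂ) :
    qSer (fun n => ((dilate d coeffFour n : ℤ) : ℂ)) τ = eisFour (d * τ) := by
  simp only [dilate_cast]
  rw [qSer_dilate hd, eisFour]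

/-- `f` has the Fourier expansion with the integer coefficients `c`. -/
def Expands (c : ℕ → ℤ) (f : ℂ → ℂ) : Prop :=
  PolyBdd (fun n => (c n : ℂ)) ∧ ∀ τ : ℂ, 0 < τ.im → qSer (fun n => (c n : ℂ)) τ = f τ

lemma Expands.add_smul {c d : ℕ → ℤ} {f g : ℂ → ℂ} (hf : Expands c f) (u : ℤ)
    (hg : Expands d g) : Expands (fun n => c n + u * d n) (fun τ => f τ + u * g τ) := by
  unfold Expands
  push_cast
  refine ⟨hf.1.add (hg.1.const_mul u), fun τ hτ => ?_⟩
  rw [qSer_add hf.1 (hg.1.const_mul u) hτ, qSer_const_mul, hf.2 τ hτ, hg.2 τ hτ]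

lemma Expands.smul {c : ℕ → ℤ} {f : ℂ → ℂ} (u : ℤ) (hf : Expands c f) :
    Expands (fun n => u * c n) (fun τ => u * f τ) := by
  unfold Expands
  push_cast
  exact ⟨hf.1.const_mul u, fun τ hτ => by rw [qSer_const_mul, hf.2 τ hτ]⟩

lemma expands_mul {c e : ℕ} (hc : 0 < c) (he : 0 < e) :
    Expands (conv (coeffDiff c) (coeffDiff e))
      (fun τ => (eisTwoDil c τ - eisTwo τ) * (eisTwoDil e τ - eisTwo τ)) := by
  unfold Expands
  simp only [conv_cast]
  refine ⟨(polyBdd_coeffDiff c).conv (polyBdd_coeffDiff e), fun τ hτ => ?_⟩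
  rw [← qSer_coeffDiff hc hτ, ← qSer_coeffDiff he hτ,
    qSer_mul (polyBdd_coeffDiff c) (polyBdd_coeffDiff e) hτ]

lemma expands_eisFour {d : ℕ} (hd : 0 < d) :
    Expands (dilate d coeffFour) (fun τ => eisFour (d * τ)) :=
  ⟨polyBdd_dilate_coeffFour d, fun τ _ => qSer_dilate_coeffFour hd τ⟩

/-- A quadratic relation between Eisenstein series of level six follows from finitely many
Fourier coefficients. -/
lemma eisenstein_relation (u₁ u₂ u₃ u₄ u₅ u₆ f₁ f₂ f₃ f₆ : ℤ)
    (h : ∀ n < 13, u₁ * conv (coeffDiff 2) (coeffDiff 2) n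
      + u₂ * conv (coeffDiff 2) (coeffDiff 3) n + u₃ * conv (coeffDiff 2) (coeffDiff 6) n
      + u₄ * conv (coeffDiff 3) (coeffDiff 3) n + u₅ * conv (coeffDiff 3) (coeffDiff 6) n
      + u₆ * conv (coeffDiff 6) (coeffDiff 6) n + f₁ * dilate 1 coeffFour n
      + f₂ * dilate 2 coeffFour n + f₃ * dilate 3 coeffFour n + f₆ * dilate 6 coeffFour n = 0)
    {τ : ℂ} (hτ : 0 < τ.im) :
    u₁ * (eisTwoDil 2 τ - eisTwo τ) * (eisTwoDil 2 τ - eisTwo τ)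
      + u₂ * (eisTwoDil 2 τ - eisTwo τ) * (eisTwoDil 3 τ - eisTwo τ)
      + u₃ * (eisTwoDil 2 τ - eisTwo τ) * (eisTwoDil 6 τ - eisTwo τ)
      + u₄ * (eisTwoDil 3 τ - eisTwo τ) * (eisTwoDil 3 τ - eisTwo τ)
      + u₅ * (eisTwoDil 3 τ - eisTwo τ) * (eisTwoDil 6 τ - eisTwo τ)
      + u₆ * (eisTwoDil 6 τ - eisTwo τ) * (eisTwoDil 6 τ - eisTwo τ)
      + f₁ * eisFour τ + f₂ * eisFour (2 * τ) + f₃ * eisFour (3 * τ) + f₆ * eisFour (6 * τ)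
      = 0 := by
  have p := (((((((((expands_mul two_pos two_pos).smul u₁).add_smul u₂
    (expands_mul two_pos three_pos)).add_smul u₃ (expands_mul two_pos (e := 6) (by norm_num))).add_smul
    u₄ (expands_mul three_pos three_pos)).add_smul u₅
    (expands_mul three_pos (e := 6) (by norm_num))).add_smul u₆
    (expands_mul (c := 6) (e := 6) (by norm_num) (by norm_num))).add_smul f₁
    (expands_eisFour one_pos)).add_smul f₂ (expands_eisFour two_pos)).add_smul f₃
    (expands_eisFour three_pos) |>.add_smul f₆ (expands_eisFour (d := 6) (by norm_num))
  have hO := isBigO_qSer p.1 13 (fun n hn => by exact_mod_cast h n hn)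
  have m2 := isModularSix_eisTwo 2 (by norm_num) (by norm_num)
  have m3 := isModularSix_eisTwo 3 (by norm_num) (by norm_num)
  have m6 := isModularSix_eisTwo 6 (by norm_num) (by norm_num)
  have v : ∀ d : ℕ, 0 < d → d ∣ 6 → _ := fun d h1 h2 => isModularSix_eisFour d h1 h2
  have mm := ((((((((((m2.mul m2).smul (u₁ : ℂ)).add ((m2.mul m3).smul (u₂ : ℂ))).add
    ((m2.mul m6).smul (u₃ : ℂ))).add ((m3.mul m3).smul (u₄ : ℂ))).add ((m3.mul m6).smul (u₅ : ℂ))).add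
    ((m6.mul m6).smul (u₆ : ℂ))).add ((v 1 (by norm_num) (by norm_num)).smul (f₁ : ℂ))).add
    ((v 2 (by norm_num) (by norm_num)).smul (f₂ : ℂ))).add
    ((v 3 (by norm_num) (by norm_num)).smul (f₃ : ℂ))).add
    ((v 6 (by norm_num) (by norm_num)).smul (f₆ : ℂ))
  have h0 := mm.eq_zero (hO.congr_left fun z => by
    rw [p.2 z z.im_pos]
    simp only [Pi.add_apply, Pi.smul_apply, Pi.mul_apply, smul_eq_mul]
    push_cast
    ring)
  have h1 := congrFun h0 ⟨τ, hτ⟩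
  simp only [Pi.add_apply, Pi.smul_apply, Pi.mul_apply, smul_eq_mul, Pi.zero_apply] at h1
  push_cast at h1
  simp only [one_mul] at h1
  linear_combination h1

end ThreeBanana

namespace ThreeBanana

open Complex Filter Topology Set

/-- The weight two form `(η(τ)η(3τ))⁴ / (η(2τ)η(6τ))²`. -/
noncomputable def formA (τ : ℂ) : ℂ :=
  eisTwo τ / 6 - eisTwoDil 2 τ / 3 - eisTwoDil 3 τ / 6 + eisTwoDil 6 τ / 3

/-- The weight two form `(η(2τ)η(6τ))⁴ / (η(τ)η(3τ))²`. -/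
noncomputable def formB (τ : ℂ) : ℂ :=
  -eisTwo τ / 24 + eisTwoDil 2 τ / 48 + eisTwoDil 3 τ / 24 - eisTwoDil 6 τ / 48

/-- The logarithmic derivative of `formB / formA`. -/
noncomputable def formW (τ : ℂ) : ℂ :=
  -eisTwo τ / 4 + eisTwoDil 2 τ / 4 - eisTwoDil 3 τ / 4 + eisTwoDil 6 τ / 4

/-- The logarithmic derivative of `formA`. -/
noncomputable def logDerivA (τ : ℂ) : ℂ :=
  eisTwo τ / 6 - eisTwoDil 2 τ / 12 + eisTwoDil 3 τ / 6 - eisTwoDil 6 τ / 12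

lemma hasDerivAt_eisTwoDil {d : ℕ} (hd : 0 < d) {τ : ℂ} (h : 0 < τ.im) :
    HasDerivAt (eisTwoDil d)
      (2 * Real.pi * I * ((eisTwoDil d τ ^ 2 - d ^ 2 * eisFour (d * τ)) / 12)) τ := by
  have hd' : (0 : ℝ) < d := by exact_mod_cast hd
  have him : 0 < ((d : ℂ) * τ).im := by simp; positivity
  have := ((hasDerivAt_eisTwo him).comp τ ((hasDerivAt_id τ).const_mul (d : ℂ))).const_mul (d : ℂ)
  refine this.congr_deriv ?_
  rw [thetaEisTwo_eq him, eisTwoDil]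
  ring

lemma hasDerivAt_eisTwo' {τ : ℂ} (h : 0 < τ.im) :
    HasDerivAt eisTwo (2 * Real.pi * I * ((eisTwo τ ^ 2 - eisFour τ) / 12)) τ := by
  rw [← thetaEisTwo_eq h]; exact hasDerivAt_eisTwo h

lemma hasDerivAt_formA {τ : ℂ} (h : 0 < τ.im) :
    HasDerivAt formA (2 * Real.pi * I * (logDerivA τ * formA τ)) τ := by
  have h2 := hasDerivAt_eisTwoDil two_pos h
  have h3 := hasDerivAt_eisTwoDil three_pos h
  have h6 := hasDerivAt_eisTwoDil (d := 6) (by norm_num) h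
  refine ((((hasDerivAt_eisTwo' h).div_const 6).sub (h2.div_const 3)).sub
    (h3.div_const 6) |>.add (h6.div_const 3)).congr_deriv ?_
  have key := eisenstein_relation (-4) 3 0 1 (-5) 4 (-1) 8 9 (-72) (by decide +kernel) h
  push_cast at key ⊢
  unfold formA logDerivA
  linear_combination (2 * Real.pi * I) / 72 * key

lemma hasDerivAt_formB {τ : ℂ} (h : 0 < τ.im) :
    HasDerivAt formB (2 * Real.pi * I * ((logDerivA τ + formW τ) * formB τ)) τ := by
  have h2 := hasDerivAt_eisTwoDil two_pos h
  have h3 := hasDerivAt_eisTwoDil three_pos h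
  have h6 := hasDerivAt_eisTwoDil (d := 6) (by norm_num) h
  refine ((((hasDerivAt_eisTwo' h).neg.div_const 24).add (h2.div_const 48)).add
    (h3.div_const 24) |>.sub (h6.div_const 48)).congr_deriv ?_
  have key := eisenstein_relation (-1) (-3) 0 4 (-5) 1 2 (-4) (-18) 36 (by decide +kernel) h
  push_cast at key ⊢
  unfold formB logDerivA formW
  linear_combination (2 * Real.pi * I) / 576 * key

lemma formW_sq {τ : ℂ} (h : 0 < τ.im) :
    formW τ ^ 2 = (formA τ + 16 * formB τ) * (formA τ + 4 * formB τ) := by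
  have key := eisenstein_relation 1 0 2 1 (-4) 1 0 0 0 0 (by decide +kernel) h
  push_cast at key
  unfold formA formB formW
  linear_combination 1 / 16 * key

lemma hasDerivAt_logDerivA {τ : ℂ} (h : 0 < τ.im) :
    HasDerivAt logDerivA (2 * Real.pi * I *
      (logDerivA τ ^ 2 / 2 - 32 * formB τ ^ 2 - 4 * formA τ * formB τ)) τ := by
  have h2 := hasDerivAt_eisTwoDil two_pos h
  have h3 := hasDerivAt_eisTwoDil three_pos h
  have h6 := hasDerivAt_eisTwoDil (d := 6) (by norm_num) h
  refine ((((hasDerivAt_eisTwo' h).div_const 6).sub (h2.div_const 12)).add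
    (h3.div_const 6) |>.sub (h6.div_const 12)).congr_deriv ?_
  have key := eisenstein_relation 7 0 (-6) (-8) (-8) 7 4 (-8) 36 (-72) (by decide +kernel) h
  push_cast at key ⊢
  unfold formA formB logDerivA
  linear_combination -(2 * Real.pi * I) / 288 * key

lemma formB_mul_formW {τ : ℂ} (h : 0 < τ.im) :
    formB τ * formW τ = (eisFour τ - eisFour (2 * τ) - 9 * eisFour (3 * τ)
      + 9 * eisFour (6 * τ)) / 240 := by
  have key := eisenstein_relation 5 5 0 (-10) 15 (-5) (-4) 4 36 (-36) (by decide +kernel) h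
  push_cast at key
  unfold formB formW
  linear_combination 1 / 960 * key

end ThreeBanana

namespace ThreeBanana

open Filter Topology Set

/-- The Bessel type integral `∫₀^∞ e^{-x-w/x} x^{-n} dx`. -/
noncomputable def bessel (n : ℕ) (w : ℝ) : ℝ := ∫ x in Ioi (0 : ℝ), Real.exp (-x - w / x) / x ^ n

lemma exp_neg_div_le {w x : ℝ} (hw : 0 < w) (hx : 0 < x) (n : ℕ) :
    Real.exp (-x - w / x) / x ^ n ≤ n.factorial / w ^ n * Real.exp (-x) := by
  have h := Real.pow_div_factorial_le_exp (w / x) (by positivity) n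
  rw [div_pow, div_div, div_le_iff₀ (by positivity)] at h
  rw [sub_eq_add_neg, Real.exp_add, Real.exp_neg (w / x), div_mul_eq_mul_div, div_le_div_iff₀
    (by positivity) (by positivity)]
  have h2 := Real.exp_pos (-x)
  have h3 := Real.exp_pos (w / x)
  field_simp
  nlinarith

lemma integrableOn_exp_neg : IntegrableOn (fun x : ℝ => Real.exp (-x)) (Ioi 0) := by
  simpa using integrableOn_exp_mul_Ioi (a := -1) (by norm_num) 0

lemma measurable_besselKernel (n : ℕ) (w : ℝ) :
    Measurable (fun x : ℝ => Real.exp (-x - w / x) / x ^ n) := by fun_prop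

lemma integrableOn_bessel (n : ℕ) {w : ℝ} (hw : 0 < w) :
    IntegrableOn (fun x => Real.exp (-x - w / x) / x ^ n) (Ioi 0) := by
  refine (integrableOn_exp_neg.const_mul (n.factorial / w ^ n)).mono'
    (measurable_besselKernel n w).aestronglyMeasurable ?_
  refine (ae_restrict_iff' measurableSet_Ioi).mpr (.of_forall fun x hx => ?_)
  have hx' : (0 : ℝ) < x := hx
  rw [Real.norm_of_nonneg (by positivity)]
  exact exp_neg_div_le hw hx n

lemma hasDerivAt_bessel (n : ℕ) {w : ℝ} (hw : 0 < w) :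
    HasDerivAt (bessel n) (-bessel (n + 1) w) w := by
  have h := hasDerivAt_integral_of_dominated_loc_of_deriv_le (μ := volume.restrict (Ioi 0))
    (F := fun v x => Real.exp (-x - v / x) / x ^ n)
    (F' := fun v x => -(Real.exp (-x - v / x) / x ^ (n + 1))) (x₀ := w) (s := Ioi (w / 2))
    (bound := fun x => Real.exp (-x - (w / 2) / x) / x ^ (n + 1)) (Ioi_mem_nhds (by linarith))
    (.of_forall fun v => (measurable_besselKernel n v).aestronglyMeasurable)
    (integrableOn_bessel n hw) (measurable_besselKernel (n + 1) w).neg.aestronglyMeasurable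
    ?_ (integrableOn_bessel (n + 1) (half_pos hw)) ?_
  · refine h.2.congr_deriv ?_
    rw [integral_neg, bessel]
  · refine (ae_restrict_iff' measurableSet_Ioi).mpr (.of_forall fun x hx v hv => ?_)
    have hx' : (0 : ℝ) < x := hx
    have hv' : w / 2 < v := hv
    rw [norm_neg, Real.norm_of_nonneg (by positivity)]
    gcongr
  · refine (ae_restrict_iff' measurableSet_Ioi).mpr (.of_forall fun x hx v hv => ?_)
    have hx' : (0 : ℝ) < x := hx
    have h1 : HasDerivAt (fun v => -x - v / x) (-(1 / x)) v :=
      ((hasDerivAt_id v).div_const x).const_sub _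
    refine (h1.exp.div_const (x ^ n)).congr_deriv ?_
    field_simp
    ring

lemma integral_Ioi_deriv {f f' : ℝ → ℝ} {a b : ℝ} (hd : ∀ x ∈ Ioi (0 : ℝ), HasDerivAt f (f' x) x)
    (hf' : IntegrableOn f' (Ioi 0)) (h0 : Tendsto f (𝓝[>] 0) (𝓝 a)) (h1 : Tendsto f atTop (𝓝 b)) :
    ∫ x in Ioi (0 : ℝ), f' x = b - a := by
  have hc : ∀ x ∈ Ioi (0 : ℝ), HasDerivAt (Function.update f 0 a) (f' x) x := fun x hx =>
    (hd x hx).congr_of_eventuallyEq <| by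
      filter_upwards [Ioi_mem_nhds hx] with y hy
      exact Function.update_of_ne (ne_of_gt hy) _ _
  have := integral_Ioi_of_hasDerivAt_of_tendsto (f := Function.update f 0 a) ?_ hc hf'
    (h1.congr' ?_)
  · simpa using this
  · rw [← Ioi_insert, continuousWithinAt_insert_self]
    refine Tendsto.congr' ?_ (by simpa using h0)
    filter_upwards [self_mem_nhdsWithin] with y hy
    exact (Function.update_of_ne (ne_of_gt hy) _ _).symm
  · filter_upwards [Ioi_mem_atTop 0] with y hy
    exact (Function.update_of_ne (ne_of_gt hy) _ _).symm

lemma integral_Ioi_deriv' {f f' : ℝ → ℝ} {a : ℝ} (hd : ∀ x ∈ Ioi (0 : ℝ), HasDerivAt f (f' x) x)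
    (hf : IntegrableOn f (Ioi 0))
    (hf' : IntegrableOn f' (Ioi 0)) (h0 : Tendsto f (𝓝[>] 0) (𝓝 a)) :
    ∫ x in Ioi (0 : ℝ), f' x = -a := by
  rw [integral_Ioi_deriv hd hf' h0 (tendsto_zero_of_hasDerivAt_of_integrableOn_Ioi hd hf' hf)]
  ring

lemma bessel_zero_eq {w : ℝ} (hw : 0 < w) : bessel 0 w = w * bessel 2 w := by
  have h := integral_Ioi_deriv' (f := fun x => Real.exp (-x - w / x))
    (f' := fun x => w * (Real.exp (-x - w / x) / x ^ 2) - Real.exp (-x - w / x) / x ^ 0) (a := 0)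
    ?_ ?_ ?_ ?_
  · rw [integral_sub ((integrableOn_bessel 2 hw).const_mul w) (integrableOn_bessel 0 hw),
      integral_const_mul] at h
    rw [bessel, bessel]
    linarith
  · intro x hx
    have hx' : x ≠ 0 := ne_of_gt hx
    have h1 : HasDerivAt (fun x => -x - w / x) (-1 - (0 * x - w * 1) / x ^ 2) x :=
      (hasDerivAt_id x).neg.sub ((hasDerivAt_const x w).div (hasDerivAt_id x) hx')
    refine h1.exp.congr_deriv ?_
    field_simp
    ring
  · simpa using integrableOn_bessel 0 hw
  · exact Integrable.sub ((integrableOn_bessel 2 hw).const_mul w) (integrableOn_bessel 0 hw)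
  · refine squeeze_zero' (.of_forall fun x => (Real.exp_pos _).le) (g := fun x => x / w) ?_ ?_
    · filter_upwards [self_mem_nhdsWithin] with x hx
      have hx' : (0 : ℝ) < x := hx
      have := exp_neg_div_le hw hx' 1
      rw [pow_one, pow_one, div_le_iff₀ hx'] at this
      refine this.trans ?_
      have : Real.exp (-x) ≤ 1 := Real.exp_le_one_iff.mpr (by linarith)
      simp only [Nat.factorial_one, Nat.cast_one]
      rw [div_mul_eq_mul_div, div_mul_eq_mul_div, one_mul]
      gcongr
      nlinarith
    · have : Tendsto (fun x : ℝ => x / w) (𝓝 0) (𝓝 (0 / w)) := tendsto_id.div_const w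
      rw [zero_div] at this
      exact this.mono_left nhdsWithin_le_nhds

lemma hasDerivAt_besselOne {w : ℝ} (hw : 0 < w) :
    HasDerivAt (bessel 1) (-(bessel 0 w / w)) w := by
  refine (hasDerivAt_bessel 1 hw).congr_deriv ?_
  rw [bessel_zero_eq hw]; field_simp

lemma bessel_nonneg (n : ℕ) (w : ℝ) : 0 ≤ bessel n w :=
  setIntegral_nonneg measurableSet_Ioi fun x hx => by
    have : (0 : ℝ) < x := hx
    positivity

lemma exp_kernel_le {w x : ℝ} (hw : 0 < w) (hx : 0 < x) :
    Real.exp (-x - w / x) ≤ Real.exp (-√w) * (Real.exp (-(x / 2)) * Real.exp (-(w / x / 2))) := by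
  rw [← Real.exp_add, ← Real.exp_add, Real.exp_le_exp]
  have h : √w ≤ x / 2 + w / x / 2 := by
    have h1 := Real.sq_sqrt hw.le
    rw [← sub_nonneg]
    have : x / 2 + w / x / 2 - √w = (x - √w) ^ 2 / (2 * x) := by
      rw [← h1]; field_simp; rw [Real.sqrt_sq (Real.sqrt_nonneg _)]; ring
    rw [this]; positivity
  linarith

lemma integrableOn_rpow_mul_exp_half {s : ℝ} (hs : -1 < s) :
    IntegrableOn (fun x : ℝ => x ^ s * Real.exp (-(x / 2))) (Ioi 0) := by
  refine (integrableOn_rpow_mul_exp_neg_mul_rpow hs one_pos (b := 1 / 2) (by norm_num)).congr_fun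
    (fun x _ => ?_) measurableSet_Ioi
  simp only [Real.rpow_one]; ring_nf

lemma bessel_zero_le : ∃ C : ℝ, 0 ≤ C ∧ ∀ w : ℝ, 0 < w → bessel 0 w ≤ C * Real.exp (-√w) := by
  have hi : IntegrableOn (fun x : ℝ => Real.exp (-(x / 2))) (Ioi 0) := by
    simpa using integrableOn_rpow_mul_exp_half (s := 0) (by norm_num)
  refine ⟨∫ x in Ioi (0 : ℝ), Real.exp (-(x / 2)),
    setIntegral_nonneg measurableSet_Ioi fun x _ => (Real.exp_pos _).le, fun w hw => ?_⟩
  rw [bessel, mul_comm, ← integral_const_mul]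
  refine setIntegral_mono_on (integrableOn_bessel 0 hw) (hi.const_mul _) measurableSet_Ioi
    fun x hx => ?_
  have hx' : (0 : ℝ) < x := hx
  rw [pow_zero, div_one]
  refine (exp_kernel_le hw hx).trans ?_
  gcongr
  have : Real.exp (-(w / x / 2)) ≤ 1 := Real.exp_le_one_iff.mpr (by rw [neg_nonpos]; positivity)
  nlinarith [Real.exp_pos (-(x / 2))]

lemma exp_neg_le_rpow {y : ℝ} (hy : 0 < y) : Real.exp (-y) ≤ y ^ (-(1 / 8) : ℝ) := by
  rw [Real.rpow_neg hy.le, Real.exp_neg]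
  apply inv_anti₀ (by positivity)
  calc y ^ (1 / 8 : ℝ) ≤ (Real.exp (8 * y)) ^ (1 / 8 : ℝ) := by
        apply Real.rpow_le_rpow hy.le _ (by norm_num)
        have := Real.add_one_le_exp (8 * y)
        linarith
    _ = Real.exp y := by rw [← Real.exp_mul]; ring_nf

lemma bessel_one_le : ∃ C : ℝ, 0 ≤ C ∧
    ∀ w : ℝ, 0 < w → bessel 1 w ≤ C * (w ^ (-(1 / 8) : ℝ) * Real.exp (-√w)) := by
  have hi := integrableOn_rpow_mul_exp_half (s := -(7 / 8)) (by norm_num)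
  refine ⟨2 ^ (1 / 8 : ℝ) * ∫ x in Ioi (0 : ℝ), x ^ (-(7 / 8) : ℝ) * Real.exp (-(x / 2)),
    mul_nonneg (by positivity) (setIntegral_nonneg measurableSet_Ioi fun x hx => ?_),
    fun w hw => ?_⟩
  · have hx' : (0 : ℝ) < x := hx
    positivity
  rw [bessel, mul_right_comm, ← integral_const_mul]
  refine setIntegral_mono_on (integrableOn_bessel 1 hw) (hi.const_mul _) measurableSet_Ioi
    fun x hx => ?_
  have hx' : (0 : ℝ) < x := hx
  rw [pow_one, div_le_iff₀ hx']
  refine (exp_kernel_le hw hx).trans ?_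
  have h1 := exp_neg_le_rpow (y := w / x / 2) (by positivity)
  have h2 : (w / x / 2) ^ (-(1 / 8) : ℝ) = 2 ^ (1 / 8 : ℝ) * w ^ (-(1 / 8) : ℝ) *
      x ^ (1 / 8 : ℝ) := by
    rw [Real.div_rpow (by positivity) (by norm_num), Real.div_rpow hw.le hx'.le,
      Real.rpow_neg hx'.le, Real.rpow_neg (by norm_num : (0:ℝ) ≤ 2)]
    field_simp
  have h3 : x ^ (-(7 / 8) : ℝ) * x = x ^ (1 / 8 : ℝ) := by
    nth_rw 2 [← Real.rpow_one x]
    rw [← Real.rpow_add hx']; norm_num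
  rw [h2] at h1
  calc _ ≤ Real.exp (-√w) * (Real.exp (-(x / 2)) * (2 ^ (1 / 8 : ℝ) * w ^ (-(1 / 8) : ℝ) *
      x ^ (1 / 8 : ℝ))) := by gcongr
    _ = _ := by rw [← h3]; ring

lemma tendsto_bessel_zero : Tendsto (bessel 0) (𝓝[>] 0) (𝓝 1) := by
  have h1 : ∫ x in Ioi (0 : ℝ), Real.exp (-x) = 1 := integral_exp_neg_Ioi_zero
  rw [← h1]
  refine tendsto_integral_filter_of_dominated_convergence (fun x => Real.exp (-x))
    (.of_forall fun w => (measurable_besselKernel 0 w).aestronglyMeasurable) ?_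
    integrableOn_exp_neg ?_
  · filter_upwards [self_mem_nhdsWithin] with w hw
    refine (ae_restrict_iff' measurableSet_Ioi).mpr (.of_forall fun x hx => ?_)
    have := exp_neg_div_le (w := w) hw hx 0
    rw [Real.norm_of_nonneg (by positivity)]
    simpa using this
  · refine .of_forall fun x => ?_
    have : Tendsto (fun w => Real.exp (-x - w / x) / x ^ 0) (𝓝 0)
        (𝓝 (Real.exp (-x - 0 / x) / x ^ 0)) :=
      (by fun_prop : Continuous fun w => Real.exp (-x - w / x) / x ^ 0).tendsto 0
    rw [zero_div, sub_zero, pow_zero, div_one] at this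
    exact this.mono_left nhdsWithin_le_nhds

end ThreeBanana

namespace ThreeBanana

open Filter Topology Set

/-- The integrand `wⁿ K₁(w)ᵖ K₀(w)ʲ` of the Bessel moments. -/
noncomputable def besselProd (p j n : ℕ) (w : ℝ) : ℝ := w ^ n * bessel 1 w ^ p * bessel 0 w ^ j

/-- The Bessel moments. -/
noncomputable def besselMoment (p j n : ℕ) : ℝ := ∫ w in Ioi (0 : ℝ), besselProd p j n w

lemma besselProd_nonneg (p j n : ℕ) {w : ℝ} (hw : 0 < w) : 0 ≤ besselProd p j n w :=
  mul_nonneg (mul_nonneg (by positivity) (pow_nonneg (bessel_nonneg _ _) _))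
    (pow_nonneg (bessel_nonneg _ _) _)

lemma besselProd_le {p j : ℕ} (hp : 1 ≤ p + j) (n : ℕ) : ∃ C : ℝ, 0 ≤ C ∧ ∀ w : ℝ, 0 < w →
    besselProd p j n w ≤ C * (w ^ ((n : ℝ) - p / 8) * Real.exp (-w ^ (1 / 2 : ℝ))) := by
  obtain ⟨C, hC, h1⟩ := bessel_one_le
  obtain ⟨D, hD, h0⟩ := bessel_zero_le
  refine ⟨C ^ p * D ^ j, by positivity, fun w hw => ?_⟩
  have e : Real.exp (-√w) ^ (p + j) ≤ Real.exp (-√w) :=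
    pow_le_of_le_one (Real.exp_pos _).le
      (Real.exp_le_one_iff.mpr (neg_nonpos.mpr (Real.sqrt_nonneg _))) (by omega)
  have e2 : w ^ n * (w ^ (-(1 / 8) : ℝ)) ^ p = w ^ ((n : ℝ) - p / 8) := by
    rw [← Real.rpow_natCast, ← Real.rpow_natCast, ← Real.rpow_mul hw.le, ← Real.rpow_add hw]
    ring_nf
  rw [← Real.sqrt_eq_rpow, besselProd, ← e2]
  calc _ ≤ w ^ n * (C * (w ^ (-(1 / 8) : ℝ) * Real.exp (-√w))) ^ p * (D * Real.exp (-√w)) ^ j := by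
        have := bessel_nonneg 1 w
        have := bessel_nonneg 0 w
        gcongr
        · exact h1 w hw
        · exact h0 w hw
    _ = C ^ p * D ^ j * (w ^ n * (w ^ (-(1 / 8) : ℝ)) ^ p * Real.exp (-√w) ^ (p + j)) := by ring
    _ ≤ _ := by gcongr

lemma hasDerivAt_besselProd (p j n : ℕ) {w : ℝ} (hw : 0 < w) :
    HasDerivAt (besselProd p j (n + 1)) ((n + 1) * besselProd p j n w
      - p * besselProd (p - 1) (j + 1) n w - j * besselProd (p + 1) (j - 1) (n + 1) w) w := by
  have h1 := (hasDerivAt_besselOne hw).pow p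
  have h0 := (hasDerivAt_bessel 0 hw).pow j
  refine (((hasDerivAt_pow (n + 1) w).mul h1).mul h0).congr_deriv ?_
  simp only [besselProd, Pi.mul_apply, Pi.pow_apply]
  push_cast
  field_simp
  ring

lemma continuousOn_besselProd (p j n : ℕ) : ContinuousOn (besselProd p j n) (Ioi 0) := by
  have h : ∀ m, ContinuousOn (bessel m) (Ioi 0) := fun m w hw =>
    (hasDerivAt_bessel m hw).continuousAt.continuousWithinAt
  exact ((continuousOn_id.pow n).mul ((h 1).pow p)).mul ((h 0).pow j)

lemma integrableOn_besselProd {p j : ℕ} (hp : 1 ≤ p + j) (hp' : p ≤ 7) (n : ℕ) :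
    IntegrableOn (besselProd p j n) (Ioi 0) := by
  obtain ⟨C, hC, h⟩ := besselProd_le hp n
  have hp'' : (p : ℝ) ≤ 7 := by exact_mod_cast hp'
  refine ((integrableOn_rpow_mul_exp_neg_rpow (s := (n : ℝ) - p / 8) (p := 1 / 2) ?_
    (by norm_num)).const_mul C).mono'
    ((continuousOn_besselProd p j n).aestronglyMeasurable measurableSet_Ioi) ?_
  · have : (0 : ℝ) ≤ n := n.cast_nonneg
    linarith
  · refine (ae_restrict_iff' measurableSet_Ioi).mpr (.of_forall fun w hw => ?_)
    rw [Real.norm_of_nonneg (besselProd_nonneg _ _ _ hw)]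
    exact h w hw

lemma besselMoment_rec {p j : ℕ} (hpj : p + j = 4) (n : ℕ) :
    (n + 1) * besselMoment p j n
      = p * besselMoment (p - 1) (j + 1) n + j * besselMoment (p + 1) (j - 1) (n + 1) := by
  have i1 := integrableOn_besselProd (p := p) (j := j) (by omega) (by omega) n
  have i2 := integrableOn_besselProd (p := p - 1) (j := j + 1) (by omega) (by omega) n
  have i3 : IntegrableOn (besselProd (p + 1) (j - 1) (n + 1)) (Ioi 0) :=
    integrableOn_besselProd (by omega) (by omega) _
  have j12 := (i1.const_mul (n + 1 : ℝ)).sub (i2.const_mul (p : ℝ))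
  have h := integral_Ioi_deriv' (f := besselProd p j (n + 1)) (a := 0)
    (fun w hw => hasDerivAt_besselProd p j n hw)
    (integrableOn_besselProd (by omega) (by omega) _) (j12.sub (i3.const_mul (j : ℝ))) ?_
  · have h2 := integral_sub j12 (i3.const_mul (j : ℝ))
    have h3 := integral_sub (i1.const_mul (n + 1 : ℝ)) (i2.const_mul (p : ℝ))
    simp only [Pi.sub_apply] at h2 h3
    rw [h2, h3, integral_const_mul, integral_const_mul, integral_const_mul] at h
    unfold besselMoment
    linarith
  · obtain ⟨C, hC, h⟩ := besselProd_le (p := p) (j := j) (by omega) (n + 1)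
    have hp' : (p : ℝ) ≤ 4 := by exact_mod_cast (by omega : p ≤ 4)
    have hs : 0 < ((n + 1 : ℕ) : ℝ) - p / 8 := by
      push_cast
      have : (0 : ℝ) ≤ n := n.cast_nonneg
      linarith
    refine squeeze_zero' (g := fun w => C * w ^ (((n + 1 : ℕ) : ℝ) - p / 8)) ?_ ?_ ?_
    · filter_upwards [self_mem_nhdsWithin] with w hw using besselProd_nonneg _ _ _ hw
    · filter_upwards [self_mem_nhdsWithin] with w hw
      have hw' : (0 : ℝ) < w := hw
      refine (h w hw).trans ?_
      have : Real.exp (-w ^ (1 / 2 : ℝ)) ≤ 1 :=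
        Real.exp_le_one_iff.mpr (by rw [neg_nonpos]; positivity)
      have h3 : 0 ≤ w ^ (((n + 1 : ℕ) : ℝ) - p / 8) := by positivity
      nlinarith [mul_nonneg hC h3]
    · have := (Real.continuousAt_rpow_const 0 _ (Or.inr hs.le)).tendsto.const_mul C
      rw [Real.zero_rpow hs.ne', mul_zero] at this
      exact this.mono_left nhdsWithin_le_nhds

lemma besselMoment_one_three : besselMoment 1 3 0 = 1 / 4 := by
  have i := integrableOn_besselProd (p := 1) (j := 3) (by omega) (by omega) 0
  have h := integral_Ioi_deriv' (f := besselProd 0 4 0) (f' := fun w => -4 * besselProd 1 3 0 w)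
    (a := 1) (fun w hw => ?_) (integrableOn_besselProd (by omega) (by omega) _)
    (i.const_mul (-4)) ?_
  · rw [integral_const_mul] at h
    unfold besselMoment
    linarith
  · have h0 := (hasDerivAt_bessel 0 hw).pow 4
    refine (h0.congr_deriv ?_).congr_of_eventuallyEq (.of_forall fun v => ?_)
    · simp only [besselProd]; push_cast; ring
    · simp [besselProd]
  · have := tendsto_bessel_zero.pow 4
    refine (this.congr fun w => ?_).trans (by rw [one_pow])
    simp [besselProd]

/-- The moments `∫ wᵏ K₁⁴ dw / k!²`. -/
noncomputable def bananaMoment (k : ℕ) : ℝ := besselMoment 4 0 k / (k.factorial : ℝ) ^ 2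

lemma bananaMoment_init : 64 * bananaMoment 1 - 4 * bananaMoment 0 = -24 := by
  have h0 := besselMoment_rec (p := 4) (j := 0) rfl 0
  have h1 := besselMoment_rec (p := 3) (j := 1) rfl 0
  have h2 := besselMoment_rec (p := 2) (j := 2) rfl 0
  have g0 := besselMoment_rec (p := 4) (j := 0) rfl 1
  have h3 := besselMoment_one_three
  unfold bananaMoment
  norm_num at h0 h1 h2 g0 ⊢
  linarith

lemma bananaMoment_rec (k : ℕ) :
    64 * (k + 2 : ℝ) ^ 3 * bananaMoment (k + 2)
      - 2 * (2 * k + 3) * (5 * (k + 1) ^ 2 + 5 * (k + 1) + 2) * bananaMoment (k + 1)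
      + (k + 1 : ℝ) ^ 3 * bananaMoment k = 0 := by
  have a0 := besselMoment_rec (p := 4) (j := 0) rfl k
  have a1 := besselMoment_rec (p := 3) (j := 1) rfl k
  have a2 := besselMoment_rec (p := 2) (j := 2) rfl k
  have a3 := besselMoment_rec (p := 1) (j := 3) rfl k
  have a4 := besselMoment_rec (p := 0) (j := 4) rfl k
  have b0 := besselMoment_rec (p := 4) (j := 0) rfl (k + 1)
  have b1 := besselMoment_rec (p := 3) (j := 1) rfl (k + 1)
  have b2 := besselMoment_rec (p := 2) (j := 2) rfl (k + 1)
  have c0 := besselMoment_rec (p := 4) (j := 0) rfl (k + 2)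
  push_cast at a0 a1 a2 a3 a4 b0 b1 b2 c0
  simp only [add_assoc, Nat.reduceAdd] at a0 a1 a2 a3 a4 b0 b1 b2 c0
  have hk : (k.factorial : ℝ) ≠ 0 := by positivity
  have hk1 : (k : ℝ) + 1 ≠ 0 := by positivity
  have hk2 : (k : ℝ) + 2 ≠ 0 := by positivity
  have key : (k + 1 : ℝ) ^ 5 * besselMoment 4 0 k - 2 * (2 * k + 3) * (5 * (k + 1) ^ 2
      + 5 * (k + 1) + 2) * besselMoment 4 0 (k + 1) + 64 * (k + 2) * besselMoment 4 0 (k + 2)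
      = 0 := by
    linear_combination (k + 1 : ℝ) ^ 4 * a0 + 4 * (k + 1 : ℝ) ^ 3 * a1 + 12 * (k + 1 : ℝ) ^ 2 * a2
      + 24 * (k + 1 : ℝ) * a3 + 24 * a4 - 48 * b2 - 8 * (5 * (k + 1) + 2) * b1
      - (6 * (k + 1) ^ 2 + 2 * (5 * (k + 1) + 2) * (k + 2)) * b0 + 24 * c0
  unfold bananaMoment
  rw [Nat.factorial_succ (k + 1), Nat.factorial_succ k]
  push_cast
  have e : (k : ℝ) + 1 + 1 = k + 2 := by ring
  rw [e]
  field_simp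
  linear_combination key

end ThreeBanana

namespace ThreeBanana

open Filter Topology Set
open scoped ENNReal

/-- Lebesgue measure on the positive half line. -/
noncomputable def posMeasure : Measure ℝ := volume.restrict (Ioi 0)

instance : SFinite posMeasure := inferInstanceAs (SFinite (volume.restrict (Ioi (0 : ℝ))))

lemma ae_pos : ∀ᵐ x ∂posMeasure, 0 < x := ae_restrict_mem measurableSet_Ioi

/-- Lebesgue measure on the positive octant. -/
noncomputable def octantMeasure : Measure (ℝ × ℝ × ℝ) :=
  posMeasure.prod (posMeasure.prod posMeasure)

instance : SFinite octantMeasure :=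
  inferInstanceAs (SFinite (posMeasure.prod (posMeasure.prod posMeasure)))

lemma ae_octant : ∀ᵐ p ∂octantMeasure, 0 < p.1 ∧ 0 < p.2.1 ∧ 0 < p.2.2 := by
  have h : octantMeasure = (volume.prod (volume.prod volume)).restrict
      (Ioi 0 ×ˢ Ioi (0 : ℝ) ×ˢ Ioi (0 : ℝ)) := by
    rw [octantMeasure, posMeasure, Measure.prod_restrict, Measure.prod_restrict]
  rw [h]
  filter_upwards [ae_restrict_mem (measurableSet_Ioi.prod
    (measurableSet_Ioi.prod measurableSet_Ioi))] with p hp using hp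

/-- The linear factor of the banana polynomial. -/
def sumVar (p : ℝ × ℝ × ℝ) : ℝ := 1 + p.1 + p.2.1 + p.2.2

/-- The reciprocal factor of the banana polynomial. -/
noncomputable def sumInv (p : ℝ × ℝ × ℝ) : ℝ := 1 + p.1⁻¹ + p.2.1⁻¹ + p.2.2⁻¹

/-- The density of the multiplicative Haar measure. -/
noncomputable def haarDensity (p : ℝ × ℝ × ℝ) : ℝ := (p.1 * p.2.1 * p.2.2)⁻¹

@[fun_prop] lemma measurable_sumVar : Measurable sumVar := by unfold sumVar; fun_prop
@[fun_prop] lemma measurable_sumInv : Measurable sumInv := by unfold sumInv; fun_prop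
@[fun_prop] lemma measurable_haarDensity : Measurable haarDensity := by unfold haarDensity; fun_prop

lemma lintegral_pos_comp_mul {c : ℝ} (hc : 0 < c) (g : ℝ → ℝ≥0∞) :
    ∫⁻ x, g x ∂posMeasure = ∫⁻ x, ENNReal.ofReal c * g (c * x) ∂posMeasure := by
  have h := lintegral_image_eq_lintegral_abs_deriv_mul (s := Ioi (0 : ℝ)) (f := fun x => c * x)
    (f' := fun _ => c) measurableSet_Ioi
    (fun x _ => by simpa using ((hasDerivAt_id x).const_mul c).hasDerivWithinAt)
    (fun x _ y _ h => mul_left_cancel₀ hc.ne' h) g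
  rw [abs_of_pos hc] at h
  rw [posMeasure, ← h]
  congr 2
  simp [image_mul_left_Ioi hc]

lemma lintegral_pow_mul_exp (k : ℕ) {s : ℝ} (hs : 0 < s) :
    ∫⁻ x, ENNReal.ofReal (x ^ k * Real.exp (-(x * s))) ∂posMeasure
      = ENNReal.ofReal (k.factorial / s ^ (k + 1)) := by
  have h := Real.integral_rpow_mul_exp_neg_mul_Ioi (a := k + 1) (r := s) (by positivity) hs
  rw [Real.Gamma_nat_eq_factorial] at h
  have h' : ∫ x, x ^ k * Real.exp (-(x * s)) ∂posMeasure = k.factorial / s ^ (k + 1) := by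
    rw [posMeasure]
    calc _ = ∫ t in Ioi (0 : ℝ), t ^ ((k : ℝ) + 1 - 1) * Real.exp (-(s * t)) := by
          congr 1; ext t; rw [add_sub_cancel_right, Real.rpow_natCast, mul_comm s]
      _ = _ := by
          rw [h]
          have : ((k : ℝ) + 1) = ((k + 1 : ℕ) : ℝ) := by push_cast; ring
          rw [this, Real.rpow_natCast, div_pow, one_pow]
          ring
  rw [← h', ofReal_integral_eq_lintegral_ofReal (.of_integral_ne_zero (by rw [h']; positivity))]
  filter_upwards [ae_pos] with x hx
  show 0 ≤ x ^ k * _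
  positivity

lemma lintegral_besselOne {a b : ℝ} (ha : 0 < a) (hb : 0 < b) :
    ∫⁻ x, ENNReal.ofReal (Real.exp (-(a * x) - b / x) / x) ∂posMeasure
      = ENNReal.ofReal (bessel 1 (a * b)) := by
  rw [bessel, ofReal_integral_eq_lintegral_ofReal (integrableOn_bessel 1 (mul_pos ha hb)),
    ← posMeasure,
    lintegral_pos_comp_mul ha (fun x => ENNReal.ofReal (Real.exp (-x - a * b / x) / x ^ 1))]
  · refine lintegral_congr_ae ?_
    filter_upwards [ae_pos] with x hx
    rw [← ENNReal.ofReal_mul ha.le]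
    congr 1
    rw [mul_div_mul_left _ _ ha.ne']
    field_simp
  · filter_upwards [ae_pos] with x hx
    show 0 ≤ _ / x ^ 1
    positivity

/-- The integrand after introducing Schwinger parameters. -/
noncomputable def schwinger (k : ℕ) (p : ℝ × ℝ × ℝ) (q : ℝ × ℝ) : ℝ≥0∞ :=
  ENNReal.ofReal (q.1 ^ k * q.2 ^ k * Real.exp (-q.1 - q.2)) *
    (ENNReal.ofReal (Real.exp (-(q.1 * p.1) - q.2 / p.1) / p.1) *
    (ENNReal.ofReal (Real.exp (-(q.1 * p.2.1) - q.2 / p.2.1) / p.2.1) *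
    ENNReal.ofReal (Real.exp (-(q.1 * p.2.2) - q.2 / p.2.2) / p.2.2)))

lemma ae_prod_pos : ∀ᵐ q ∂posMeasure.prod posMeasure, 0 < q.1 ∧ 0 < q.2 := by
  rw [posMeasure, Measure.prod_restrict]
  filter_upwards [ae_restrict_mem (measurableSet_Ioi.prod measurableSet_Ioi)] with p hp using hp

lemma lintegral_schwinger_left (k : ℕ) {q : ℝ × ℝ} (h1 : 0 < q.1) (h2 : 0 < q.2) :
    ∫⁻ p, schwinger k p q ∂octantMeasure =
      ENNReal.ofReal (q.1 ^ k * q.2 ^ k * Real.exp (-q.1 - q.2) * bessel 1 (q.1 * q.2) ^ 3) := by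
  have hm : Measurable fun x : ℝ => ENNReal.ofReal (Real.exp (-(q.1 * x) - q.2 / x) / x) := by
    fun_prop
  unfold schwinger
  rw [lintegral_const_mul _ (by fun_prop), octantMeasure,
    lintegral_prod_mul (f := fun x => ENNReal.ofReal (Real.exp (-(q.1 * x) - q.2 / x) / x))
      (g := fun p : ℝ × ℝ => ENNReal.ofReal (Real.exp (-(q.1 * p.1) - q.2 / p.1) / p.1) *
    ENNReal.ofReal (Real.exp (-(q.1 * p.2) - q.2 / p.2) / p.2)) hm.aemeasurable
      (by fun_prop),
    lintegral_prod_mul (f := fun x => ENNReal.ofReal (Real.exp (-(q.1 * x) - q.2 / x) / x))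
      (g := fun x => ENNReal.ofReal (Real.exp (-(q.1 * x) - q.2 / x) / x)) hm.aemeasurable
      hm.aemeasurable, lintegral_besselOne h1 h2, ← ENNReal.ofReal_mul (bessel_nonneg _ _),
    ← ENNReal.ofReal_mul (bessel_nonneg _ _), ← ENNReal.ofReal_mul (by positivity)]
  congr 1
  ring

lemma lintegral_schwinger_right (k : ℕ) {p : ℝ × ℝ × ℝ} (h : 0 < p.1 ∧ 0 < p.2.1 ∧ 0 < p.2.2) :
    ∫⁻ q, schwinger k p q ∂posMeasure.prod posMeasure = ENNReal.ofReal ((k.factorial : ℝ) ^ 2) *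
      ENNReal.ofReal (((sumVar p * sumInv p) ^ (k + 1))⁻¹ * haarDensity p) := by
  obtain ⟨hx, hy, hz⟩ := h
  have hS : 0 < sumVar p := by unfold sumVar; positivity
  have hT : 0 < sumInv p := by unfold sumInv; positivity
  have hw : 0 < haarDensity p := by unfold haarDensity; positivity
  calc _ = ∫⁻ q, (ENNReal.ofReal (haarDensity p) *
        ENNReal.ofReal (q.1 ^ k * Real.exp (-(q.1 * sumVar p)))) *
        ENNReal.ofReal (q.2 ^ k * Real.exp (-(q.2 * sumInv p))) ∂posMeasure.prod posMeasure := by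
        refine lintegral_congr_ae ?_
        filter_upwards [ae_prod_pos] with q ⟨hq1, hq2⟩
        unfold schwinger
        rw [← ENNReal.ofReal_mul (by positivity), ← ENNReal.ofReal_mul (by positivity),
          ← ENNReal.ofReal_mul (by positivity), ← ENNReal.ofReal_mul (by positivity),
          ← ENNReal.ofReal_mul (by positivity)]
        congr 1
        have : Real.exp (-(q.1 * sumVar p)) * Real.exp (-(q.2 * sumInv p)) =
            Real.exp (-q.1 - q.2) * Real.exp (-(q.1 * p.1) - q.2 / p.1) *
            Real.exp (-(q.1 * p.2.1) - q.2 / p.2.1) * Real.exp (-(q.1 * p.2.2) - q.2 / p.2.2) := by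
          rw [← Real.exp_add, ← Real.exp_add, ← Real.exp_add, ← Real.exp_add]
          congr 1
          unfold sumVar sumInv
          ring
        rw [show haarDensity p * (q.1 ^ k * Real.exp (-(q.1 * sumVar p))) *
          (q.2 ^ k * Real.exp (-(q.2 * sumInv p))) = haarDensity p * q.1 ^ k * q.2 ^ k *
          (Real.exp (-(q.1 * sumVar p)) * Real.exp (-(q.2 * sumInv p))) by ring, this, haarDensity]
        field_simp
    _ = _ := by
        rw [lintegral_prod_mul (f := fun x => ENNReal.ofReal (haarDensity p) *
          ENNReal.ofReal (x ^ k * Real.exp (-(x * sumVar p))))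
          (g := fun x => ENNReal.ofReal (x ^ k * Real.exp (-(x * sumInv p)))) (by fun_prop)
          (by fun_prop), lintegral_const_mul _ (by fun_prop), lintegral_pow_mul_exp k hS,
          lintegral_pow_mul_exp k hT, ← ENNReal.ofReal_mul (by positivity),
          ← ENNReal.ofReal_mul (by positivity), ← ENNReal.ofReal_mul (by positivity)]
        congr 1
        rw [mul_pow]
        field_simp

@[fun_prop] lemma measurable_bessel (n : ℕ) : Measurable (bessel n) := by
  have h : StronglyMeasurable (Function.uncurry fun (w x : ℝ) => Real.exp (-x - w / x) / x ^ n) := by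
    apply Measurable.stronglyMeasurable
    unfold Function.uncurry
    fun_prop
  exact (h.integral_prod_right (ν := volume.restrict (Ioi 0))).measurable

lemma lintegral_bessel_double (k : ℕ) :
    ∫⁻ q, ENNReal.ofReal (q.1 ^ k * q.2 ^ k * Real.exp (-q.1 - q.2) * bessel 1 (q.1 * q.2) ^ 3)
      ∂posMeasure.prod posMeasure = ENNReal.ofReal (besselMoment 4 0 k) := by
  rw [lintegral_prod _ (by fun_prop)]
  calc _ = ∫⁻ a, ∫⁻ w, ENNReal.ofReal (w ^ k * bessel 1 w ^ 3) *
        ENNReal.ofReal (Real.exp (-(1 * a) - w / a) / a) ∂posMeasure ∂posMeasure := by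
        refine lintegral_congr_ae ?_
        filter_upwards [ae_pos] with a ha
        rw [lintegral_pos_comp_mul (inv_pos.mpr ha)]
        refine lintegral_congr_ae ?_
        filter_upwards [ae_pos] with w hw
        have hb := bessel_nonneg 1 w
        have hb2 : 0 ≤ w ^ k * bessel 1 w ^ 3 := by positivity
        rw [← ENNReal.ofReal_mul (by positivity), ← ENNReal.ofReal_mul hb2]
        have e : a * (a⁻¹ * w) = w := by field_simp
        have e2 : a ^ k * (a⁻¹ * w) ^ k = w ^ k := by rw [← mul_pow, e]
        have e3 : -a - a⁻¹ * w = -(1 * a) - w / a := by ring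
        simp only [e, e2, e3]
        congr 1
        field_simp
    _ = ∫⁻ w, ∫⁻ a, ENNReal.ofReal (w ^ k * bessel 1 w ^ 3) *
        ENNReal.ofReal (Real.exp (-(1 * a) - w / a) / a) ∂posMeasure ∂posMeasure := by
        rw [lintegral_lintegral_swap]
        exact Measurable.aemeasurable (by unfold Function.uncurry; fun_prop)
    _ = ∫⁻ w, ENNReal.ofReal (besselProd 4 0 k w) ∂posMeasure := by
        refine lintegral_congr_ae ?_
        filter_upwards [ae_pos] with w hw
        have hb := bessel_nonneg 1 w
        rw [lintegral_const_mul _ (by fun_prop), lintegral_besselOne one_pos hw,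
          ← ENNReal.ofReal_mul (by positivity), one_mul, besselProd]
        congr 1
        ring
    _ = _ := by
        rw [besselMoment, ofReal_integral_eq_lintegral_ofReal
          (integrableOn_besselProd (by norm_num) (by norm_num) k), ← posMeasure]
        filter_upwards [ae_pos] with w hw using besselProd_nonneg _ _ _ hw

lemma lintegral_banana (k : ℕ) :
    ∫⁻ p, ENNReal.ofReal (((sumVar p * sumInv p) ^ (k + 1))⁻¹ * haarDensity p) ∂octantMeasure
      = ENNReal.ofReal (bananaMoment k) := by
  have h : ∫⁻ p, ∫⁻ q, schwinger k p q ∂posMeasure.prod posMeasure ∂octantMeasure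
      = ∫⁻ q, ∫⁻ p, schwinger k p q ∂octantMeasure ∂posMeasure.prod posMeasure :=
    lintegral_lintegral_swap
      (Measurable.aemeasurable (by unfold Function.uncurry schwinger; fun_prop))
  have h1 : ∫⁻ p, ∫⁻ q, schwinger k p q ∂posMeasure.prod posMeasure ∂octantMeasure =
      ENNReal.ofReal ((k.factorial : ℝ) ^ 2) * ∫⁻ p, ENNReal.ofReal
        (((sumVar p * sumInv p) ^ (k + 1))⁻¹ * haarDensity p) ∂octantMeasure := by
    rw [← lintegral_const_mul _ (by fun_prop)]
    refine lintegral_congr_ae ?_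
    filter_upwards [ae_octant] with p hp using lintegral_schwinger_right k hp
  have h2 : ∫⁻ q, ∫⁻ p, schwinger k p q ∂octantMeasure ∂posMeasure.prod posMeasure =
      ENNReal.ofReal (besselMoment 4 0 k) := by
    rw [← lintegral_bessel_double]
    refine lintegral_congr_ae ?_
    filter_upwards [ae_prod_pos] with q hq using lintegral_schwinger_left k hq.1 hq.2
  rw [h1, h2] at h
  have hk : (0 : ℝ) < (k.factorial : ℝ) ^ 2 := by positivity
  rw [bananaMoment, ENNReal.ofReal_div_of_pos hk, ← h, mul_comm,
    ENNReal.mul_div_cancel_right (by simpa using hk.ne') ENNReal.ofReal_ne_top]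

end ThreeBanana

namespace ThreeBanana

open Filter Topology Set
open scoped ENNReal

/-- The multiplicative Haar measure on the positive octant. -/
noncomputable def haarOctant : Measure (ℝ × ℝ × ℝ) :=
  octantMeasure.withDensity fun p => ENNReal.ofReal (haarDensity p)

/-- The banana polynomial. -/
noncomputable def bananaPoly (p : ℝ × ℝ × ℝ) : ℝ := sumVar p * sumInv p

@[fun_prop] lemma measurable_bananaPoly : Measurable bananaPoly := by unfold bananaPoly; fun_prop

lemma bananaPoly_sub {p : ℝ × ℝ × ℝ} (h : 0 < p.1 ∧ 0 < p.2.1 ∧ 0 < p.2.2) :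
    bananaPoly p - 16 = (p.1 - 1) ^ 2 / p.1 + (p.2.1 - 1) ^ 2 / p.2.1 + (p.2.2 - 1) ^ 2 / p.2.2 +
      (p.1 - p.2.1) ^ 2 / (p.1 * p.2.1) + (p.1 - p.2.2) ^ 2 / (p.1 * p.2.2) +
      (p.2.1 - p.2.2) ^ 2 / (p.2.1 * p.2.2) := by
  obtain ⟨hx, hy, hz⟩ := h
  unfold bananaPoly sumVar sumInv
  field_simp
  ring

lemma ae_fst_ne_one : ∀ᵐ p ∂octantMeasure, p.1 ≠ 1 := by
  have h : ∀ᵐ x ∂posMeasure, x ≠ 1 := by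
    rw [posMeasure]
    exact ae_restrict_of_ae (by simp [ae_iff])
  exact Measure.quasiMeasurePreserving_fst.ae h

lemma ae_bananaPoly_gt' : ∀ᵐ p ∂octantMeasure, 16 < bananaPoly p := by
  filter_upwards [ae_octant, ae_fst_ne_one] with p hp h1
  have h := bananaPoly_sub hp
  obtain ⟨hx, hy, hz⟩ := hp
  have : 0 < (p.1 - 1) ^ 2 / p.1 := by
    have : p.1 - 1 ≠ 0 := sub_ne_zero.2 h1
    positivity
  have : 0 < bananaPoly p - 16 := by rw [h]; positivity
  linarith

lemma ae_bananaPoly_gt : ∀ᵐ p ∂haarOctant, 16 < bananaPoly p :=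
  (withDensity_absolutelyContinuous _ _).ae_le ae_bananaPoly_gt'

lemma lintegral_bananaPoly_pow (k : ℕ) :
    ∫⁻ p, ENNReal.ofReal ((bananaPoly p ^ (k + 1))⁻¹) ∂haarOctant =
      ENNReal.ofReal (bananaMoment k) := by
  rw [haarOctant, lintegral_withDensity_eq_lintegral_mul _ (by fun_prop) (by fun_prop),
    ← lintegral_banana]
  refine lintegral_congr_ae ?_
  filter_upwards [ae_bananaPoly_gt'] with p hp
  have : 0 < bananaPoly p := by linarith
  simp only [Pi.mul_apply]
  rw [mul_comm, ← ENNReal.ofReal_mul (by positivity)]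
  rfl

lemma bananaMoment_nonneg (k : ℕ) : 0 ≤ bananaMoment k := by
  unfold bananaMoment besselMoment
  refine div_nonneg (setIntegral_nonneg measurableSet_Ioi fun x hx => ?_) (by positivity)
  have hx : 0 < x := hx
  exact besselProd_nonneg _ _ _ hx

lemma integrable_bananaPoly_pow (k : ℕ) :
    Integrable (fun p => (bananaPoly p ^ (k + 1))⁻¹) haarOctant := by
  refine ⟨by fun_prop, ?_⟩
  rw [hasFiniteIntegral_iff_ofReal, lintegral_bananaPoly_pow]
  · exact ENNReal.ofReal_lt_top
  · filter_upwards [ae_bananaPoly_gt] with p hp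
    have : 0 < bananaPoly p := by linarith
    show 0 ≤ (bananaPoly p ^ (k + 1))⁻¹
    positivity

lemma integral_bananaPoly_pow (k : ℕ) :
    ∫ p, (bananaPoly p ^ (k + 1))⁻¹ ∂haarOctant = bananaMoment k := by
  rw [integral_eq_lintegral_of_nonneg_ae, lintegral_bananaPoly_pow,
    ENNReal.toReal_ofReal (bananaMoment_nonneg k)]
  · filter_upwards [ae_bananaPoly_gt] with p hp
    have : 0 < bananaPoly p := by linarith
    show 0 ≤ (bananaPoly p ^ (k + 1))⁻¹
    positivity
  · fun_prop

lemma bananaMoment_le (k : ℕ) : bananaMoment k ≤ bananaMoment 0 * (1 / 16) ^ k := by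
  rw [← integral_bananaPoly_pow, ← integral_bananaPoly_pow, ← integral_mul_const]
  refine integral_mono_ae (integrable_bananaPoly_pow k)
    ((integrable_bananaPoly_pow 0).mul_const _) ?_
  filter_upwards [ae_bananaPoly_gt] with p hp
  have h0 : 0 < bananaPoly p := by linarith
  show (bananaPoly p ^ (k + 1))⁻¹ ≤ _
  rw [pow_succ, mul_inv, mul_comm, zero_add, pow_one, ← inv_pow]
  gcongr
  rw [one_div]
  gcongr

/-- The Feynman integral as a function of a complex parameter. -/
noncomputable def bananaInt (t : ℂ) : ℂ := ∫ p, ((bananaPoly p : ℂ) - t)⁻¹ ∂haarOctant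

lemma hasSum_bananaInt {t : ℂ} (ht : ‖t‖ < 16) :
    HasSum (fun k => (bananaMoment k : ℂ) * t ^ k) (bananaInt t) := by
  have hterm_int : ∀ k, Integrable (fun p => t ^ k * (((bananaPoly p ^ (k + 1))⁻¹ : ℝ) : ℂ))
      haarOctant := fun k => ((integrable_bananaPoly_pow k).ofReal).const_mul _
  have hnorm : ∀ k, ∫ p, ‖t ^ k * (((bananaPoly p ^ (k + 1))⁻¹ : ℝ) : ℂ)‖ ∂haarOctant =
      ‖t‖ ^ k * bananaMoment k := by
    intro k
    rw [← integral_bananaPoly_pow, ← integral_const_mul]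
    refine integral_congr_ae ?_
    filter_upwards [ae_bananaPoly_gt] with p hp
    have h0 : 0 < bananaPoly p := by linarith
    rw [norm_mul, norm_pow, Complex.norm_real, Real.norm_of_nonneg (by positivity)]
  have h := hasSum_integral_of_summable_integral_norm hterm_int (by
    simp_rw [hnorm]
    refine Summable.of_nonneg_of_le (fun k => mul_nonneg (by positivity) (bananaMoment_nonneg k))
      (fun k => mul_le_mul_of_nonneg_left (bananaMoment_le k) (by positivity)) ?_
    have : Summable fun k : ℕ => bananaMoment 0 * (‖t‖ / 16) ^ k :=
      (summable_geometric_of_lt_one (by positivity) (by linarith)).mul_left _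
    refine this.congr fun k => ?_
    rw [div_pow, div_pow, one_pow]
    ring)
  have e0 : (fun k => (bananaMoment k : ℂ) * t ^ k) =
      fun k => ∫ p, t ^ k * (((bananaPoly p ^ (k + 1))⁻¹ : ℝ) : ℂ) ∂haarOctant := by
    ext k
    rw [integral_const_mul, integral_complex_ofReal, integral_bananaPoly_pow, mul_comm]
  have e2 : bananaInt t =
      ∫ p, ∑' k, t ^ k * (((bananaPoly p ^ (k + 1))⁻¹ : ℝ) : ℂ) ∂haarOctant := by
    refine integral_congr_ae ?_
    filter_upwards [ae_bananaPoly_gt] with p hp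
    have h0 : 0 < bananaPoly p := by linarith
    have h0' : (bananaPoly p : ℂ) ≠ 0 := by exact_mod_cast h0.ne'
    have hr : ‖t / bananaPoly p‖ < 1 := by
      rw [norm_div, Complex.norm_real, Real.norm_of_nonneg h0.le, div_lt_one h0]
      linarith
    have h1 := (hasSum_geometric_of_norm_lt_one hr).mul_left (bananaPoly p : ℂ)⁻¹
    have hne : (bananaPoly p : ℂ) - t ≠ 0 := by
      intro hh
      rw [sub_eq_zero] at hh
      rw [← hh, div_self h0', norm_one] at hr
      exact lt_irrefl _ hr
    have e1 : (bananaPoly p : ℂ)⁻¹ * (1 - t / bananaPoly p)⁻¹ = (bananaPoly p - t)⁻¹ := by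
      rw [← mul_inv, mul_sub, mul_one, mul_div_cancel₀ _ h0']
    rw [← e1, ← h1.tsum_eq]
    refine tsum_congr fun k => ?_
    push_cast
    rw [div_pow, pow_succ]
    field_simp
  rw [e0, e2]
  exact h

lemma norm_inv_sub_le {r : ℝ} {t : ℂ} (hr : 0 < r) {Q : ℝ} (hQ : 16 < Q)
    (h : r ≤ ‖(Q : ℂ) - t‖) : ‖((Q : ℂ) - t)⁻¹‖ ≤ (1 + ‖t‖ / r) * Q⁻¹ := by
  have h0 : 0 < Q := by linarith
  have hd : 0 < ‖(Q : ℂ) - t‖ := by linarith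
  have h1 : Q ≤ ‖(Q : ℂ) - t‖ + ‖t‖ := by
    have := norm_add_le ((Q : ℂ) - t) t
    rwa [sub_add_cancel, Complex.norm_real, Real.norm_of_nonneg h0.le] at this
  rw [norm_inv, ← div_eq_mul_inv, le_div_iff₀ h0, inv_mul_le_iff₀ hd]
  have : ‖t‖ ≤ ‖(Q : ℂ) - t‖ * (‖t‖ / r) := by
    rw [mul_div_assoc', le_div_iff₀ hr, mul_comm ‖(Q : ℂ) - t‖]
    gcongr
  linarith

/-- The cut plane on which the Feynman integral is analytic. -/
def cutPlane : Set ℂ := {t : ℂ | t.im ≠ 0 ∨ t.re < 16}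

lemma exists_ball_cutPlane {t : ℂ} (ht : t ∈ cutPlane) :
    ∃ r > 0, ∀ s ∈ Metric.ball t r, ∀ Q : ℝ, 16 < Q → r ≤ ‖(Q : ℂ) - s‖ := by
  obtain ⟨r, hr, h⟩ : ∃ r > 0, ∀ Q : ℝ, 16 < Q → r ≤ ‖(Q : ℂ) - t‖ := by
    rcases ht with ht | ht
    · refine ⟨|t.im|, abs_pos.2 ht, fun Q _ => ?_⟩
      have := Complex.abs_im_le_norm ((Q : ℂ) - t)
      simpa using this
    · refine ⟨16 - t.re, by linarith, fun Q hQ => ?_⟩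
      have := Complex.re_le_norm ((Q : ℂ) - t)
      simp only [Complex.sub_re, Complex.ofReal_re] at this
      linarith
  refine ⟨r / 2, by positivity, fun s hs Q hQ => ?_⟩
  have h1 := h Q hQ
  have h2 := norm_sub_le_norm_sub_add_norm_sub (Q : ℂ) s t
  rw [Metric.mem_ball, dist_eq_norm] at hs
  linarith

lemma integrable_bananaInt {t : ℂ} (ht : t ∈ cutPlane) :
    Integrable (fun p => ((bananaPoly p : ℂ) - t)⁻¹) haarOctant := by
  obtain ⟨r, hr, h⟩ := exists_ball_cutPlane ht
  have h0 := (integrable_bananaPoly_pow 0).const_mul (1 + ‖t‖ / r)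
  refine h0.mono' (by fun_prop) ?_
  filter_upwards [ae_bananaPoly_gt] with p hp
  have := norm_inv_sub_le hr hp (h t (Metric.mem_ball_self hr) _ hp)
  simpa using this

lemma differentiableAt_bananaInt {t : ℂ} (ht : t ∈ cutPlane) : DifferentiableAt ℂ bananaInt t := by
  obtain ⟨r, hr, h⟩ := exists_ball_cutPlane ht
  have h0 := (integrable_bananaPoly_pow 0).const_mul ((1 + (‖t‖ + r) / r) / r)
  refine (hasDerivAt_integral_of_dominated_loc_of_deriv_le (μ := haarOctant)
    (F := fun t p => ((bananaPoly p : ℂ) - t)⁻¹)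
    (F' := fun t p => ((bananaPoly p : ℂ) - t)⁻¹ * ((bananaPoly p : ℂ) - t)⁻¹)
    (Metric.ball_mem_nhds t hr) (Eventually.of_forall fun s => by fun_prop)
    (integrable_bananaInt ht) (by fun_prop) ?_ h0 ?_).2.differentiableAt
  · filter_upwards [ae_bananaPoly_gt] with p hp s hs
    have hb := h s hs _ hp
    have h1 := norm_inv_sub_le hr hp hb
    have hQ : 0 < bananaPoly p := by linarith
    have h2 : ‖((bananaPoly p : ℂ) - s)⁻¹‖ ≤ r⁻¹ := by
      rw [norm_inv]; gcongr
    have h3 : ‖s‖ ≤ ‖t‖ + r := by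
      rw [Metric.mem_ball, dist_eq_norm] at hs
      have := norm_sub_norm_le s t
      linarith
    rw [norm_mul, zero_add, pow_one]
    calc _ ≤ r⁻¹ * ((1 + ‖s‖ / r) * (bananaPoly p)⁻¹) := by gcongr
      _ ≤ r⁻¹ * ((1 + (‖t‖ + r) / r) * (bananaPoly p)⁻¹) := by gcongr
      _ = _ := by ring
  · filter_upwards [ae_bananaPoly_gt] with p hp s hs
    have hb := h s hs _ hp
    have hne : (bananaPoly p : ℂ) - s ≠ 0 := norm_pos_iff.1 (by linarith)
    have := ((hasDerivAt_const s (bananaPoly p : ℂ)).sub (hasDerivAt_id s)).inv hne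
    refine this.congr_deriv ?_
    show -(0 - 1) / ((bananaPoly p : ℂ) - s) ^ 2 = _
    field_simp
    ring

lemma norm_inv_le_re_add_im {w : ℂ} {C : ℝ} (hC : 0 ≤ C) (him : w.im ≤ 0)
    (h : C * w.im ≤ w.re) : ‖w⁻¹‖ ≤ w⁻¹.re + (1 + 2 * C) * w⁻¹.im := by
  rcases eq_or_ne w 0 with rfl | hw
  · simp
  have hn : 0 < Complex.normSq w := Complex.normSq_pos.2 hw
  have h1 : ‖w‖ ≤ |w.re| + |w.im| := Complex.norm_le_abs_re_add_abs_im w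
  have h2 : |w.re| ≤ w.re + 2 * C * (-w.im) := by
    rw [abs_le]
    constructor <;> nlinarith
  rw [abs_of_nonpos him] at h1
  have h3 : ‖w⁻¹‖ = ‖w‖ / Complex.normSq w := by
    rw [norm_inv, Complex.normSq_eq_norm_sq, pow_two]
    have : 0 < ‖w‖ := norm_pos_iff.2 hw
    field_simp
  rw [h3, Complex.inv_re, Complex.inv_im, mul_div_assoc', ← add_div]
  gcongr
  linarith

/-- Boundary values at the branch point, approached inside a cone in the upper half plane. -/
lemma bananaInt_boundary {C : ℝ} (hC : 0 ≤ C) {t : ℕ → ℂ} {L : ℂ}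
    (ht : Tendsto t atTop (𝓝 16)) (him : ∀ n, 0 < (t n).im)
    (hre : ∀ n, |(t n).re - 16| ≤ C * (t n).im)
    (hL : Tendsto (fun n => bananaInt (t n)) atTop (𝓝 L)) :
    Integrable (fun p => ((bananaPoly p : ℂ) - 16)⁻¹) haarOctant ∧ bananaInt 16 = L := by
  have hcut : ∀ n, t n ∈ cutPlane := fun n => Or.inl (him n).ne'
  have hlim : ∀ᵐ p ∂haarOctant, Tendsto (fun n => ((bananaPoly p : ℂ) - t n)⁻¹) atTop
      (𝓝 ((bananaPoly p : ℂ) - 16)⁻¹) := by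
    filter_upwards [ae_bananaPoly_gt] with p hp
    refine (tendsto_const_nhds.sub ht).inv₀ (sub_ne_zero.2 ?_)
    exact_mod_cast hp.ne'
  have hnorm : ∀ n, ∫⁻ p, ‖((bananaPoly p : ℂ) - t n)⁻¹‖ₑ ∂haarOctant ≤
      ENNReal.ofReal ((bananaInt (t n)).re + (1 + 2 * C) * (bananaInt (t n)).im) := by
    intro n
    have hi := integrable_bananaInt (hcut n)
    have e : (bananaInt (t n)).re + (1 + 2 * C) * (bananaInt (t n)).im =
        ∫ p, (((bananaPoly p : ℂ) - t n)⁻¹.re + (1 + 2 * C) * ((bananaPoly p : ℂ) - t n)⁻¹.im)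
          ∂haarOctant := by
      have e1 := integral_re hi
      have e2 := integral_im hi
      simp only [RCLike.re_to_complex, RCLike.im_to_complex] at e1 e2
      have e3 := integral_add hi.re (hi.im.const_mul (1 + 2 * C))
      simp only [RCLike.re_to_complex, RCLike.im_to_complex] at e3
      rw [e3, integral_const_mul]
      exact congrArg₂ _ e1.symm (congrArg _ e2.symm)
    have h1 : ∫ p, ‖((bananaPoly p : ℂ) - t n)⁻¹‖ ∂haarOctant ≤
        (bananaInt (t n)).re + (1 + 2 * C) * (bananaInt (t n)).im := by
      rw [e]
      refine integral_mono_ae hi.norm (hi.re.add (hi.im.const_mul _)) ?_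
      filter_upwards [ae_bananaPoly_gt] with p hp
      have h2 := abs_le.1 (hre n)
      refine norm_inv_le_re_add_im hC ?_ ?_
      · simpa using (him n).le
      · simp only [Complex.sub_im, Complex.ofReal_im, Complex.sub_re, Complex.ofReal_re]
        linarith
    rw [← ofReal_integral_norm_eq_lintegral_enorm hi]
    exact ENNReal.ofReal_le_ofReal h1
  have hlimit : Tendsto (fun n => ENNReal.ofReal ((bananaInt (t n)).re +
      (1 + 2 * C) * (bananaInt (t n)).im)) atTop
      (𝓝 (ENNReal.ofReal (L.re + (1 + 2 * C) * L.im))) :=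
    (ENNReal.continuous_ofReal.tendsto _).comp
      (((Complex.continuous_re.tendsto _).comp hL).add
        (((Complex.continuous_im.tendsto _).comp hL).const_mul _))
  have hI : Integrable (fun p => ((bananaPoly p : ℂ) - 16)⁻¹) haarOctant := by
    refine ⟨by fun_prop, ?_⟩
    have h1 : ∫⁻ p, ‖((bananaPoly p : ℂ) - 16)⁻¹‖ₑ ∂haarOctant ≤
        liminf (fun n => ∫⁻ p, ‖((bananaPoly p : ℂ) - t n)⁻¹‖ₑ ∂haarOctant) atTop := by
      refine le_trans (le_of_eq (lintegral_congr_ae ?_)) (lintegral_liminf_le' fun n => by fun_prop)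
      filter_upwards [hlim] with p hp using hp.enorm.liminf_eq.symm
    refine lt_of_le_of_lt (h1.trans (liminf_le_liminf (Eventually.of_forall hnorm))) ?_
    rw [hlimit.liminf_eq]
    exact ENNReal.ofReal_lt_top
  refine ⟨hI, tendsto_nhds_unique ?_ hL⟩
  refine tendsto_integral_of_dominated_convergence
    (fun p => (C + 2) * ‖((bananaPoly p : ℂ) - 16)⁻¹‖) (fun n => by fun_prop)
    (hI.norm.const_mul _) (fun n => ?_) hlim
  filter_upwards [ae_bananaPoly_gt] with p hp
  set Q := bananaPoly p
  have h2 := abs_le.1 (hre n)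
  have hpos : 0 < ‖(Q : ℂ) - t n‖ := by
    refine norm_pos_iff.2 (sub_ne_zero.2 fun hh => (him n).ne' ?_)
    rw [← hh, Complex.ofReal_im]
  have h3 : ‖(Q : ℂ) - 16‖ = Q - 16 := by
    have : (Q : ℂ) - 16 = ((Q - 16 : ℝ) : ℂ) := by push_cast; rfl
    rw [this, Complex.norm_real, Real.norm_of_nonneg (by linarith)]
  have h4 := Complex.abs_im_le_norm ((Q : ℂ) - t n)
  have h5 := Complex.re_le_norm ((Q : ℂ) - t n)
  simp only [Complex.sub_im, Complex.ofReal_im, Complex.sub_re, Complex.ofReal_re, zero_sub,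
    abs_neg, abs_of_pos (him n)] at h4 h5
  rw [norm_inv, norm_inv, h3, ← div_eq_mul_inv, le_div_iff₀ (by linarith), inv_mul_le_iff₀ hpos]
  nlinarith

lemma feynmanI_eq_of_integrable {t : ℝ}
    (h : Integrable (fun p => ((bananaPoly p : ℂ) - t)⁻¹) haarOctant) :
    ((feynmanI t : ℝ) : ℂ) = bananaInt t := by
  have h' : Integrable (fun p => (bananaPoly p - t)⁻¹) haarOctant := by
    refine h.re.congr (Eventually.of_forall fun p => ?_)
    have : ((bananaPoly p : ℂ) - t)⁻¹ = (((bananaPoly p - t)⁻¹ : ℝ) : ℂ) := by push_cast; rfl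
    exact congrArg Complex.re this
  have e : bananaInt t = ((∫ p, (bananaPoly p - t)⁻¹ ∂haarOctant : ℝ) : ℂ) := by
    rw [← integral_complex_ofReal, bananaInt]
    push_cast
    rfl
  rw [e]
  congr 1
  have hw : ∀ᵐ p ∂octantMeasure, ENNReal.ofReal (haarDensity p) < ∞ :=
    Eventually.of_forall fun _ => ENNReal.ofReal_lt_top
  have h2 : Integrable (fun p => (bananaPoly p - t)⁻¹ * haarDensity p) octantMeasure := by
    rw [haarOctant, integrable_withDensity_iff (by fun_prop) hw] at h'
    refine h'.congr ?_
    filter_upwards [ae_octant] with p ⟨h1, h2, h3⟩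
    rw [ENNReal.toReal_ofReal (by unfold haarDensity; positivity)]
  have e2 : ∫ p, (bananaPoly p - t)⁻¹ ∂haarOctant =
      ∫ p, (bananaPoly p - t)⁻¹ * haarDensity p ∂octantMeasure := by
    rw [haarOctant, integral_withDensity_eq_integral_toReal_smul (by fun_prop) hw]
    refine integral_congr_ae ?_
    filter_upwards [ae_octant] with p ⟨h1, h2, h3⟩
    rw [ENNReal.toReal_ofReal (by unfold haarDensity; positivity), smul_eq_mul, mul_comm]
  rw [e2, octantMeasure, integral_prod _ h2]
  refine integral_congr_ae ?_
  filter_upwards [h2.prod_right_ae] with x hx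
  rw [integral_prod _ hx]
  rfl

end ThreeBanana

namespace ThreeBanana

open Complex Filter Topology Set

/-- The series `∑ kʲ M_k tᵏ` attached to the banana moments. -/
noncomputable def momentSer (j : ℕ) (t : ℂ) : ℂ := ∑' k : ℕ, (k : ℂ) ^ j * bananaMoment k * t ^ k

lemma polyBdd_moment (j : ℕ) : PolyBdd fun k => (k : ℂ) ^ j * bananaMoment k * 16 ^ k := by
  refine ⟨bananaMoment 0, j, fun k => ?_⟩
  have h := bananaMoment_le k
  rw [one_div, inv_pow, ← div_eq_mul_inv, le_div_iff₀ (by positivity)] at h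
  rw [norm_mul, norm_mul, norm_pow, norm_pow, Complex.norm_real,
    Real.norm_of_nonneg (bananaMoment_nonneg k), Complex.norm_natCast, mul_assoc]
  have h16 : ‖(16 : ℂ)‖ = 16 := by simp
  rw [h16, mul_comm]
  have h0 := bananaMoment_nonneg 0
  gcongr
  linarith

lemma summable_momentSer (j : ℕ) {t : ℂ} (ht : ‖t‖ < 16) :
    Summable fun k : ℕ => (k : ℂ) ^ j * bananaMoment k * t ^ k := by
  have h := (polyBdd_moment j).summable (z := t / 16)
    (by rw [norm_div]; simp; linarith)
  refine h.congr fun k => ?_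
  rw [div_pow]
  field_simp

lemma momentSer_zero_apply (j : ℕ) : momentSer j 0 = 0 ^ j * bananaMoment 0 := by
  rw [momentSer, tsum_eq_single 0 (by intro k hk; simp [hk])]
  simp

lemma momentSer_mul_nome (j : ℕ) (w : ℂ) : momentSer j (16 * nome w) =
    qSer (fun k => (k : ℂ) ^ j * bananaMoment k * 16 ^ k) w := by
  refine tsum_congr fun k => ?_
  rw [mul_pow]; ring

lemma exists_nome_eq {z : ℂ} (hz : z ≠ 0) (h : ‖z‖ < 1) : ∃ w : ℂ, 0 < w.im ∧ nome w = z := by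
  have he : nome (Complex.log z / (2 * Real.pi * I)) = z := by
    rw [nome, mul_div_cancel₀ _ two_pi_I_ne_zero, exp_log hz]
  refine ⟨_, ?_, he⟩
  rw [← he, norm_nome, Real.exp_lt_one_iff, neg_lt_zero] at h
  exact pos_of_mul_pos_right h (by positivity)

lemma hasDerivAt_momentSer (j : ℕ) {t : ℂ} (h0 : t ≠ 0) (ht : ‖t‖ < 16) :
    HasDerivAt (momentSer j) (momentSer (j + 1) t / t) t := by
  obtain ⟨w, hw, he⟩ := exists_nome_eq (z := t / 16) (by simpa using h0)
    (by rw [norm_div]; simp; linarith)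
  have ht' : t = 16 * nome w := by rw [he]; ring
  have hne := nome_ne_zero w
  have hl : HasDerivAt (fun s => w + Complex.log (s / t) / (2 * Real.pi * I))
      ((1 / t) / (t / t) / (2 * Real.pi * I)) t := by
    refine (((hasDerivAt_id t).div_const t).clog ?_).div_const _ |>.const_add w
    simp [div_self h0]
  have hq := hasDerivAt_qSer (polyBdd_moment j) (τ := w) hw
  have hv : w + Complex.log (t / t) / (2 * Real.pi * I) = w := by rw [div_self h0]; simp
  have hc := HasDerivAt.comp t (hv.symm ▸ hq) hl
  rw [hv] at hc
  have hev : momentSer j =ᶠ[𝓝 t] qSer (fun k => (k : ℂ) ^ j * bananaMoment k * 16 ^ k) ∘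
      (fun s => w + Complex.log (s / t) / (2 * Real.pi * I)) := by
    filter_upwards [isOpen_ne.mem_nhds h0] with s hs
    rw [Function.comp_apply, ← momentSer_mul_nome]
    congr 1
    rw [nome, mul_add, mul_div_cancel₀ _ two_pi_I_ne_zero, exp_add,
      exp_log (div_ne_zero hs h0), ← nome, ← mul_assoc, ← ht', mul_div_cancel₀ _ h0]
  refine (hc.congr_of_eventuallyEq hev).congr_deriv ?_
  rw [div_self h0, ht', momentSer_mul_nome, ← ht']
  have e : (fun n : ℕ => (n : ℂ) * ((n : ℂ) ^ j * bananaMoment n * 16 ^ n)) =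
      fun k : ℕ => (k : ℂ) ^ (j + 1) * bananaMoment k * 16 ^ k := by
    ext n; ring
  have hpi := two_pi_I_ne_zero
  rw [e]
  field_simp

lemma exists_hasDerivAt_momentSer (j : ℕ) {t : ℂ} (ht : ‖t‖ < 16) :
    ∃ d, HasDerivAt (momentSer j) d t ∧ d * t = momentSer (j + 1) t := by
  rcases eq_or_ne t 0 with rfl | h0
  · have hb : ∀ k : ℕ, ∀ z ∈ Metric.ball (0 : ℂ) 8,
        ‖(k : ℂ) ^ j * bananaMoment k * z ^ k‖ ≤ ‖(k : ℂ) ^ j * bananaMoment k * 8 ^ k‖ := by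
      intro k z hz
      rw [mem_ball_zero_iff] at hz
      rw [norm_mul, norm_mul _ (8 ^ k), norm_pow, norm_pow (8 : ℂ)]
      have : ‖(8 : ℂ)‖ = 8 := by simp
      rw [this]
      gcongr
    have h := (differentiableOn_tsum_of_summable_norm
      (summable_momentSer j (t := 8) (by simp; norm_num)).norm
      (fun k => by fun_prop) Metric.isOpen_ball hb).differentiableAt
      (Metric.ball_mem_nhds _ (by norm_num))
    exact ⟨_, h.hasDerivAt, by rw [momentSer_zero_apply]; simp⟩
  · exact ⟨_, hasDerivAt_momentSer j h0 ht, div_mul_cancel₀ _ h0⟩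

lemma tendsto_momentSer (j : ℕ) {ι : Type*} {l : Filter ι} {t : ι → ℂ} (ht : Tendsto t l (𝓝 0)) :
    Tendsto (fun i => momentSer j (t i)) l (𝓝 (0 ^ j * bananaMoment 0)) := by
  rw [← momentSer_zero_apply]
  obtain ⟨d, hd, -⟩ := exists_hasDerivAt_momentSer j (t := 0) (by simp)
  exact hd.continuousAt.tendsto.comp ht

/-- The inhomogeneous Picard-Fuchs equation. -/
lemma momentSer_ode {t : ℂ} (ht : ‖t‖ < 16) :
    64 * momentSer 3 t - 2 * t * (10 * momentSer 3 t + 15 * momentSer 2 t + 9 * momentSer 1 t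
      + 2 * momentSer 0 t) + t ^ 2 * (momentSer 3 t + 3 * momentSer 2 t + 3 * momentSer 1 t
      + momentSer 0 t) = -24 * t := by
  set f : ℕ → ℕ → ℂ := fun j k => (k : ℂ) ^ j * bananaMoment k * t ^ k with hf
  have hs : ∀ j, HasSum (f j) (momentSer j t) := fun j => (summable_momentSer j ht).hasSum
  have hs1 : ∀ j, HasSum (fun k => f j (k + 1)) (momentSer j t - f j 0) := fun j => by
    simpa using (hasSum_nat_add_iff' 1).2 (hs j)
  have hs2 : ∀ j, HasSum (fun k => f j (k + 2)) (momentSer j t - (f j 0 + f j 1)) := fun j => by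
    simpa [Finset.sum_range_succ] using (hasSum_nat_add_iff' 2).2 (hs j)
  have hA := (hs2 3).mul_left 64
  have hB := ((((hs1 3).mul_left 10).add ((hs1 2).mul_left 15)).add ((hs1 1).mul_left 9)).add
    ((hs1 0).mul_left 2) |>.mul_left (2 * t)
  have hC := (((hs 3).add ((hs 2).mul_left 3)).add ((hs 1).mul_left 3)).add (hs 0)
    |>.mul_left (t ^ 2)
  have hT := (hA.sub hB).add hC
  have h0 : ∀ k, 64 * f 3 (k + 2) - 2 * t * (10 * f 3 (k + 1) + 15 * f 2 (k + 1) + 9 * f 1 (k + 1)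
      + 2 * f 0 (k + 1)) + t ^ 2 * (f 3 k + 3 * f 2 k + 3 * f 1 k + f 0 k) = 0 := by
    intro k
    have hr : ((64 * ((k : ℝ) + 2) ^ 3 * bananaMoment (k + 2) -
      2 * (2 * k + 3) * (5 * ((k : ℝ) + 1) ^ 2 + 5 * (k + 1) + 2) * bananaMoment (k + 1) +
      ((k : ℝ) + 1) ^ 3 * bananaMoment k : ℝ) : ℂ) = 0 := by
      rw [bananaMoment_rec k]; simp
    push_cast at hr
    simp only [hf]
    push_cast
    linear_combination t ^ (k + 2) * hr
  have hz := hT.unique (by simpa only [h0] using hasSum_zero)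
  have hi : ((64 * bananaMoment 1 - 4 * bananaMoment 0 : ℝ) : ℂ) = -24 := by
    rw [bananaMoment_init]; simp
  push_cast at hi
  simp only [hf] at hz
  push_cast at hz
  linear_combination hz + t * hi

lemma bananaInt_eq_momentSer {t : ℂ} (ht : ‖t‖ < 16) : bananaInt t = momentSer 0 t := by
  rw [← (hasSum_bananaInt ht).tsum_eq, momentSer]
  simp

end ThreeBanana

namespace ThreeBanana

open Complex Filter Topology Set

/-- The filter of points approaching the cusp `i∞`. -/
noncomputable def cuspFilter : Filter ℂ := comap Complex.im atTop

lemma tendsto_qSer_cusp {c : ℕ → ℂ} (hc : PolyBdd c) : Tendsto (qSer c) cuspFilter (𝓝 (c 0)) :=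
  tendsto_qSer hc (f := id) tendsto_comap

lemma tendsto_nat_mul_cusp {d : ℕ} (hd : 0 < d) :
    Tendsto (fun τ : ℂ => (d : ℂ) * τ) cuspFilter cuspFilter := by
  rw [cuspFilter, tendsto_comap_iff]
  have : (Complex.im ∘ fun τ : ℂ => (d : ℂ) * τ) = fun τ => (d : ℝ) * τ.im := by
    ext τ; simp
  rw [this]
  exact tendsto_comap.const_mul_atTop (by exact_mod_cast hd)

lemma tendsto_eisTwo_cusp : Tendsto eisTwo cuspFilter (𝓝 1) := by
  have h := tendsto_qSer_cusp polyBdd_coeffTwo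
  rwa [show ((coeffTwo 0 : ℤ) : ℂ) = 1 by simp [coeffTwo]] at h

lemma tendsto_eisTwoDil_cusp {d : ℕ} (hd : 0 < d) :
    Tendsto (eisTwoDil d) cuspFilter (𝓝 d) := by
  have h := (tendsto_eisTwo_cusp.comp (tendsto_nat_mul_cusp hd)).const_mul (d : ℂ)
  rwa [mul_one] at h

lemma tendsto_formA_cusp : Tendsto formA cuspFilter (𝓝 1) := by
  have h2 := tendsto_eisTwoDil_cusp two_pos
  have h3 := tendsto_eisTwoDil_cusp three_pos
  have h6 := tendsto_eisTwoDil_cusp (d := 6) (by norm_num)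
  have := (((tendsto_eisTwo_cusp.div_const 6).sub (h2.div_const 3)).sub (h3.div_const 6)).add
    (h6.div_const 3)
  norm_num at this
  exact this

lemma tendsto_formB_cusp : Tendsto formB cuspFilter (𝓝 0) := by
  have h2 := tendsto_eisTwoDil_cusp two_pos
  have h3 := tendsto_eisTwoDil_cusp three_pos
  have h6 := tendsto_eisTwoDil_cusp (d := 6) (by norm_num)
  have := (((tendsto_eisTwo_cusp.neg.div_const 24).add (h2.div_const 48)).add
    (h3.div_const 24)).sub (h6.div_const 48)
  norm_num at this
  exact this

lemma tendsto_formW_cusp : Tendsto formW cuspFilter (𝓝 1) := by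
  have h2 := tendsto_eisTwoDil_cusp two_pos
  have h3 := tendsto_eisTwoDil_cusp three_pos
  have h6 := tendsto_eisTwoDil_cusp (d := 6) (by norm_num)
  have := (((tendsto_eisTwo_cusp.neg.div_const 4).add (h2.div_const 4)).sub
    (h3.div_const 4)).add (h6.div_const 4)
  norm_num at this
  exact this

lemma tendsto_logDerivA_cusp : Tendsto logDerivA cuspFilter (𝓝 0) := by
  have h2 := tendsto_eisTwoDil_cusp two_pos
  have h3 := tendsto_eisTwoDil_cusp three_pos
  have h6 := tendsto_eisTwoDil_cusp (d := 6) (by norm_num)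
  have := (((tendsto_eisTwo_cusp.div_const 6).sub (h2.div_const 12)).add (h3.div_const 6)).sub
    (h6.div_const 12)
  norm_num at this
  exact this

/-- The Hauptmodul `t = -64 B / A`. -/
noncomputable def hauptmodul (τ : ℂ) : ℂ := -64 * formB τ / formA τ

lemma tendsto_hauptmodul_cusp : Tendsto hauptmodul cuspFilter (𝓝 0) := by
  have := (tendsto_formB_cusp.const_mul (-64)).div tendsto_formA_cusp one_ne_zero
  rwa [mul_zero, zero_div] at this

lemma hasDerivAt_hauptmodul {τ : ℂ} (h : 0 < τ.im) (hA : formA τ ≠ 0) :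
    HasDerivAt hauptmodul (2 * Real.pi * I * (formW τ * hauptmodul τ)) τ := by
  refine (((hasDerivAt_formB h).const_mul (-64)).div (hasDerivAt_formA h) hA).congr_deriv ?_
  unfold hauptmodul
  field_simp
  ring

lemma differentiableAt_formW {τ : ℂ} (h : 0 < τ.im) : DifferentiableAt ℂ formW τ := by
  have h1 := (hasDerivAt_eisTwo' h).differentiableAt
  have h2 := (hasDerivAt_eisTwoDil two_pos h).differentiableAt
  have h3 := (hasDerivAt_eisTwoDil three_pos h).differentiableAt
  have h6 := (hasDerivAt_eisTwoDil (d := 6) (by norm_num) h).differentiableAt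
  exact (((h1.neg.div_const 4).add (h2.div_const 4)).sub (h3.div_const 4)).add (h6.div_const 4)

lemma hasDerivAt_formW {τ : ℂ} (h : 0 < τ.im) (hW : formW τ ≠ 0) :
    HasDerivAt formW (2 * Real.pi * I *
      (logDerivA τ * formW τ + 10 * formA τ * formB τ + 64 * formB τ ^ 2)) τ := by
  have hd := (differentiableAt_formW h).hasDerivAt
  refine hd.congr_deriv ?_
  have h1 := hd.pow 2
  have h2 := ((hasDerivAt_formA h).add ((hasDerivAt_formB h).const_mul 16)).mul
    ((hasDerivAt_formA h).add ((hasDerivAt_formB h).const_mul 4))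
  have hev : formW ^ 2 =ᶠ[𝓝 τ] (formA + fun τ => 16 * formB τ) * (formA + fun τ => 4 * formB τ) := by
    filter_upwards [(isOpen_lt continuous_const Complex.continuous_im).mem_nhds h] with s hs
    exact formW_sq hs
  have key := (h1.congr_of_eventuallyEq hev.symm).unique h2
  simp only [Pi.add_apply] at key
  have hsq := formW_sq h
  refine mul_left_cancel₀ (mul_ne_zero two_ne_zero hW) ?_
  norm_num at key
  linear_combination key - 4 * Real.pi * I * logDerivA τ * hsq

/-- The Feynman integral divided by the holomorphic period, and its two derivatives. -/
noncomputable def normInt (τ : ℂ) : ℂ := momentSer 0 (hauptmodul τ) / formA τ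

/-- The first derivative of `normInt`. -/
noncomputable def normIntOne (τ : ℂ) : ℂ :=
  (formW τ * momentSer 1 (hauptmodul τ) - logDerivA τ * momentSer 0 (hauptmodul τ)) / formA τ

/-- The second derivative of `normInt`. -/
noncomputable def normIntTwo (τ : ℂ) : ℂ :=
  (formW τ ^ 2 * momentSer 2 (hauptmodul τ)
    + (10 * formA τ * formB τ + 64 * formB τ ^ 2 - logDerivA τ * formW τ)
      * momentSer 1 (hauptmodul τ)
    + (logDerivA τ ^ 2 / 2 + 32 * formB τ ^ 2 + 4 * formA τ * formB τ)
      * momentSer 0 (hauptmodul τ)) / formA τ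

lemma hasDerivAt_momentSer_hauptmodul (j : ℕ) {τ : ℂ} (h : 0 < τ.im) (hA : formA τ ≠ 0)
    (ht : ‖hauptmodul τ‖ < 16) :
    HasDerivAt (fun τ => momentSer j (hauptmodul τ))
      (2 * Real.pi * I * (formW τ * momentSer (j + 1) (hauptmodul τ))) τ := by
  obtain ⟨d, hd, he⟩ := exists_hasDerivAt_momentSer j ht
  refine (HasDerivAt.comp τ hd (hasDerivAt_hauptmodul h hA)).congr_deriv ?_
  rw [← he]; ring

lemma hasDerivAt_normInt {τ : ℂ} (h : 0 < τ.im) (hA : formA τ ≠ 0) (ht : ‖hauptmodul τ‖ < 16) :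
    HasDerivAt normInt (2 * Real.pi * I * normIntOne τ) τ := by
  have h0 := hasDerivAt_momentSer_hauptmodul 0 h hA ht
  refine (h0.div (hasDerivAt_formA h) hA).congr_deriv ?_
  unfold normIntOne
  field_simp

lemma hasDerivAt_normIntOne {τ : ℂ} (h : 0 < τ.im) (hA : formA τ ≠ 0) (hW : formW τ ≠ 0)
    (ht : ‖hauptmodul τ‖ < 16) :
    HasDerivAt normIntOne (2 * Real.pi * I * normIntTwo τ) τ := by
  have h0 := hasDerivAt_momentSer_hauptmodul 0 h hA ht
  have h1 := hasDerivAt_momentSer_hauptmodul 1 h hA ht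
  refine ((((hasDerivAt_formW h hW).mul h1).sub ((hasDerivAt_logDerivA h).mul h0)).div
    (hasDerivAt_formA h) hA).congr_deriv ?_
  unfold normIntTwo
  simp only [Pi.sub_apply, Pi.mul_apply]
  field_simp
  ring

lemma hasDerivAt_normIntTwo {τ : ℂ} (h : 0 < τ.im) (hA : formA τ ≠ 0) (hW : formW τ ≠ 0)
    (ht : ‖hauptmodul τ‖ < 16) :
    HasDerivAt normIntTwo (2 * Real.pi * I * (24 * (formB τ * formW τ))) τ := by
  have h0 := hasDerivAt_momentSer_hauptmodul 0 h hA ht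
  have h1 := hasDerivAt_momentSer_hauptmodul 1 h hA ht
  have h2 := hasDerivAt_momentSer_hauptmodul 2 h hA ht
  have hdA := hasDerivAt_formA h
  have hdB := hasDerivAt_formB h
  have hdW := hasDerivAt_formW h hW
  have hda := hasDerivAt_logDerivA h
  refine ((((hdW.pow 2).mul h2).add ((((hdA.const_mul 10).mul hdB).add
    ((hdB.pow 2).const_mul 64) |>.sub (hda.mul hdW)).mul h1) |>.add
    ((((hda.pow 2).div_const 2).add ((hdB.pow 2).const_mul 32) |>.add
      ((hdA.const_mul 4).mul hdB)).mul h0)).div hdA hA).congr_deriv ?_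
  have hode := momentSer_ode ht
  have hsq := formW_sq h
  have ht' : hauptmodul τ * formA τ = -64 * formB τ := by
    unfold hauptmodul; field_simp
  simp only [Pi.sub_apply, Pi.mul_apply, Pi.add_apply, Pi.pow_apply, zero_add]
  set J0 := momentSer 0 (hauptmodul τ)
  set J1 := momentSer 1 (hauptmodul τ)
  set J2 := momentSer 2 (hauptmodul τ)
  set J3 := momentSer 3 (hauptmodul τ)
  set t := hauptmodul τ
  have hB : formB τ = -(t * formA τ) / 64 := by linear_combination (1 / 64) * ht'
  set A := formA τ
  set W := formW τ
  rw [hB] at hsq ⊢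
  rw [div_eq_iff (pow_ne_zero 2 hA)]
  linear_combination (2 * Real.pi * I * A) * (W * J3 * hsq + W * A ^ 2 / 64 * hode)

end ThreeBanana

namespace ThreeBanana

open Complex Filter Topology Set

/-- The iterated Eichler integrals of `(E₄ - 1) / 240`. -/
noncomputable def epsSer (j : ℕ) (τ : ℂ) : ℂ :=
  qSer (fun n => ((coeffFour n : ℤ) : ℂ) / (240 * (n : ℂ) ^ j)) τ

lemma polyBdd_epsSer (j : ℕ) : PolyBdd fun n => ((coeffFour n : ℤ) : ℂ) / (240 * (n : ℂ) ^ j) := by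
  obtain ⟨C, k, h⟩ := polyBdd_coeffFour
  refine ⟨C, k, fun n => le_trans ?_ (h n)⟩
  rw [norm_div]
  rcases eq_or_ne (240 * (n : ℂ) ^ j) 0 with hz | hz
  · rw [hz]; simp
  refine div_le_self (norm_nonneg _) ?_
  have hn : (n : ℂ) ^ j ≠ 0 := right_ne_zero_of_mul hz
  have : n ^ j ≠ 0 := by exact_mod_cast hn
  have h1 : 1 ≤ n ^ j := Nat.one_le_iff_ne_zero.2 this
  rw [norm_mul, norm_pow, Complex.norm_natCast]
  have : (1 : ℝ) ≤ (n : ℝ) ^ j := by exact_mod_cast h1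
  simp
  linarith

lemma hasDerivAt_epsSer (j : ℕ) {τ : ℂ} (h : 0 < τ.im) :
    HasDerivAt (epsSer (j + 2)) (2 * Real.pi * I * epsSer (j + 1) τ) τ := by
  refine (hasDerivAt_qSer (polyBdd_epsSer (j + 2)) h).congr_deriv ?_
  congr 2
  ext n
  rcases eq_or_ne n 0 with rfl | hn
  · simp
  · have : (n : ℂ) ≠ 0 := by exact_mod_cast hn
    field_simp
    ring

lemma hasDerivAt_epsSer_one {τ : ℂ} (h : 0 < τ.im) :
    HasDerivAt (epsSer 1) (2 * Real.pi * I * ((eisFour τ - 1) / 240)) τ := by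
  refine (hasDerivAt_qSer (polyBdd_epsSer 1) h).congr_deriv ?_
  congr 1
  have h1 := ((polyBdd_coeffFour.hasSum h).sub (hasSum_ite_eq (0 : ℕ) (1 : ℂ))).div_const 240
  refine HasSum.tsum_eq ?_
  suffices e : (fun n : ℕ => (n : ℂ) * ((coeffFour n : ℤ) / (240 * (n : ℂ) ^ 1)) * nome τ ^ n) =
      fun n : ℕ => (((coeffFour n : ℤ) : ℂ) * nome τ ^ n - if n = 0 then 1 else 0) / 240 by
    rw [e]; exact h1
  ext n
  rcases eq_or_ne n 0 with rfl | hn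
  · simp [coeffFour]
  · have : (n : ℂ) ≠ 0 := by exact_mod_cast hn
    simp only [hn, if_false]
    field_simp
    ring

lemma tendsto_epsSer_cusp (j : ℕ) : Tendsto (epsSer (j + 1)) cuspFilter (𝓝 0) := by
  have h := tendsto_qSer_cusp (polyBdd_epsSer (j + 1))
  rwa [show ((coeffFour 0 : ℤ) : ℂ) / (240 * ((0 : ℕ) : ℂ) ^ (j + 1)) = 0 by simp] at h

/-- The level six combination of Eichler integrals. -/
noncomputable def epsComb (τ : ℂ) : ℂ :=
  epsSer 3 τ - epsSer 3 (2 * τ) / 8 - epsSer 3 (3 * τ) / 3 + epsSer 3 (6 * τ) / 24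

/-- The first derivative of `epsComb`. -/
noncomputable def epsCombOne (τ : ℂ) : ℂ :=
  epsSer 2 τ - epsSer 2 (2 * τ) / 4 - epsSer 2 (3 * τ) + epsSer 2 (6 * τ) / 4

/-- The second derivative of `epsComb`. -/
noncomputable def epsCombTwo (τ : ℂ) : ℂ :=
  epsSer 1 τ - epsSer 1 (2 * τ) / 2 - 3 * epsSer 1 (3 * τ) + 3 / 2 * epsSer 1 (6 * τ)

lemma hasDerivAt_comp_nat_mul {f g : ℂ → ℂ}
    (hf : ∀ {τ : ℂ}, 0 < τ.im → HasDerivAt f (2 * Real.pi * I * g τ) τ) {d : ℕ} (hd : 0 < d)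
    {τ : ℂ} (h : 0 < τ.im) :
    HasDerivAt (fun τ => f (d * τ)) (2 * Real.pi * I * (d * g (d * τ))) τ := by
  have hd' : (0 : ℝ) < d := by exact_mod_cast hd
  have him : 0 < ((d : ℂ) * τ).im := by simp; positivity
  refine ((hf him).comp τ ((hasDerivAt_id τ).const_mul (d : ℂ))).congr_deriv ?_
  ring

lemma hasDerivAt_epsComb {τ : ℂ} (h : 0 < τ.im) :
    HasDerivAt epsComb (2 * Real.pi * I * epsCombOne τ) τ := by
  have h2 := hasDerivAt_comp_nat_mul (hasDerivAt_epsSer 1) two_pos h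
  have h3 := hasDerivAt_comp_nat_mul (hasDerivAt_epsSer 1) three_pos h
  have h6 := hasDerivAt_comp_nat_mul (hasDerivAt_epsSer 1) (d := 6) (by norm_num) h
  push_cast at h2 h3 h6
  refine ((((hasDerivAt_epsSer 1 h).sub (h2.div_const 8)).sub (h3.div_const 3)).add
    (h6.div_const 24)).congr_deriv ?_
  unfold epsCombOne
  ring

lemma hasDerivAt_epsCombOne {τ : ℂ} (h : 0 < τ.im) :
    HasDerivAt epsCombOne (2 * Real.pi * I * epsCombTwo τ) τ := by
  have h2 := hasDerivAt_comp_nat_mul (hasDerivAt_epsSer 0) two_pos h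
  have h3 := hasDerivAt_comp_nat_mul (hasDerivAt_epsSer 0) three_pos h
  have h6 := hasDerivAt_comp_nat_mul (hasDerivAt_epsSer 0) (d := 6) (by norm_num) h
  push_cast at h2 h3 h6
  refine ((((hasDerivAt_epsSer 0 h).sub (h2.div_const 4)).sub h3).add
    (h6.div_const 4)).congr_deriv ?_
  unfold epsCombTwo
  ring

lemma hasDerivAt_epsCombTwo {τ : ℂ} (h : 0 < τ.im) :
    HasDerivAt epsCombTwo (2 * Real.pi * I * (formB τ * formW τ)) τ := by
  have h2 := hasDerivAt_comp_nat_mul hasDerivAt_epsSer_one two_pos h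
  have h3 := hasDerivAt_comp_nat_mul hasDerivAt_epsSer_one three_pos h
  have h6 := hasDerivAt_comp_nat_mul hasDerivAt_epsSer_one (d := 6) (by norm_num) h
  push_cast at h2 h3 h6
  refine ((((hasDerivAt_epsSer_one h).sub (h2.div_const 2)).sub (h3.const_mul 3)).add
    (h6.const_mul (3 / 2))).congr_deriv ?_
  rw [formB_mul_formW h]
  ring

lemma tendsto_comb_cusp {f : ℂ → ℂ} (hf : Tendsto f cuspFilter (𝓝 0)) (a b c : ℂ) :
    Tendsto (fun τ => f τ - a * f (2 * τ) - b * f (3 * τ) + c * f (6 * τ)) cuspFilter (𝓝 0) := by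
  have h2 := hf.comp (tendsto_nat_mul_cusp two_pos)
  have h3 := hf.comp (tendsto_nat_mul_cusp three_pos)
  have h6 := hf.comp (tendsto_nat_mul_cusp (d := 6) (by norm_num))
  have := ((hf.sub (h2.const_mul a)).sub (h3.const_mul b)).add (h6.const_mul c)
  simpa using this

instance : cuspFilter.NeBot :=
  comap_neBot fun s hs => by
    obtain ⟨y, hy⟩ := Filter.nonempty_of_mem hs
    exact ⟨y * I, by simpa using hy⟩

lemma eq_of_hasDerivAt_zero {f f' : ℂ → ℂ} {Y : ℝ} {c : ℂ}
    (hf : ∀ τ : ℂ, Y < τ.im → HasDerivAt f (f' τ) τ) (h0 : ∀ τ : ℂ, Y < τ.im → f' τ = 0)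
    (hc : Tendsto f cuspFilter (𝓝 c)) {τ : ℂ} (h : Y < τ.im) : f τ = c := by
  have hev : ∀ᶠ σ in cuspFilter, f σ = f τ := by
    filter_upwards [tendsto_comap.eventually (eventually_gt_atTop Y)] with σ hσ
    exact (convex_halfSpace_im_gt Y).is_const_of_fderivWithin_eq_zero (𝕜 := ℂ)
      (fun x hx => (hf x hx).differentiableAt.differentiableWithinAt)
      (fun x hx => by
        have h1 := (hf x hx).hasFDerivAt.hasFDerivWithinAt (s := {c : ℂ | Y < c.im})
        rw [h1.fderivWithin ((isOpen_lt continuous_const Complex.continuous_im).uniqueDiffWithinAt hx), h0 x hx]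
        simp) hσ h
  exact tendsto_nhds_unique (tendsto_const_nhds.congr' (hev.mono fun _ h => h.symm)) hc

lemma bananaInt_hauptmodul_near_cusp : ∃ Y > 0, ∀ τ : ℂ, Y < τ.im → formA τ ≠ 0 ∧
    ‖hauptmodul τ‖ < 16 ∧
    bananaInt (hauptmodul τ) = formA τ * (24 * epsComb τ + bananaMoment 0) := by
  have hev : ∀ᶠ τ in cuspFilter, formA τ ≠ 0 ∧ formW τ ≠ 0 ∧ ‖hauptmodul τ‖ < 16 := by
    have h1 := tendsto_hauptmodul_cusp.norm
    rw [norm_zero] at h1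
    filter_upwards [tendsto_formA_cusp.eventually_ne one_ne_zero,
      tendsto_formW_cusp.eventually_ne one_ne_zero,
      h1.eventually_lt_const (by norm_num : (0 : ℝ) < 16)] with τ a b c using ⟨a, b, c⟩
  rw [cuspFilter, eventually_comap, eventually_atTop] at hev
  obtain ⟨Y, hY⟩ := hev
  have hpos : ∀ τ : ℂ, max Y 1 < τ.im → 0 < τ.im := fun τ h => by
    have := le_max_right Y 1
    linarith
  have hgood : ∀ τ : ℂ, max Y 1 < τ.im → formA τ ≠ 0 ∧ formW τ ≠ 0 ∧ ‖hauptmodul τ‖ < 16 :=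
    fun τ h => hY τ.im ((le_max_left Y 1).trans h.le) τ rfl
  have hJ : ∀ j, Tendsto (fun τ => momentSer j (hauptmodul τ)) cuspFilter
      (𝓝 (0 ^ j * bananaMoment 0)) := fun j => tendsto_momentSer j tendsto_hauptmodul_cusp
  have hA := tendsto_formA_cusp
  have hB := tendsto_formB_cusp
  have hW := tendsto_formW_cusp
  have ha := tendsto_logDerivA_cusp
  have e2 : ∀ τ : ℂ, max Y 1 < τ.im → normIntTwo τ - 24 * epsCombTwo τ = 0 := fun τ h => by
    refine eq_of_hasDerivAt_zero (f := fun τ => normIntTwo τ - 24 * epsCombTwo τ)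
      (fun τ h => (hasDerivAt_normIntTwo (hpos τ h) (hgood τ h).1 (hgood τ h).2.1
      (hgood τ h).2.2).sub ((hasDerivAt_epsCombTwo (hpos τ h)).const_mul 24)) (fun τ h => by ring)
      ?_ h
    have t1 : Tendsto normIntTwo cuspFilter (𝓝 0) := by
      have := (((hW.pow 2).mul (hJ 2)).add (((((hA.const_mul 10).mul hB).add
        ((hB.pow 2).const_mul 64)).sub (ha.mul hW)).mul (hJ 1)) |>.add
        (((((ha.pow 2).div_const 2).add ((hB.pow 2).const_mul 32)).add
        ((hA.const_mul 4).mul hB)).mul (hJ 0))).div hA one_ne_zero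
      convert this using 2
      · rfl
      · norm_num
    have t2 := tendsto_comb_cusp (tendsto_epsSer_cusp 0) (1 / 2) 3 (3 / 2)
    have := t1.sub (t2.const_mul 24)
    rw [mul_zero, sub_zero] at this
    refine this.congr fun τ => ?_
    unfold epsCombTwo
    ring
  have e1 : ∀ τ : ℂ, max Y 1 < τ.im → normIntOne τ - 24 * epsCombOne τ = 0 := fun τ h => by
    refine eq_of_hasDerivAt_zero (f := fun τ => normIntOne τ - 24 * epsCombOne τ)
      (fun τ h => (hasDerivAt_normIntOne (hpos τ h) (hgood τ h).1 (hgood τ h).2.1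
      (hgood τ h).2.2).sub ((hasDerivAt_epsCombOne (hpos τ h)).const_mul 24))
      (fun τ h => by linear_combination (2 * Real.pi * I) * e2 τ h) ?_ h
    have t1 : Tendsto normIntOne cuspFilter (𝓝 0) := by
      have := ((hW.mul (hJ 1)).sub (ha.mul (hJ 0))).div hA one_ne_zero
      convert this using 2
      · rfl
      · norm_num
    have t2 := tendsto_comb_cusp (tendsto_epsSer_cusp 1) (1 / 4) 1 (1 / 4)
    have := t1.sub (t2.const_mul 24)
    rw [mul_zero, sub_zero] at this
    refine this.congr fun τ => ?_
    unfold epsCombOne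
    ring
  have e0 : ∀ τ : ℂ, max Y 1 < τ.im → normInt τ - 24 * epsComb τ = bananaMoment 0 := fun τ h => by
    refine eq_of_hasDerivAt_zero (f := fun τ => normInt τ - 24 * epsComb τ)
      (fun τ h => (hasDerivAt_normInt (hpos τ h) (hgood τ h).1
      (hgood τ h).2.2).sub ((hasDerivAt_epsComb (hpos τ h)).const_mul 24))
      (fun τ h => by linear_combination (2 * Real.pi * I) * e1 τ h) ?_ h
    have t1 : Tendsto normInt cuspFilter (𝓝 (bananaMoment 0)) := by
      have := (hJ 0).div hA one_ne_zero
      convert this using 2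
      · rfl
      · norm_num
    have t2 := tendsto_comb_cusp (tendsto_epsSer_cusp 2) (1 / 8) (1 / 3) (1 / 24)
    have := t1.sub (t2.const_mul 24)
    rw [mul_zero, sub_zero] at this
    refine this.congr fun τ => ?_
    unfold epsComb
    ring
  refine ⟨max Y 1, by positivity, fun τ h => ⟨(hgood τ h).1, (hgood τ h).2.2, ?_⟩⟩
  rw [bananaInt_eq_momentSer (hgood τ h).2.2, ← e0 τ h, normInt]
  have := (hgood τ h).1
  field_simp
  ring

end ThreeBanana

namespace ThreeBanana

open Complex Filter Topology Set

lemma exists_const_of_deriv_zero {f f' : ℂ → ℂ}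
    (hf : ∀ τ : ℂ, 0 < τ.im → HasDerivAt f (f' τ) τ) (h0 : ∀ τ : ℂ, 0 < τ.im → f' τ = 0) :
    ∃ c, ∀ τ : ℂ, 0 < τ.im → f τ = c := by
  refine ⟨f I, fun τ h => ?_⟩
  exact (convex_halfSpace_im_gt 0).is_const_of_fderivWithin_eq_zero (𝕜 := ℂ)
    (fun x hx => (hf x hx).differentiableAt.differentiableWithinAt)
    (fun x hx => by
      have h1 := (hf x hx).hasFDerivAt.hasFDerivWithinAt (s := {c : ℂ | 0 < c.im})
      rw [h1.fderivWithin
        ((isOpen_lt continuous_const Complex.continuous_im).uniqueDiffWithinAt hx), h0 x hx]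
      simp) h (by simp)

lemma exists_quadratic {f f₁ f₂ : ℂ → ℂ} (h₀ : ∀ τ : ℂ, 0 < τ.im → HasDerivAt f (f₁ τ) τ)
    (h₁ : ∀ τ : ℂ, 0 < τ.im → HasDerivAt f₁ (f₂ τ) τ)
    (h₂ : ∀ τ : ℂ, 0 < τ.im → HasDerivAt f₂ 0 τ) :
    ∃ a b c, ∀ τ : ℂ, 0 < τ.im → f τ = a * τ ^ 2 + b * τ + c := by
  obtain ⟨a, ha⟩ := exists_const_of_deriv_zero h₂ (fun _ _ => rfl)
  obtain ⟨b, hb⟩ := exists_const_of_deriv_zero (f := fun τ => f₁ τ - a * τ)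
    (fun τ h => (h₁ τ h).sub ((hasDerivAt_id τ).const_mul a)) (fun τ h => by rw [ha τ h]; ring)
  obtain ⟨c, hc⟩ := exists_const_of_deriv_zero (f := fun τ => f τ - (a / 2 * τ ^ 2 + b * τ))
    (fun τ h => (h₀ τ h).sub (((hasDerivAt_pow 2 τ).const_mul (a / 2)).add
      ((hasDerivAt_id τ).const_mul b))) (fun τ h => by
        have := hb τ h
        push_cast
        linear_combination this)
  exact ⟨a / 2, b, c, fun τ h => by linear_combination hc τ h⟩

lemma hasDerivAt_comp_inv {f : ℂ → ℂ} {d τ : ℂ} (h : 0 < τ.im) (hf : HasDerivAt f d (-1 / τ)) :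
    HasDerivAt (fun τ => f (-1 / τ)) (d / τ ^ 2) τ := by
  have h0 : τ ≠ 0 := by rintro rfl; simp at h
  have hs : HasDerivAt (fun τ : ℂ => -1 / τ) (1 / τ ^ 2) τ := by
    refine ((hasDerivAt_const τ (-1 : ℂ)).div (hasDerivAt_id τ) h0).congr_deriv ?_
    simp
  refine (HasDerivAt.comp τ hf hs).congr_deriv ?_
  ring

lemma exists_epsSer_inv : ∃ α β γ : ℂ, ∀ τ : ℂ, 0 < τ.im →
    τ ^ 2 * epsSer 3 (-1 / τ) - epsSer 3 τ =
      -(I * Real.pi ^ 3 / 180) * (τ ^ 3 + 1 / τ) + α * τ ^ 2 + β * τ + γ := by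
  set k : ℂ := 2 * Real.pi * I with hk
  have hk3 : k ^ 3 = -8 * I * Real.pi ^ 3 := by
    rw [hk]; linear_combination 8 * (Real.pi : ℂ) ^ 3 * I * I_sq
  have hne : ∀ τ : ℂ, 0 < τ.im → τ ≠ 0 := fun τ h => by rintro rfl; simp at h
  have hinv : ∀ τ : ℂ, 0 < τ.im → HasDerivAt (fun τ : ℂ => τ⁻¹) (-(τ ^ 2)⁻¹) τ :=
    fun τ h => hasDerivAt_inv (hne τ h)
  have key := exists_quadratic
    (f := fun τ => τ ^ 2 * epsSer 3 (-1 / τ) - epsSer 3 τ - k ^ 3 / 1440 * (τ ^ 3 + τ⁻¹))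
    (f₁ := fun τ => 2 * (τ * epsSer 3 (-1 / τ)) + k * epsSer 2 (-1 / τ) - k * epsSer 2 τ
      - k ^ 3 / 1440 * (3 * τ ^ 2 - τ⁻¹ ^ 2))
    (f₂ := fun τ => 2 * epsSer 3 (-1 / τ) + 2 * k * (τ⁻¹ * epsSer 2 (-1 / τ))
      + k ^ 2 * (τ⁻¹ ^ 2 * epsSer 1 (-1 / τ)) - k ^ 2 * epsSer 1 τ
      - k ^ 3 / 1440 * (6 * τ + 2 * τ⁻¹ ^ 3))
    (fun τ h => by
      have h0 := hne τ h
      have d3 := hasDerivAt_comp_inv h (hasDerivAt_epsSer 1 (im_inv_pos h))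
      refine ((((hasDerivAt_pow 2 τ).mul d3).sub (hasDerivAt_epsSer 1 h)).sub
        (((hasDerivAt_pow 3 τ).add (hinv τ h)).const_mul (k ^ 3 / 1440))).congr_deriv ?_
      push_cast
      field_simp
      ring)
    (fun τ h => by
      have h0 := hne τ h
      have d3 := hasDerivAt_comp_inv h (hasDerivAt_epsSer 1 (im_inv_pos h))
      have d2 := hasDerivAt_comp_inv h (hasDerivAt_epsSer 0 (im_inv_pos h))
      refine ((((((hasDerivAt_id τ).mul d3).const_mul 2).add (d2.const_mul k)).sub
        ((hasDerivAt_epsSer 0 h).const_mul k)).sub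
        ((((hasDerivAt_pow 2 τ).const_mul 3).sub ((hinv τ h).pow 2)).const_mul
          (k ^ 3 / 1440))).congr_deriv ?_
      simp only [id]
      push_cast
      field_simp
      ring)
    (fun τ h => by
      have h0 := hne τ h
      have d3 := hasDerivAt_comp_inv h (hasDerivAt_epsSer 1 (im_inv_pos h))
      have d2 := hasDerivAt_comp_inv h (hasDerivAt_epsSer 0 (im_inv_pos h))
      have d1 := hasDerivAt_comp_inv h (hasDerivAt_epsSer_one (im_inv_pos h))
      refine (((((d3.const_mul 2).add (((hinv τ h).mul d2).const_mul (2 * k))).add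
        ((((hinv τ h).pow 2).mul d1).const_mul (k ^ 2))).sub
        ((hasDerivAt_epsSer_one h).const_mul (k ^ 2))).sub
        ((((hasDerivAt_id τ).const_mul 6).add (((hinv τ h).pow 3).const_mul 2)).const_mul
          (k ^ 3 / 1440))).congr_deriv ?_
      rw [eisFour_inv h]
      simp only [Pi.pow_apply]
      push_cast
      field_simp
      ring)
  obtain ⟨α, β, γ, hq⟩ := key
  refine ⟨α, β, γ, fun τ h => ?_⟩
  have := hq τ h
  rw [hk3] at this
  rw [one_div]
  linear_combination this

lemma qSer_conj {c : ℕ → ℂ} (hc : ∀ n, (c n).im = 0) {τ : ℂ} (hτ : (nome τ).im = 0) :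
    (qSer c τ).im = 0 := by
  rw [← Complex.conj_eq_iff_im, qSer, Complex.conj_tsum]
  refine tsum_congr fun n => ?_
  rw [map_mul, map_pow, Complex.conj_eq_iff_im.2 (hc n), Complex.conj_eq_iff_im.2 hτ]

lemma epsSer_im {j : ℕ} {τ : ℂ} (hτ : (nome τ).im = 0) : (epsSer j τ).im = 0 := by
  refine qSer_conj (fun n => ?_) hτ
  have : ((coeffFour n : ℤ) : ℂ) / (240 * (n : ℂ) ^ j) =
      (((coeffFour n : ℤ) / (240 * (n : ℝ) ^ j) : ℝ) : ℂ) := by push_cast; rfl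
  rw [this, Complex.ofReal_im]

lemma nome_im_of_re {τ : ℂ} (h : τ.re = 0) : (nome τ).im = 0 := by
  have : nome τ = ((Real.exp (-(2 * Real.pi * τ.im)) : ℝ) : ℂ) := by
    rw [nome, Complex.ofReal_exp]
    congr 1
    have : τ = τ.im * I := by
      apply Complex.ext <;> simp [h]
    rw [this]
    push_cast
    simp
    linear_combination 2 * (Real.pi : ℂ) * τ.im * I_sq
  rw [this, Complex.ofReal_im]

/-- The Eichler integral with its transformation law under inversion. -/
lemma exists_eichler : ∃ c : ℝ, ∀ τ : ℂ, 0 < τ.im →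
    τ ^ 2 * (epsSer 3 (-1 / τ) + c) = epsSer 3 τ + c
      - (I * Real.pi ^ 3 / 180) * (τ ^ 3 + 1 / τ) + (I * Real.pi ^ 3 / 36) * τ := by
  obtain ⟨α, β, γ, h⟩ := exists_epsSer_inv
  have hγ : γ = -α := by
    have h1 := h (2 * I) (by simp)
    have h2 := h (-1 / (2 * I)) (im_inv_pos (by simp))
    have e : -1 / (-1 / (2 * I)) = 2 * I := by field_simp
    have e' : -1 / (2 * I) = I / 2 := by field_simp; rw [I_sq]
    rw [e, e'] at h2
    rw [e'] at h1
    have i1 : 1 / (2 * I) = -I / 2 := by field_simp; rw [I_sq]; ring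
    have i2 : 1 / (I / 2) = -2 * I := by field_simp; rw [I_sq]; ring
    rw [i1] at h1
    rw [i2] at h2
    have i3 : I ^ 3 = -I := by rw [pow_succ, I_sq]; ring
    have i4 := I_sq
    simp only [mul_pow, div_pow, i3, i4] at h1 h2
    linear_combination (1 / 3) * h1 - (4 / 3) * h2
  set c := -α with hc
  have hH : ∀ τ : ℂ, 0 < τ.im → τ ^ 2 * (epsSer 3 (-1 / τ) + c) = epsSer 3 τ + c
      - (I * Real.pi ^ 3 / 180) * (τ ^ 3 + 1 / τ) + β * τ := fun τ hτ => by
    have := h τ hτ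
    rw [hγ] at this
    linear_combination this + τ ^ 2 * hc
  have hper : ∀ τ, epsSer 3 (τ + 1) = epsSer 3 τ := fun τ => qSer_add_one _ τ
  have hβ : β = I * Real.pi ^ 3 / 36 := by
    have h1 := hH I (by simp)
    have h2 := hH (I + 1) (by simp)
    have him : 0 < (-1 / (I + 1)).im := im_inv_pos (by simp)
    have h3 := hH (-1 / (I + 1) + 1) (by simpa using him)
    have hne : (I + 1 : ℂ) ≠ 0 := by
      intro hh
      have := congrArg Complex.im hh
      simp at this
    have e1 : -1 / I = I := by field_simp; rw [I_sq]
    have e3 : -1 / (I + 1) + 1 = (1 + I) / 2 := by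
      field_simp; linear_combination  -I_sq
    have e4 : -1 / ((1 + I) / 2) + 1 = I := by
      have hne' : (1 + I : ℂ) ≠ 0 := by rwa [add_comm]
      field_simp; linear_combination -I_sq
    rw [← hper (-1 / (-1 / (I + 1) + 1)), hper (-1 / (I + 1)), e3, e4] at h3
    rw [hper I] at h2
    rw [e1] at h1
    have i1 : 1 / I = -I := by field_simp; rw [I_sq]; ring
    have i2 : 1 / (I + 1) = (1 - I) / 2 := by field_simp; linear_combination I_sq
    have i3 : 1 / ((1 + I) / 2) = 1 - I := by
      have hne' : (1 + I : ℂ) ≠ 0 := by rwa [add_comm]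
      field_simp; linear_combination I_sq
    rw [i1] at h1
    rw [i2] at h2
    rw [i3] at h3
    have hI := I_sq
    clear_value c
    generalize epsSer 3 I = x at *
    generalize epsSer 3 (-1 / (I + 1)) = y at *
    generalize (Real.pi : ℂ) ^ 3 = p at *
    clear i1 i2 i3 e1 e3 e4 hne him hH h hper
    generalize (I : ℂ) = i at *
    grind
  have hre : c.im = 0 := by
    have h1 := hH (2 * I) (by simp)
    have e' : -1 / (2 * I) = I / 2 := by field_simp; rw [I_sq]
    have i1 : 1 / (2 * I) = -I / 2 := by field_simp; rw [I_sq]; ring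
    rw [e', i1, hβ] at h1
    have z1 : (epsSer 3 (2 * I)).im = 0 := epsSer_im (nome_im_of_re (by simp))
    have z2 : (epsSer 3 (I / 2)).im = 0 := epsSer_im (nome_im_of_re (by simp))
    rw [← Complex.conj_eq_iff_im] at z1 z2 ⊢
    have h2 := congrArg (starRingEnd ℂ) h1
    simp only [map_mul, map_add, map_sub, map_div₀, map_pow, Complex.conj_I, map_neg,
      Complex.conj_ofReal, z1, z2, map_ofNat] at h2
    have hI := I_sq
    generalize (starRingEnd ℂ) c = d at *
    clear z1 z2 e' i1 hH h hper
    grind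
  refine ⟨c.re, fun τ hτ => ?_⟩
  have : ((c.re : ℝ) : ℂ) = c := by
    apply Complex.ext <;> simp [hre]
  rw [this, hH τ hτ, hβ]

end ThreeBanana

namespace ThreeBanana

open Complex Filter Topology Set

/-- The constant making the Eichler integral of the weight four Eisenstein series equivariant. -/
noncomputable def eichlerConst : ℝ := exists_eichler.choose

/-- The normalised Eichler integral of the weight four Eisenstein series. -/
noncomputable def eichler (τ : ℂ) : ℂ := epsSer 3 τ + eichlerConst

lemma eichler_inv {τ : ℂ} (h : 0 < τ.im) :
    τ ^ 2 * eichler (-1 / τ) = eichler τ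
      - (I * Real.pi ^ 3 / 180) * (τ ^ 3 + 1 / τ) + (I * Real.pi ^ 3 / 36) * τ :=
  exists_eichler.choose_spec τ h

lemma eichler_add_one (τ : ℂ) : eichler (τ + 1) = eichler τ := by
  rw [eichler, eichler, epsSer, epsSer, qSer_add_one]

lemma eisTwo_add_one (τ : ℂ) : eisTwo (τ + 1) = eisTwo τ := qSer_add_one _ τ

lemma eichler_im {τ : ℂ} (hτ : (nome τ).im = 0) : (eichler τ).im = 0 := by
  rw [eichler, Complex.add_im, epsSer_im hτ, Complex.ofReal_im, add_zero]

lemma eisTwo_im {τ : ℂ} (hτ : (nome τ).im = 0) : (eisTwo τ).im = 0 :=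
  qSer_conj (fun n => by rw [Complex.intCast_im]) hτ

lemma nome_im_of_half {τ : ℂ} (h : τ.re = 1 / 2) : (nome τ).im = 0 := by
  have := nome_add_half (τ - 1 / 2)
  rw [sub_add_cancel] at this
  rw [this, Complex.neg_im, nome_im_of_re (by simp [h]), neg_zero]

lemma sum_divisors_two_mul (k m : ℕ) :
    ∑ d ∈ (2 * m).divisors, (d : ℤ) ^ k = ∑ d ∈ (2 * m).divisors with Odd d, (d : ℤ) ^ k
      + 2 ^ k * ∑ d ∈ m.divisors, (d : ℤ) ^ k := by
  rw [← Finset.sum_filter_add_sum_filter_not _ (fun d => Odd d)]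
  congr 1
  rw [Finset.mul_sum]
  have hinj : Set.InjOn (fun d : ℕ => 2 * d) (m.divisors : Set ℕ) := fun a _ b _ h =>
    Nat.eq_of_mul_eq_mul_left two_pos h
  rw [show (∑ d ∈ m.divisors, (2 : ℤ) ^ k * (d : ℤ) ^ k) =
    ∑ d ∈ m.divisors.image (fun d : ℕ => 2 * d), (d : ℤ) ^ k by
      rw [Finset.sum_image hinj]
      exact Finset.sum_congr rfl fun d _ => by push_cast; ring]
  congr 1
  ext d
  simp only [Finset.mem_filter, Nat.mem_divisors, Finset.mem_image, Nat.not_odd_iff_even]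
  constructor
  · rintro ⟨⟨h1, h2⟩, e, rfl⟩
    refine ⟨e, ⟨?_, by omega⟩, by ring⟩
    rw [← two_mul] at h1
    exact Nat.dvd_of_mul_dvd_mul_left two_pos h1
  · rintro ⟨e, ⟨h1, h2⟩, rfl⟩
    exact ⟨⟨Nat.mul_dvd_mul_left 2 h1, by omega⟩, even_two_mul e⟩

lemma divisors_two_mul_odd (m : ℕ) :
    (2 * m).divisors.filter Odd = m.divisors.filter Odd := by
  ext d
  simp only [Finset.mem_filter, Nat.mem_divisors]
  constructor
  · rintro ⟨⟨h1, h2⟩, h3⟩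
    exact ⟨⟨(Nat.Coprime.dvd_mul_left (h3.coprime_two_right)).1 h1, by omega⟩, h3⟩
  · rintro ⟨⟨h1, h2⟩, h3⟩
    exact ⟨⟨h1.mul_left 2, by omega⟩, h3⟩

lemma sum_divisors_hecke (k n : ℕ) :
    ∑ d ∈ (2 * n).divisors, (d : ℤ) ^ k
      + 2 ^ k * (if 2 ∣ n then ∑ d ∈ (n / 2).divisors, (d : ℤ) ^ k else 0) =
      (1 + 2 ^ k) * ∑ d ∈ n.divisors, (d : ℤ) ^ k := by
  rw [sum_divisors_two_mul, divisors_two_mul_odd]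
  split_ifs with h
  · obtain ⟨m, rfl⟩ := h
    rw [Nat.mul_div_cancel_left m two_pos, sum_divisors_two_mul k m]
    ring
  · have : n.divisors.filter Odd = n.divisors := by
      refine Finset.filter_true_of_mem fun d hd => ?_
      by_contra hh
      rw [Nat.not_odd_iff_even] at hh
      exact h (hh.two_dvd.trans (Nat.dvd_of_mem_divisors hd))
    rw [this]
    ring

lemma nome_half_sq (τ : ℂ) : nome (τ / 2) ^ 2 = nome τ := by
  rw [← nome_nat_mul]
  congr 1
  push_cast
  ring

lemma PolyBdd.comp_two_mul {c : ℕ → ℂ} (hc : PolyBdd c) : PolyBdd fun n => c (2 * n) := by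
  obtain ⟨C, k, hC, h⟩ := hc.exists_nonneg
  refine ⟨C * 2 ^ k, k, fun n => (h (2 * n)).trans ?_⟩
  rw [mul_assoc, ← mul_pow]
  gcongr
  push_cast
  linarith

lemma qSer_half {c : ℕ → ℂ} (hc : PolyBdd c) {τ : ℂ} (h : 0 < τ.im) :
    qSer c (τ / 2) + qSer c ((τ + 1) / 2) = 2 * qSer (fun n => c (2 * n)) τ := by
  have him : 0 < (τ / 2).im := by simp [h]
  have him' : 0 < ((τ + 1) / 2).im := by simp [h]
  have e : nome ((τ + 1) / 2) = -nome (τ / 2) := by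
    rw [← nome_add_half]; congr 1; ring
  have s1 := (hc.hasSum him).summable
  have s2 := (hc.hasSum him').summable
  simp only [qSer]
  rw [← s1.tsum_add s2, ← tsum_mul_left]
  have hinj : Function.Injective (fun n : ℕ => 2 * n) := fun a b hab =>
    Nat.eq_of_mul_eq_mul_left two_pos hab
  rw [← hinj.tsum_eq]
  · refine tsum_congr fun n => ?_
    simp only [e, pow_mul, neg_sq, nome_half_sq]
    ring
  · intro n hn
    rcases Nat.even_or_odd n with ⟨m, rfl⟩ | ho
    · exact ⟨m, by ring⟩
    · exact absurd (by simp only [e, ho.neg_pow]; ring) hn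

lemma eisTwo_hecke {τ : ℂ} (h : 0 < τ.im) :
    eisTwo (τ / 2) + eisTwo ((τ + 1) / 2) + 4 * eisTwo (2 * τ) = 6 * eisTwo τ := by
  have h1 := qSer_half polyBdd_coeffTwo h
  have h2 := qSer_dilate two_pos (fun n => (coeffTwo n : ℂ)) τ
  have hd : PolyBdd (dilate 2 fun n => (coeffTwo n : ℂ)) := polyBdd_coeffTwo.dilate 2
  have h3 := qSer_add (c := fun n => (coeffTwo (2 * n) : ℂ))
    (d := fun n => 2 * dilate 2 (fun n => (coeffTwo n : ℂ)) n)
    (polyBdd_coeffTwo.comp_two_mul) (hd.const_mul 2) h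
  rw [qSer_const_mul, h2] at h3
  have h4 : qSer (fun n => 3 * (coeffTwo n : ℂ)) τ = 3 * eisTwo τ := qSer_const_mul 3 _ τ
  have h5 : (fun n => (coeffTwo (2 * n) : ℂ) + 2 * dilate 2 (fun n => (coeffTwo n : ℂ)) n) =
      fun n => 3 * (coeffTwo n : ℂ) := by
    funext n
    rcases eq_or_ne n 0 with rfl | hn
    · simp [dilate, coeffTwo]; norm_num
    · have := sum_divisors_hecke 1 n
      simp only [pow_one] at this
      have h6 : coeffTwo (2 * n) + 2 * (if 2 ∣ n then coeffTwo (n / 2) else 0) =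
          3 * coeffTwo n := by
        by_cases h2n : 2 ∣ n
        · have : n / 2 ≠ 0 := by omega
          simp only [coeffTwo, hn, h2n, if_true, if_false, mul_eq_zero, this, or_self,
            OfNat.ofNat_ne_zero] at *
          linarith
        · simp only [coeffTwo, hn, h2n, if_false, mul_eq_zero, or_self,
            OfNat.ofNat_ne_zero] at *
          linarith
      have h7 := congrArg (Int.cast : ℤ → ℂ) h6
      push_cast at h7
      rw [← h7, dilate]
  rw [h5, h4] at h3
  simp only [eisTwo] at *
  push_cast at h3
  linear_combination h1 - 2 * h3

lemma eichler_hecke {τ : ℂ} (h : 0 < τ.im) :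
    eichler (τ / 2) + eichler ((τ + 1) / 2) + eichler (2 * τ) / 4 = 9 / 4 * eichler τ := by
  set a : ℕ → ℂ := fun n => ((coeffFour n : ℤ) : ℂ) / (240 * (n : ℂ) ^ 3) with ha
  have h1 := qSer_half (polyBdd_epsSer 3) h
  have h2 := qSer_dilate two_pos a τ
  have hd : PolyBdd (dilate 2 a) := (polyBdd_epsSer 3).dilate 2
  have h3 := qSer_add (c := fun n => a (2 * n)) (d := fun n => 1 / 8 * dilate 2 a n)
    ((polyBdd_epsSer 3).comp_two_mul) (hd.const_mul (1 / 8)) h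
  rw [qSer_const_mul, h2] at h3
  have h4 : qSer (fun n => 9 / 8 * a n) τ = 9 / 8 * qSer a τ := qSer_const_mul _ _ τ
  have h5 : (fun n => a (2 * n) + 1 / 8 * dilate 2 a n) = fun n => 9 / 8 * a n := by
    funext n
    rcases eq_or_ne n 0 with rfl | hn
    · simp [dilate, ha]
    · have h6 := sum_divisors_hecke 3 n
      have hn' : (n : ℂ) ≠ 0 := by exact_mod_cast hn
      have hb : ∀ m : ℕ, m ≠ 0 → a m = ((∑ d ∈ m.divisors, (d : ℤ) ^ 3 : ℤ) : ℂ) / (m : ℂ) ^ 3 := by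
        intro m hm
        simp only [ha, coeffFour, hm, if_false]
        push_cast
        field_simp
      rw [hb _ hn, hb (2 * n) (by omega), dilate]
      have h7 := congrArg (Int.cast : ℤ → ℂ) h6
      by_cases h2n : 2 ∣ n
      · obtain ⟨m, rfl⟩ := h2n
        have hm : m ≠ 0 := by omega
        have hm' : (m : ℂ) ≠ 0 := by exact_mod_cast hm
        rw [if_pos (dvd_mul_right 2 m)] at h7 ⊢
        rw [Nat.mul_div_cancel_left m two_pos] at h7 ⊢
        rw [hb m hm]
        generalize (∑ d ∈ (2 * (2 * m)).divisors, (d : ℤ) ^ 3) = S at h7 ⊢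
        push_cast at h7 ⊢
        field_simp
        linear_combination 8 * h7
      · rw [if_neg h2n] at h7 ⊢
        push_cast at h7 ⊢
        field_simp
        linear_combination 8 * h7
  rw [h5, h4] at h3
  have h6 : ∀ τ, eichler τ = qSer a τ + eichlerConst := fun _ => rfl
  rw [h6, h6, h6, h6]
  rw [← ha] at h1
  have h8 : (fun n => a (2 * n)) =
    fun n => ((coeffFour (2 * n) : ℤ) : ℂ) / (240 * ((2 * n : ℕ) : ℂ) ^ 3) := rfl
  rw [← h8] at h1
  clear_value a
  push_cast at h3
  linear_combination h1 - 2 * h3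

/-- `√3` as a complex number. -/
noncomputable def rt : ℂ := (Real.sqrt 3 : ℝ)

lemma rt_sq : rt ^ 2 = 3 := by
  rw [rt, ← Complex.ofReal_pow, Real.sq_sqrt (by norm_num)]; norm_num

lemma rt_ne : rt ≠ 0 := by
  intro h
  have := rt_sq
  rw [h] at this
  norm_num at this

lemma rt_re : rt.re = Real.sqrt 3 := Complex.ofReal_re _

lemma rt_im : rt.im = 0 := Complex.ofReal_im _

lemma sqrt_three_pos : 0 < Real.sqrt 3 := Real.sqrt_pos.2 (by norm_num)

lemma pi_ne' : (Real.pi : ℂ) ≠ 0 := ofReal_ne_zero.mpr Real.pi_ne_zero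

lemma pi_I_inv (x : ℂ) : x / (Real.pi * I) = -I * (x / Real.pi) := by
  have := pi_ne'
  field_simp
  rw [I_sq]
  ring

/-- The elliptic point where the Hauptmodul takes the value `16`. -/
noncomputable def ellPt : ℂ := (3 + rt * I) / 6

lemma eisTwo_omega : eisTwo ((1 + rt * I) / 2) = 2 * rt / Real.pi := by
  set w := (1 + rt * I) / 2 with hw
  have him : 0 < w.im := by simp [hw, rt_re, rt_im]
  have hne : w ≠ 0 := by rintro h; rw [h] at him; simp at him
  have hr := rt_sq
  have hI := I_sq
  have h := eisTwo_inv him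
  have e : -1 / w = w - 1 := by
    field_simp
    rw [hw]
    linear_combination (-1 / 4) * I ^ 2 * hr - 3 / 4 * hI
  have p := eisTwo_add_one (w - 1)
  rw [sub_add_cancel] at p
  rw [e, ← p, pi_I_inv] at h
  have hw2 : w ^ 2 = w - 1 := by
    rw [hw]
    linear_combination (1 / 4) * I ^ 2 * hr + 3 / 4 * hI
  have h5 : (2 - w) * (eisTwo w - 2 * rt / Real.pi) = 0 := by
    rw [show 6 * w / (Real.pi : ℂ) = 6 * w * (1 / Real.pi) by ring] at h
    rw [show 2 * rt / (Real.pi : ℂ) = 2 * rt * (1 / Real.pi) by ring]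
    generalize (1 / Real.pi : ℂ) = p at *
    have e1 : -I * (6 * w * p) - (2 - w) * (2 * rt * p) = 0 := by
      rw [hw]
      linear_combination (p * I) * hr - 3 * p * rt * hI
    linear_combination h + e1 + eisTwo w * hw2
  rcases mul_eq_zero.1 h5 with h6 | h6
  · exfalso
    have := congrArg Complex.re h6
    simp [hw, rt_im, rt_re] at this
    norm_num at this
  · linear_combination h6

lemma ellPt_inv : -1 / ((1 + rt * I) / 2 - 2) = ellPt := by
  have hr := rt_sq
  have hI := I_sq
  have hne : (1 + rt * I) / 2 - 2 ≠ 0 := by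
    intro h
    have := congrArg Complex.re h
    simp [rt_im] at this
    norm_num at this
  rw [div_eq_iff hne, ellPt]
  linear_combination (-1 / 12) * I ^ 2 * hr - 1 / 4 * hI

lemma eisTwo_ellPt : eisTwo ellPt = 6 * rt / Real.pi := by
  have hr := rt_sq
  have hI := I_sq
  have h := eisTwo_inv (w := (1 + rt * I) / 2 - 2) (by simp [rt_re, rt_im])
  have p1 := eisTwo_add_one ((1 + rt * I) / 2 - 1)
  have p2 := eisTwo_add_one ((1 + rt * I) / 2 - 2)
  rw [sub_add_cancel] at p1
  rw [show (1 + rt * I) / 2 - 2 + 1 = (1 + rt * I) / 2 - 1 by ring] at p2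
  rw [ellPt_inv, ← p2, ← p1, eisTwo_omega, pi_I_inv] at h
  rw [h]
  have := pi_ne'
  field_simp
  linear_combination (rt * I ^ 2 - 6 * I) * hr - 3 * rt * hI

lemma eisTwo_two_ellPt : eisTwo (2 * ellPt) = -3 * eisTwo (rt * I) + 6 * rt / Real.pi := by
  have hr := rt_sq
  have hI := I_sq
  have h := eisTwo_inv (w := rt * I) (by simp [rt_re])
  have e : -1 / (rt * I) + 1 = 2 * ellPt := by
    have := rt_ne
    rw [ellPt]
    field_simp
    linear_combination (-2 * I ^ 2) * hr - 6 * hI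
  rw [← e, eisTwo_add_one, h, pi_I_inv]
  linear_combination (eisTwo (rt * I) * I ^ 2) * hr
    + (3 * eisTwo (rt * I) - 6 * rt / Real.pi) * hI

lemma eisTwo_three_ellPt : eisTwo (3 * ellPt) = 2 * rt / Real.pi := by
  rw [← eisTwo_omega, ← eisTwo_add_one ((1 + rt * I) / 2)]
  congr 1
  rw [ellPt]
  ring

lemma eisTwo_six_ellPt : eisTwo (6 * ellPt) = eisTwo (rt * I) := by
  rw [← eisTwo_add_one (rt * I), ← eisTwo_add_one (rt * I + 1), ← eisTwo_add_one (rt * I + 1 + 1)]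
  congr 1
  rw [ellPt]
  ring

end ThreeBanana

namespace ThreeBanana

open Complex Filter Topology Set

lemma im_nat_mul_pos {d : ℕ} (hd : 0 < d) {σ : ℂ} (h : 0 < σ.im) : 0 < ((d : ℂ) * σ).im := by
  have : (0 : ℝ) < d := by exact_mod_cast hd
  simp [this, h]

lemma ne_zero_of_im_pos {σ : ℂ} (h : 0 < σ.im) : σ ≠ 0 := by rintro rfl; simp at h

lemma eisTwoDil_fricke {d e : ℕ} (hde : d * e = 6) {σ : ℂ} (h : 0 < σ.im) :
    eisTwoDil d (-1 / (6 * σ)) = 6 * σ ^ 2 * eisTwoDil e σ + 36 * σ / (Real.pi * I) := by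
  have he : 0 < e := Nat.pos_of_ne_zero (by rintro rfl; simp at hde)
  have hd : 0 < d := Nat.pos_of_ne_zero (by rintro rfl; simp at hde)
  have hd' : (d : ℂ) ≠ 0 := by exact_mod_cast hd.ne'
  have he' : (e : ℂ) ≠ 0 := by exact_mod_cast he.ne'
  have h0 := ne_zero_of_im_pos h
  have hc : (d : ℂ) * e = 6 := by exact_mod_cast hde
  have e1 : (d : ℂ) * (-1 / (6 * σ)) = -1 / (e * σ) := by
    rw [← hc]; field_simp
  rw [eisTwoDil, eisTwoDil, e1, eisTwo_inv (im_nat_mul_pos he h)]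
  have hpi := pi_ne'
  field_simp
  linear_combination (σ * e * Real.pi * I * eisTwo (e * σ) + 6) * hc

lemma formA_fricke {σ : ℂ} (h : 0 < σ.im) :
    formA (-1 / (6 * σ)) = -48 * σ ^ 2 * formB σ := by
  have h1 := eisTwoDil_fricke (d := 1) (e := 6) rfl h
  have h2 := eisTwoDil_fricke (d := 2) (e := 3) rfl h
  have h3 := eisTwoDil_fricke (d := 3) (e := 2) rfl h
  have h6 := eisTwoDil_fricke (d := 6) (e := 1) rfl h
  have hd1 : ∀ τ, eisTwoDil 1 τ = eisTwo τ := fun τ => by simp [eisTwoDil]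
  rw [hd1] at h1 h6
  unfold formA formB
  rw [h1, h2, h3, h6]
  ring

lemma formB_fricke {σ : ℂ} (h : 0 < σ.im) :
    formB (-1 / (6 * σ)) = -(3 / 4) * σ ^ 2 * formA σ := by
  have h1 := eisTwoDil_fricke (d := 1) (e := 6) rfl h
  have h2 := eisTwoDil_fricke (d := 2) (e := 3) rfl h
  have h3 := eisTwoDil_fricke (d := 3) (e := 2) rfl h
  have h6 := eisTwoDil_fricke (d := 6) (e := 1) rfl h
  have hd1 : ∀ τ, eisTwoDil 1 τ = eisTwo τ := fun τ => by simp [eisTwoDil]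
  rw [hd1] at h1 h6
  unfold formA formB
  rw [h1, h2, h3, h6]
  ring

/-- The Hauptmodul in the coordinate at the other cusp. -/
noncomputable def frickeT (σ : ℂ) : ℂ := -formA σ / formB σ

lemma hauptmodul_fricke {σ : ℂ} (h : 0 < σ.im) : hauptmodul (-1 / (6 * σ)) = frickeT σ := by
  have h0 := ne_zero_of_im_pos h
  rw [hauptmodul, formA_fricke h, formB_fricke h, frickeT]
  rcases eq_or_ne (formB σ) 0 with hB | hB
  · rw [hB]; simp
  · field_simp
    ring

/-- The difference between the initial moment and its modular value. -/
noncomputable def kap : ℝ := bananaMoment 0 - 14 * eichlerConst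

/-- The closed form of the Feynman integral in the coordinate `σ`. -/
noncomputable def frickeInt (σ : ℂ) : ℂ :=
  formB σ * (-16 * (2 * eichler (6 * σ) - eichler (3 * σ) - 6 * eichler (2 * σ) + 3 * eichler σ)
    + 32 * I * Real.pi ^ 3 * σ ^ 3 - 48 * kap * σ ^ 2)

lemma eichler_fricke {d e : ℕ} (hde : d * e = 6) {σ : ℂ} (h : 0 < σ.im) :
    eichler (d * (-1 / (6 * σ))) = (eichler (e * σ) - (I * Real.pi ^ 3 / 180) *
      ((e * σ) ^ 3 + 1 / (e * σ)) + (I * Real.pi ^ 3 / 36) * (e * σ)) / (e * σ) ^ 2 := by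
  have he : 0 < e := Nat.pos_of_ne_zero (by rintro rfl; simp at hde)
  have hd : 0 < d := Nat.pos_of_ne_zero (by rintro rfl; simp at hde)
  have hd' : (d : ℂ) ≠ 0 := by exact_mod_cast hd.ne'
  have he' : (e : ℂ) ≠ 0 := by exact_mod_cast he.ne'
  have h0 := ne_zero_of_im_pos h
  have hc : (d : ℂ) * e = 6 := by exact_mod_cast hde
  have e1 : (d : ℂ) * (-1 / (6 * σ)) = -1 / (e * σ) := by
    rw [← hc]; field_simp
  rw [← eichler_inv (im_nat_mul_pos he h), e1]
  field_simp

lemma frickeInt_eq {σ : ℂ} (h : 0 < σ.im) :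
    formA (-1 / (6 * σ)) * (24 * epsComb (-1 / (6 * σ)) + bananaMoment 0) = frickeInt σ := by
  have h1 := eichler_fricke (d := 1) (e := 6) rfl h
  have h2 := eichler_fricke (d := 2) (e := 3) rfl h
  have h3 := eichler_fricke (d := 3) (e := 2) rfl h
  have h6 := eichler_fricke (d := 6) (e := 1) rfl h
  have h0 := ne_zero_of_im_pos h
  push_cast at h1 h2 h3 h6
  rw [one_mul] at h1 h6
  have e1 : 24 * epsComb (-1 / (6 * σ)) + bananaMoment 0 =
      24 * (eichler (-1 / (6 * σ)) - eichler (2 * (-1 / (6 * σ))) / 8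
        - eichler (3 * (-1 / (6 * σ))) / 3 + eichler (6 * (-1 / (6 * σ))) / 24) + kap := by
    simp only [epsComb, eichler, kap]
    push_cast
    ring
  rw [e1, h1, h2, h3, h6, formA_fricke h, frickeInt]
  field_simp
  ring

lemma bananaInt_frickeT_near : ∃ δ > (0 : ℝ), ∀ σ : ℂ,
    ‖σ‖ ^ 2 ≤ δ * σ.im → 0 < σ.im → bananaInt (frickeT σ) = frickeInt σ := by
  obtain ⟨Y, hY, h⟩ := bananaInt_hauptmodul_near_cusp
  refine ⟨1 / (12 * Y), by positivity, fun σ hσ him => ?_⟩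
  have h0 := ne_zero_of_im_pos him
  have hn : 0 < ‖σ‖ := norm_pos_iff.2 h0
  have hlt : Y < (-1 / (6 * σ)).im := by
    have : (-1 / (6 * σ)).im = σ.im / (6 * ‖σ‖ ^ 2) := by
      rw [← Complex.normSq_eq_norm_sq, Complex.div_im]
      simp [Complex.normSq_apply]
      field_simp
    rw [this, lt_div_iff₀ (by positivity)]
    have : ‖σ‖ ^ 2 * (12 * Y) ≤ σ.im := by
      calc _ ≤ 1 / (12 * Y) * σ.im * (12 * Y) := by gcongr
        _ = _ := by field_simp
    nlinarith
  have := (h _ hlt).2.2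
  rwa [hauptmodul_fricke him, frickeInt_eq him] at this

end ThreeBanana

namespace ThreeBanana

open Complex Filter Topology Set

/-- The logarithmic part of the primitive of `eisTwo`. -/
noncomputable def logSer (τ : ℂ) : ℂ := qSer (fun n => ((coeffTwo n : ℤ) : ℂ) / n) τ

lemma polyBdd_logSer : PolyBdd fun n => ((coeffTwo n : ℤ) : ℂ) / n := by
  obtain ⟨C, k, h⟩ := polyBdd_coeffTwo
  refine ⟨C, k, fun n => le_trans ?_ (h n)⟩
  rw [norm_div, Complex.norm_natCast]
  rcases Nat.eq_zero_or_pos n with rfl | hn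
  · simp
  · exact div_le_self (norm_nonneg _) (by exact_mod_cast hn)

lemma hasDerivAt_logSer {τ : ℂ} (h : 0 < τ.im) :
    HasDerivAt logSer (2 * Real.pi * I * (eisTwo τ - 1)) τ := by
  refine (hasDerivAt_qSer polyBdd_logSer h).congr_deriv ?_
  congr 1
  rw [eisTwo, qSer, qSer, (polyBdd_coeffTwo.hasSum h).summable.tsum_eq_zero_add,
    tsum_eq_zero_add']
  · simp [coeffTwo]
    refine tsum_congr fun n => ?_
    have : (n : ℂ) + 1 ≠ 0 := by exact_mod_cast n.succ_ne_zero
    field_simp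
  · refine ((summable_nat_add_iff 1).2 (polyBdd_coeffTwo.hasSum h).summable).congr fun n => ?_
    have : (n : ℂ) + 1 ≠ 0 := by exact_mod_cast n.succ_ne_zero
    push_cast
    field_simp

/-- A primitive of `eisTwoDil d`. -/
noncomputable def eisPrim (d : ℕ) (τ : ℂ) : ℂ := d * τ + logSer (d * τ) / (2 * Real.pi * I)

lemma hasDerivAt_eisPrim {d : ℕ} (hd : 0 < d) {τ : ℂ} (h : 0 < τ.im) :
    HasDerivAt (eisPrim d) (eisTwoDil d τ) τ := by
  have h1 : HasDerivAt (fun τ : ℂ => (d : ℂ) * τ) d τ := by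
    simpa using (hasDerivAt_id τ).const_mul (d : ℂ)
  have h2 := HasDerivAt.comp τ (hasDerivAt_logSer (im_nat_mul_pos hd h)) h1
  refine (h1.add (h2.div_const (2 * Real.pi * I))).congr_deriv ?_
  have := pi_ne'
  rw [eisTwoDil]
  field_simp
  ring

lemma eisPrim_re {d : ℕ} {τ : ℂ} (h : (nome (d * τ)).im = 0) : (eisPrim d τ).re = d * τ.re := by
  have hl : (logSer (d * τ)).im = 0 := qSer_conj (fun n => by
    rw [show ((coeffTwo n : ℤ) : ℂ) / n = (((coeffTwo n : ℤ) / (n : ℝ) : ℝ) : ℂ) by push_cast; rfl,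
      Complex.ofReal_im]) h
  have : logSer (d * τ) / (2 * Real.pi * I) = -I * (((logSer (d * τ)).re / (2 * Real.pi) : ℝ) : ℂ) := by
    have := pi_ne'
    rw [← Complex.re_add_im (logSer (d * τ)), hl]
    push_cast
    simp
    field_simp
    rw [I_sq]
    ring
  rw [eisPrim, this, Complex.add_re, neg_mul, Complex.neg_re, Complex.I_mul_re, Complex.ofReal_im]
  simp

lemma eq_const_mul_exp {f φ P : ℂ → ℂ}
    (hf : ∀ τ : ℂ, 0 < τ.im → HasDerivAt f (2 * Real.pi * I * (φ τ * f τ)) τ)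
    (hP : ∀ τ : ℂ, 0 < τ.im → HasDerivAt P (φ τ) τ) :
    ∃ K, ∀ τ : ℂ, 0 < τ.im → f τ = K * Complex.exp (2 * Real.pi * I * P τ) := by
  obtain ⟨K, hK⟩ := exists_const_of_deriv_zero
    (f := fun τ => f τ * Complex.exp (-(2 * Real.pi * I * P τ)))
    (fun τ h => (hf τ h).mul (((hP τ h).const_mul (2 * Real.pi * I)).neg.cexp))
    (fun τ h => by simp only [Pi.neg_apply]; ring)
  refine ⟨K, fun τ h => ?_⟩
  rw [← hK τ h, mul_assoc, ← Complex.exp_add, neg_add_cancel, Complex.exp_zero, mul_one]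

/-- A primitive of `logDerivA`. -/
noncomputable def primA (τ : ℂ) : ℂ :=
  eisPrim 1 τ / 6 - eisPrim 2 τ / 12 + eisPrim 3 τ / 6 - eisPrim 6 τ / 12

/-- A primitive of `formW`. -/
noncomputable def primW (τ : ℂ) : ℂ :=
  -eisPrim 1 τ / 4 + eisPrim 2 τ / 4 - eisPrim 3 τ / 4 + eisPrim 6 τ / 4

lemma eisTwoDil_one (τ : ℂ) : eisTwoDil 1 τ = eisTwo τ := by simp [eisTwoDil]

lemma hasDerivAt_primA {τ : ℂ} (h : 0 < τ.im) : HasDerivAt primA (logDerivA τ) τ := by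
  have h1 := hasDerivAt_eisPrim one_pos h
  rw [eisTwoDil_one] at h1
  exact (((h1.div_const 6).sub ((hasDerivAt_eisPrim two_pos h).div_const 12)).add
    ((hasDerivAt_eisPrim three_pos h).div_const 6)).sub
    ((hasDerivAt_eisPrim (d := 6) (by norm_num) h).div_const 12)

lemma hasDerivAt_primW {τ : ℂ} (h : 0 < τ.im) : HasDerivAt primW (formW τ) τ := by
  have h1 := hasDerivAt_eisPrim one_pos h
  rw [eisTwoDil_one] at h1
  exact (((h1.neg.div_const 4).add ((hasDerivAt_eisPrim two_pos h).div_const 4)).sub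
    ((hasDerivAt_eisPrim three_pos h).div_const 4)).add
    ((hasDerivAt_eisPrim (d := 6) (by norm_num) h).div_const 4)

lemma nome_nat_mul_im {d : ℕ} {τ : ℂ} (h : (nome τ).im = 0) : (nome (d * τ)).im = 0 := by
  rw [nome_nat_mul, ← Complex.conj_eq_iff_im, map_pow, Complex.conj_eq_iff_im.2 h]

lemma primA_re {τ : ℂ} (h : (nome τ).im = 0) : (primA τ).re = 0 := by
  have := fun d : ℕ => eisPrim_re (nome_nat_mul_im (d := d) h)
  have h6 := this 6
  have h3 := this 3
  have h2 := this 2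
  have h1 := this 1
  push_cast at *
  rw [primA, Complex.sub_re, Complex.add_re, Complex.sub_re, Complex.div_ofNat_re,
    Complex.div_ofNat_re, Complex.div_ofNat_re, Complex.div_ofNat_re, h1, h2, h3, h6]
  ring

lemma primW_re {τ : ℂ} (h : (nome τ).im = 0) : (primW τ).re = τ.re := by
  have := fun d : ℕ => eisPrim_re (nome_nat_mul_im (d := d) h)
  have h6 := this 6
  have h3 := this 3
  have h2 := this 2
  have h1 := this 1
  push_cast at *
  rw [primW, Complex.add_re, Complex.sub_re, Complex.add_re, Complex.div_ofNat_re,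
    Complex.div_ofNat_re, Complex.div_ofNat_re, Complex.div_ofNat_re, Complex.neg_re, h1, h2, h3, h6]
  ring

lemma eisTwoDil_im {τ : ℂ} (h : (nome τ).im = 0) (d : ℕ) : (eisTwoDil d τ).im = 0 := by
  rw [eisTwoDil, Complex.mul_im, eisTwo_im (nome_nat_mul_im h)]
  simp

lemma formA_im {τ : ℂ} (h : (nome τ).im = 0) : (formA τ).im = 0 := by
  simp [formA, eisTwoDil_im h, eisTwo_im h]

lemma formB_im {τ : ℂ} (h : (nome τ).im = 0) : (formB τ).im = 0 := by
  simp [formB, eisTwoDil_im h, eisTwo_im h]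

lemma exp_of_re {z : ℂ} (h : z.re = 0) :
    Complex.exp (2 * Real.pi * I * z) = (Real.exp (-(2 * Real.pi * z.im)) : ℝ) := by
  have : 2 * Real.pi * I * z = ((-(2 * Real.pi * z.im) : ℝ) : ℂ) := by
    apply Complex.ext <;> simp [h]
  rw [this, Complex.ofReal_exp]

/-- `formA` in terms of the primitive of its logarithmic derivative. -/
lemma formA_eq_exp : ∃ K : ℝ, 0 < K ∧ ∀ τ : ℂ, 0 < τ.im →
    formA τ = K * Complex.exp (2 * Real.pi * I * primA τ) := by
  obtain ⟨K, hK⟩ := eq_const_mul_exp (f := formA) (fun τ h => hasDerivAt_formA h)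
    (fun τ h => hasDerivAt_primA h)
  have ht : Tendsto (fun y : ℝ => (y : ℂ) * I) atTop cuspFilter := by
    rw [cuspFilter, tendsto_comap_iff]
    exact tendsto_id.congr fun y => by simp
  have h1 := (Complex.continuous_re.tendsto 1).comp (tendsto_formA_cusp.comp ht)
  obtain ⟨y, hy, hy0⟩ := ((h1.eventually_const_lt (u := 0) (by simp)).and
    (eventually_gt_atTop 0)).exists
  have hre : ((y : ℂ) * I).re = 0 := by simp
  have h2 := hK (y * I) (by simpa using hy0)
  rw [exp_of_re (primA_re (nome_im_of_re hre))] at h2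
  have h3 := formA_im (nome_im_of_re hre)
  have hpos := Real.exp_pos (-(2 * Real.pi * (primA (y * I)).im))
  simp only [Function.comp_apply] at hy
  rw [h2, Complex.re_mul_ofReal] at hy
  rw [h2, Complex.im_mul_ofReal] at h3
  refine ⟨K.re, pos_of_mul_pos_left hy hpos.le, fun τ h => ?_⟩
  rw [hK τ h]
  congr 1
  apply Complex.ext
  · simp
  · simpa [hpos.ne'] using h3

lemma formA_ne_zero {τ : ℂ} (h : 0 < τ.im) : formA τ ≠ 0 := by
  obtain ⟨K, hK, he⟩ := formA_eq_exp
  rw [he τ h]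
  exact mul_ne_zero (by exact_mod_cast hK.ne') (Complex.exp_ne_zero _)

lemma formB_ne_zero {τ : ℂ} (h : 0 < τ.im) : formB τ ≠ 0 := by
  intro h0
  have h1 : 0 < (6 * τ).im := by simpa using im_nat_mul_pos (d := 6) (by norm_num) h
  have := formA_ne_zero (im_inv_pos h1)
  rw [formA_fricke h, h0, mul_zero] at this
  exact this rfl

lemma formA_pos {y : ℝ} (hy : 0 < y) : ∃ r : ℝ, 0 < r ∧ formA (y * I) = r := by
  obtain ⟨K, hK, he⟩ := formA_eq_exp
  have hre : ((y : ℂ) * I).re = 0 := by simp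
  refine ⟨K * Real.exp (-(2 * Real.pi * (primA (y * I)).im)), mul_pos hK (Real.exp_pos _), ?_⟩
  rw [he _ (by simpa using hy), exp_of_re (primA_re (nome_im_of_re hre)), Complex.ofReal_mul]

lemma formB_pos {y : ℝ} (hy : 0 < y) : ∃ r : ℝ, 0 < r ∧ formB (y * I) = r := by
  obtain ⟨r, hr, h⟩ := formA_pos (y := 1 / (6 * y)) (by positivity)
  refine ⟨r / (48 * y ^ 2), by positivity, ?_⟩
  have h1 := formA_fricke (σ := y * I) (by simpa using hy)
  have hy' : (y : ℂ) ≠ 0 := by exact_mod_cast hy.ne'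
  have e : -1 / (6 * (y * I)) = ((1 / (6 * y) : ℝ) : ℂ) * I := by
    push_cast
    field_simp
    rw [I_sq]
  rw [e, h] at h1
  push_cast
  field_simp
  rw [h1]
  linear_combination (48 * y ^ 2 * formB (y * I)) * I_sq

lemma frickeT_eq_exp : ∃ C : ℝ, 0 < C ∧ ∀ τ : ℂ, 0 < τ.im →
    frickeT τ = -C * Complex.exp (-(2 * Real.pi * I * primW τ)) := by
  obtain ⟨K, hK⟩ := eq_const_mul_exp (f := frickeT) (φ := fun τ => -formW τ)
    (P := fun τ => -primW τ) (fun τ h => by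
      have hB := formB_ne_zero h
      refine ((hasDerivAt_formA h).neg.div (hasDerivAt_formB h) hB).congr_deriv ?_
      simp only [frickeT, Pi.neg_apply]
      field_simp
      ring) (fun τ h => (hasDerivAt_primW h).neg)
  have hre : (((1 : ℝ) : ℂ) * I).re = 0 := by simp
  obtain ⟨r, hr, hA⟩ := formA_pos one_pos
  obtain ⟨s, hs, hB⟩ := formB_pos one_pos
  have h2 := hK (((1 : ℝ) : ℂ) * I) (by simp)
  have h3 : (-primW (((1 : ℝ) : ℂ) * I)).re = 0 := by
    rw [Complex.neg_re, primW_re (nome_im_of_re hre), hre, neg_zero]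
  rw [exp_of_re h3, frickeT, hA, hB] at h2
  have hu := Real.exp_pos (-(2 * Real.pi * (-primW (((1 : ℝ) : ℂ) * I)).im))
  generalize Real.exp _ = u at h2 hu
  have hu' : (u : ℂ) ≠ 0 := by exact_mod_cast hu.ne'
  refine ⟨r / (s * u), by positivity, fun τ h => ?_⟩
  have hKe : K = -((r / (s * u) : ℝ) : ℂ) := by
    have hs' : (s : ℂ) ≠ 0 := by exact_mod_cast hs.ne'
    push_cast
    field_simp at h2 ⊢
    linear_combination -h2
  rw [hK τ h, hKe, mul_neg]

end ThreeBanana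

namespace ThreeBanana

open Complex Filter Topology Set

lemma norm_mul_pow_div_le {z : ℂ} (hz : ‖z‖ < 1) (n : ℕ) (hn : n ≠ 0) :
    ‖(n : ℂ) * z ^ n / (1 - z ^ n)‖ ≤ n * ‖z‖ ^ n / (1 - ‖z‖) := by
  have h1 : 1 - ‖z‖ ≤ ‖1 - z ^ n‖ := by
    have := norm_sub_norm_le (1 : ℂ) (z ^ n)
    rw [norm_one, norm_pow] at this
    have h2 := pow_le_of_le_one (norm_nonneg z) hz.le hn
    linarith
  rw [norm_div, norm_mul, norm_pow, Complex.norm_natCast]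
  have : 0 < 1 - ‖z‖ := by linarith
  gcongr

lemma summable_lambert {z : ℂ} (hz : ‖z‖ < 1) :
    Summable fun n : ℕ => (n : ℂ) * z ^ n / (1 - z ^ n) := by
  have hs : Summable fun n : ℕ => (n : ℝ) * ‖z‖ ^ n / (1 - ‖z‖) := by
    have := summable_pow_mul_geometric_of_norm_lt_one 1 (r := ‖z‖) (by simpa using hz)
    simp only [pow_one] at this
    exact this.div_const _
  refine Summable.of_norm_bounded hs fun n => ?_
  rcases eq_or_ne n 0 with rfl | hn
  · simp
  · exact norm_mul_pow_div_le hz n hn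

lemma eisTwo_lambert {τ : ℂ} (h : 0 < τ.im) :
    eisTwo τ = 1 - 24 * ∑' n : ℕ, (n : ℂ) * nome τ ^ n / (1 - nome τ ^ n) := by
  have hq := norm_nome_lt_one h
  have h1 := tsum_pow_div_one_sub_eq_tsum_sigma hq 1
  simp only [pow_one] at h1
  rw [(summable_lambert hq).tsum_eq_zero_add, eisTwo, qSer,
    (polyBdd_coeffTwo.hasSum h).summable.tsum_eq_zero_add]
  rw [tsum_pnat_eq_tsum_succ (f := fun n : ℕ => (n : ℂ) * nome τ ^ n / (1 - nome τ ^ n)),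
    tsum_pnat_eq_tsum_succ (f := fun n : ℕ => (ArithmeticFunction.sigma 1 n : ℂ) * nome τ ^ n)] at h1
  rw [h1]
  simp only [coeffTwo, if_true, Nat.succ_ne_zero, if_false]
  push_cast
  rw [zero_mul, zero_div, zero_add, pow_zero, mul_one, sub_eq_add_neg, ← neg_mul,
    ← tsum_mul_left (a := (-24 : ℂ))]
  congr 1
  refine tsum_congr fun n => ?_
  rw [ArithmeticFunction.sigma_one_apply]
  push_cast
  ring

/-- The odd part of the Lambert series of `eisTwo`, in the variable `-q`. -/
noncomputable def lam {𝕜 : Type*} [NormedField 𝕜] (z : 𝕜) : 𝕜 :=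
  ∑' n : ℕ, ((2 * n + 1 : ℕ) : 𝕜) * z ^ (2 * n + 1) / (1 + z ^ (2 * n + 1))

lemma odd_term (z : ℂ) (n : ℕ) :
    ((2 * n + 1 : ℕ) : ℂ) * z ^ (2 * n + 1) / (1 + z ^ (2 * n + 1)) =
      -(((2 * n + 1 : ℕ) : ℂ) * (-z) ^ (2 * n + 1) / (1 - (-z) ^ (2 * n + 1))) := by
  have : (-z) ^ (2 * n + 1) = -z ^ (2 * n + 1) := (odd_two_mul_add_one n).neg_pow z
  rw [this, sub_neg_eq_add]
  ring

lemma summable_lam {z : ℂ} (hz : ‖z‖ < 1) : Summable fun n : ℕ =>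
    ((2 * n + 1 : ℕ) : ℂ) * z ^ (2 * n + 1) / (1 + z ^ (2 * n + 1)) := by
  have hz' : ‖-z‖ < 1 := by rwa [norm_neg]
  have := (summable_lambert hz').comp_injective (i := fun n : ℕ => 2 * n + 1)
    (fun a b h => by simpa using h)
  exact this.neg.congr fun n => (odd_term z n).symm

lemma lambert_sub {z : ℂ} (hz : ‖z‖ < 1) :
    ∑' n : ℕ, (n : ℂ) * z ^ n / (1 - z ^ n) - 2 * ∑' n : ℕ, (n : ℂ) * (z ^ 2) ^ n / (1 - (z ^ 2) ^ n)
      = -lam (-z) := by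
  have hs := summable_lambert hz
  have h1 : Summable fun n : ℕ => ((2 * n : ℕ) : ℂ) * z ^ (2 * n) / (1 - z ^ (2 * n)) :=
    hs.comp_injective (i := fun n : ℕ => 2 * n) (fun a b h => by simpa using h)
  have h2 : Summable fun n : ℕ => ((2 * n + 1 : ℕ) : ℂ) * z ^ (2 * n + 1) / (1 - z ^ (2 * n + 1)) :=
    hs.comp_injective (i := fun n : ℕ => 2 * n + 1) (fun a b h => by simpa using h)
  have h3 := tsum_even_add_odd (f := fun n : ℕ => (n : ℂ) * z ^ n / (1 - z ^ n)) h1 h2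
  have h4 : ∑' n : ℕ, ((2 * n : ℕ) : ℂ) * z ^ (2 * n) / (1 - z ^ (2 * n)) =
      2 * ∑' n : ℕ, (n : ℂ) * (z ^ 2) ^ n / (1 - (z ^ 2) ^ n) := by
    rw [← tsum_mul_left]
    refine tsum_congr fun n => ?_
    rw [pow_mul]
    push_cast
    ring
  have h5 : ∑' n : ℕ, ((2 * n + 1 : ℕ) : ℂ) * z ^ (2 * n + 1) / (1 - z ^ (2 * n + 1)) = -lam (-z) := by
    rw [lam, ← tsum_neg]
    refine tsum_congr fun n => ?_
    rw [odd_term, neg_neg, neg_neg]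
  rw [← h3, h4, h5]
  ring

lemma formW_eq_lam {τ : ℂ} (h : 0 < τ.im) :
    formW τ = 1 - 6 * lam (-nome τ) - 18 * lam (-nome τ ^ 3) := by
  have hq := norm_nome_lt_one h
  have hq3 := norm_nome_lt_one (im_nat_mul_pos three_pos h)
  have e := fun d (hd : 0 < d) => eisTwo_lambert (im_nat_mul_pos (d := d) hd h)
  have e2 := e 2 two_pos
  have e3 := e 3 three_pos
  have e6 := e 6 (by norm_num)
  simp only [nome_nat_mul] at e2 e3 e6 hq3
  have l1 := lambert_sub hq
  have l3 := lambert_sub hq3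
  rw [← pow_mul] at l3
  simp only [formW, eisTwoDil, e2, e3, e6, eisTwo_lambert h]
  push_cast
  linear_combination 6 * l1 + 18 * l3

lemma re_div_one_add_le {z : ℂ} (hz : ‖z‖ < 1) : (z / (1 + z)).re ≤ ‖z‖ / (1 + ‖z‖) := by
  have hne : 1 + z ≠ 0 := by
    intro h
    rw [show z = -1 by linear_combination h] at hz
    simp at hz
  have hpos : 0 < Complex.normSq (1 + z) := Complex.normSq_pos.2 hne
  have h0 := norm_nonneg z
  have hx := Complex.re_le_norm z
  have hsq : ‖z‖ ^ 2 = z.re * z.re + z.im * z.im := by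
    rw [← Complex.normSq_eq_norm_sq, Complex.normSq_apply]
  rw [Complex.div_re, ← add_div, div_le_div_iff₀ hpos (by positivity), Complex.normSq_apply]
  simp only [Complex.add_re, Complex.one_re, Complex.add_im, Complex.one_im, zero_add]
  nlinarith [mul_nonneg (sub_nonneg.2 hx) (sub_nonneg.2 hz.le)]

lemma lam_ofReal (r : ℝ) : ((lam r : ℝ) : ℂ) = lam (r : ℂ) := by
  rw [lam, lam, Complex.ofReal_tsum]
  refine tsum_congr fun n => ?_
  push_cast
  rfl

lemma summable_lam_real {r : ℝ} (h0 : 0 ≤ r) (h1 : r < 1) : Summable fun n : ℕ =>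
    ((2 * n + 1 : ℕ) : ℝ) * r ^ (2 * n + 1) / (1 + r ^ (2 * n + 1)) := by
  have := summable_lam (z := (r : ℂ)) (by rwa [Complex.norm_real, Real.norm_of_nonneg h0])
  rw [← Complex.summable_ofReal]
  refine this.congr fun n => ?_
  push_cast
  rfl

lemma lam_re_le {z : ℂ} (hz : ‖z‖ < 1) : (lam z).re ≤ lam ‖z‖ := by
  rw [lam, lam, Complex.re_tsum (summable_lam hz)]
  refine Summable.tsum_le_tsum (fun n => ?_) ((Complex.reCLM.summable (summable_lam hz)))
    (summable_lam_real (norm_nonneg z) hz)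
  have hn : ‖z ^ (2 * n + 1)‖ < 1 := by
    rw [norm_pow]; exact pow_lt_one₀ (norm_nonneg z) hz (by omega)
  have := re_div_one_add_le hn
  rw [mul_div_assoc, mul_div_assoc, ← norm_pow, ← Complex.ofReal_natCast, Complex.re_ofReal_mul]
  gcongr

lemma lam_lt {r s : ℝ} (h0 : 0 ≤ r) (hrs : r < s) (hs : s < 1) : lam r < lam s := by
  have key : ∀ n : ℕ, ((2 * n + 1 : ℕ) : ℝ) * r ^ (2 * n + 1) / (1 + r ^ (2 * n + 1)) <
      ((2 * n + 1 : ℕ) : ℝ) * s ^ (2 * n + 1) / (1 + s ^ (2 * n + 1)) := by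
    intro n
    have h1 : r ^ (2 * n + 1) < s ^ (2 * n + 1) := pow_lt_pow_left₀ hrs h0 (by omega)
    have h2 : 0 ≤ r ^ (2 * n + 1) := by positivity
    have h3 : 0 < ((2 * n + 1 : ℕ) : ℝ) := by positivity
    rw [mul_div_assoc, mul_div_assoc]
    refine mul_lt_mul_of_pos_left ?_ h3
    rw [div_lt_div_iff₀ (by linarith) (by linarith)]
    nlinarith
  exact Summable.tsum_lt_tsum (i := 0) (fun n => (key n).le) (key 0)
    (summable_lam_real h0 (hrs.trans hs)) (summable_lam_real (h0.trans hrs.le) hs)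

lemma formW_ellPt : formW ellPt = 0 := by
  simp only [formW, eisTwoDil]
  push_cast
  rw [eisTwo_ellPt, eisTwo_two_ellPt, eisTwo_three_ellPt, eisTwo_six_ellPt]
  ring

lemma ellPt_re : ellPt.re = 1 / 2 := by
  simp [ellPt, rt_im]; norm_num

lemma ellPt_im : ellPt.im = Real.sqrt 3 / 6 := by
  simp [ellPt, rt_re]

lemma ellPt_im_pos : 0 < ellPt.im := by
  rw [ellPt_im]; have := sqrt_three_pos; positivity

lemma nome_of_half {τ : ℂ} (h : τ.re = 1 / 2) : nome τ = -(‖nome τ‖ : ℂ) := by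
  have h1 : (nome τ) = -nome (τ - 1 / 2) := by rw [← nome_add_half, sub_add_cancel]
  have h2 : nome (τ - 1 / 2) = (Real.exp (-(2 * Real.pi * (τ - 1 / 2).im)) : ℝ) :=
    exp_of_re (by simp [h])
  rw [h1, norm_neg, h2, Complex.norm_real, Real.norm_of_nonneg (Real.exp_pos _).le]

lemma formW_re_pos {τ : ℂ} (h : ellPt.im < τ.im) : 0 < (formW τ).re := by
  have him : 0 < τ.im := ellPt_im_pos.trans h
  have h0 := formW_eq_lam ellPt_im_pos
  set r := ‖nome ellPt‖ with hr
  have hr1 : r < 1 := norm_nome_lt_one ellPt_im_pos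
  have hs1 := norm_nome_lt_one him
  have hlt : ‖nome τ‖ < r := by
    rw [hr, norm_nome, norm_nome]
    have := Real.pi_pos
    apply Real.exp_lt_exp.2
    nlinarith
  have hr0 : 0 ≤ r := norm_nonneg _
  rw [formW_ellPt, nome_of_half ellPt_re, ← hr, (by decide : Odd 3).neg_pow, neg_neg, neg_neg,
    ← Complex.ofReal_pow, ← lam_ofReal, ← lam_ofReal] at h0
  have h0' : 0 = 1 - 6 * lam r - 18 * lam (r ^ 3) := by exact_mod_cast h0
  have h1 : (formW τ).re = 1 - 6 * (lam (-nome τ)).re - 18 * (lam (-nome τ ^ 3)).re := by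
    rw [formW_eq_lam him]
    simp
  have h2 := lam_re_le (z := -nome τ) (by rwa [norm_neg])
  have h3 := lam_re_le (z := -nome τ ^ 3) (by
    rw [norm_neg, norm_pow]; exact pow_lt_one₀ (norm_nonneg _) hs1 (by norm_num))
  rw [norm_neg] at h2
  rw [norm_neg, norm_pow] at h3
  have h4 := lam_lt (norm_nonneg _) hlt hr1
  have h5 := lam_lt (pow_nonneg (norm_nonneg _) 3)
    (pow_lt_pow_left₀ hlt (norm_nonneg _) (by norm_num : 3 ≠ 0))
    (pow_lt_one₀ hr0 hr1 (by norm_num : 3 ≠ 0))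
  linarith

end ThreeBanana

namespace ThreeBanana

open Complex Filter Topology Set

lemma isOpen_cutPlane : IsOpen cutPlane := by
  have : cutPlane = {t : ℂ | t.im ≠ 0} ∪ {t : ℂ | t.re < 16} := rfl
  rw [this]
  exact (isOpen_ne_fun Complex.continuous_im continuous_const).union
    (isOpen_lt Complex.continuous_re continuous_const)

lemma analyticAt_bananaInt {t : ℂ} (ht : t ∈ cutPlane) : AnalyticAt ℂ bananaInt t :=
  DifferentiableOn.analyticAt (s := cutPlane)
    (fun _ hx => (differentiableAt_bananaInt hx).differentiableWithinAt)
    (isOpen_cutPlane.mem_nhds ht)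

lemma isOpen_upper : IsOpen {τ : ℂ | 0 < τ.im} := isOpen_lt continuous_const Complex.continuous_im

lemma analyticAt_of_upper {f : ℂ → ℂ} (hf : ∀ τ : ℂ, 0 < τ.im → DifferentiableAt ℂ f τ)
    {τ : ℂ} (h : 0 < τ.im) : AnalyticAt ℂ f τ :=
  DifferentiableOn.analyticAt (s := {τ : ℂ | 0 < τ.im})
    (fun x hx => (hf x hx).differentiableWithinAt) (isOpen_upper.mem_nhds h)

lemma differentiableAt_frickeT {τ : ℂ} (h : 0 < τ.im) : DifferentiableAt ℂ frickeT τ :=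
  (hasDerivAt_formA h).differentiableAt.neg.div (hasDerivAt_formB h).differentiableAt
    (formB_ne_zero h)

lemma differentiableAt_eichler {τ : ℂ} (h : 0 < τ.im) : DifferentiableAt ℂ eichler τ :=
  (hasDerivAt_epsSer 1 h).differentiableAt.add_const _

lemma differentiableAt_eichler_mul {d : ℕ} (hd : 0 < d) {τ : ℂ} (h : 0 < τ.im) :
    DifferentiableAt ℂ (fun τ => eichler (d * τ)) τ :=
  DifferentiableAt.comp τ (g := eichler) (differentiableAt_eichler (im_nat_mul_pos hd h))
    (by fun_prop)

lemma differentiableAt_frickeInt {τ : ℂ} (h : 0 < τ.im) : DifferentiableAt ℂ frickeInt τ := by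
  have h1 := differentiableAt_eichler h
  have h2 := differentiableAt_eichler_mul two_pos h
  have h3 := differentiableAt_eichler_mul three_pos h
  have h6 := differentiableAt_eichler_mul (d := 6) (by norm_num) h
  have hB := (hasDerivAt_formB h).differentiableAt
  push_cast at h2 h3 h6
  unfold frickeInt
  fun_prop

lemma primW_re_mem {τ : ℂ} (h0 : 0 < τ.re) (h1 : τ.re < 1 / 2) (him : ellPt.im < τ.im) :
    0 < (primW τ).re ∧ (primW τ).re < 1 / 2 := by
  have hpos : ∀ x : ℝ, 0 < ((x : ℂ) + τ.im * I).im := fun x => by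
    simpa using ellPt_im_pos.trans him
  have hd : ∀ x : ℝ, HasDerivAt (fun x : ℝ => (primW (x + τ.im * I)).re)
      (formW (x + τ.im * I)).re x := by
    intro x
    have h2 : HasDerivAt (fun z : ℂ => primW (z + τ.im * I)) (formW (x + τ.im * I)) (x : ℂ) := by
      simpa using HasDerivAt.comp_add_const (x : ℂ) (τ.im * I) (hasDerivAt_primW (hpos x))
    exact h2.real_of_complex
  have hmono := strictMono_of_hasDerivAt_pos hd (fun x => formW_re_pos (by simpa using him))
  have e : ((τ.re : ℝ) : ℂ) + τ.im * I = τ := Complex.re_add_im τ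
  have m0 := hmono h0
  have m1 := hmono h1
  simp only [e] at m0 m1
  have r0 : (primW (((0 : ℝ) : ℂ) + τ.im * I)).re = 0 := by
    rw [primW_re (nome_im_of_re (by simp))]; simp
  have r1 : (primW (((1 / 2 : ℝ) : ℂ) + τ.im * I)).re = 1 / 2 := by
    rw [primW_re (nome_im_of_half (by simp))]; simp
  rw [r0] at m0
  rw [r1] at m1
  exact ⟨m0, m1⟩

lemma frickeT_im_pos {τ : ℂ} (h0 : 0 < τ.re) (h1 : τ.re < 1 / 2) (him : ellPt.im < τ.im) :
    0 < (frickeT τ).im := by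
  obtain ⟨C, hC, h⟩ := frickeT_eq_exp
  obtain ⟨m0, m1⟩ := primW_re_mem h0 h1 him
  have hs : 0 < Real.sin (2 * Real.pi * (primW τ).re) :=
    Real.sin_pos_of_pos_of_lt_pi (by have := Real.pi_pos; positivity)
      (by nlinarith [Real.pi_pos])
  rw [h τ (ellPt_im_pos.trans him), ← Complex.ofReal_neg, Complex.im_ofReal_mul, Complex.exp_im]
  have e1 : (-(2 * Real.pi * I * primW τ)).im = -(2 * Real.pi * (primW τ).re) := by simp
  rw [e1, Real.sin_neg]
  have := Real.exp_pos (-(2 * Real.pi * I * primW τ)).re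
  have := mul_pos hC (mul_pos this hs)
  linarith

lemma frickeT_axis {τ : ℂ} (h0 : τ.re = 0) (him : 0 < τ.im) : (frickeT τ).re < 0 := by
  obtain ⟨r, hr, hA⟩ := formA_pos him
  obtain ⟨s, hs, hB⟩ := formB_pos him
  have e : τ = τ.im * I := by apply Complex.ext <;> simp [h0]
  rw [e, frickeT, hA, hB, ← Complex.ofReal_neg, ← Complex.ofReal_div, Complex.ofReal_re]
  exact div_neg_of_neg_of_pos (by linarith) hs

/-- The connected region along which the Feynman integral is continued. -/
def contRegion : Set ℂ :=
  {τ | τ.re = 0 ∧ 0 < τ.im} ∪ {τ | (0 ≤ τ.re ∧ τ.re < 1 / 2) ∧ ellPt.im < τ.im}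

lemma contRegion_im {τ : ℂ} (h : τ ∈ contRegion) : 0 < τ.im := by
  rcases h with h | h
  · exact h.2
  · exact ellPt_im_pos.trans h.2

lemma frickeT_mem_cutPlane {τ : ℂ} (h : τ ∈ contRegion) : frickeT τ ∈ cutPlane := by
  rcases h with h | h
  · exact Or.inr (by have := frickeT_axis h.1 h.2; linarith)
  · rcases h.1.1.eq_or_lt with h0 | h0
    · exact Or.inr (by have := frickeT_axis h0.symm (ellPt_im_pos.trans h.2); linarith)
    · exact Or.inl (frickeT_im_pos h0 h.1.2 h.2).ne'

lemma ellPt_im_lt_one : ellPt.im < 1 := by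
  rw [ellPt_im]
  have : Real.sqrt 3 < 2 := by
    rw [Real.sqrt_lt' (by norm_num)]; norm_num
  linarith

lemma isPreconnected_contRegion : IsPreconnected contRegion := by
  refine IsPreconnected.union I ⟨by simp, by simp⟩ ⟨by simp, by simpa using ellPt_im_lt_one⟩ ?_ ?_
  · have h1 : Convex ℝ {τ : ℂ | τ.re = 0} := convex_hyperplane Complex.reLm.isLinear 0
    exact (h1.inter (convex_halfSpace_im_gt 0)).isPreconnected
  · exact (((convex_halfSpace_re_ge 0).inter (convex_halfSpace_re_lt (1 / 2))).inter
      (convex_halfSpace_im_gt ellPt.im)).isPreconnected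

lemma bananaInt_frickeT {τ : ℂ} (h : τ ∈ contRegion) : bananaInt (frickeT τ) = frickeInt τ := by
  obtain ⟨δ, hδ, hnear⟩ := bananaInt_frickeT_near
  have hz : ((δ / 2 : ℝ) : ℂ) * I ∈ contRegion := Or.inl ⟨by simp, by simpa using hδ⟩
  refine AnalyticOnNhd.eqOn_of_preconnected_of_eventuallyEq (𝕜 := ℂ)
    (f := fun τ => bananaInt (frickeT τ)) (g := frickeInt) (fun τ hτ => ?_) (fun τ hτ => ?_) isPreconnected_contRegion hz ?_ h
  · exact AnalyticAt.comp (g := bananaInt) (f := frickeT) (analyticAt_bananaInt (frickeT_mem_cutPlane hτ))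
      (analyticAt_of_upper (fun _ h => differentiableAt_frickeT h) (contRegion_im hτ))
  · exact analyticAt_of_upper (fun _ h => differentiableAt_frickeInt h) (contRegion_im hτ)
  · have h1 : ∀ᶠ σ in 𝓝 (((δ / 2 : ℝ) : ℂ) * I), ‖σ‖ ^ 2 < δ * σ.im := by
      refine ContinuousAt.eventually_lt (by fun_prop)
        (continuous_const.mul Complex.continuous_im).continuousAt ?_
      simp only [norm_mul, Complex.norm_real, Complex.norm_I, mul_one, Real.norm_eq_abs, sq_abs,
        Complex.im_ofReal_mul, Complex.I_im]
      nlinarith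
    filter_upwards [h1, isOpen_upper.mem_nhds (contRegion_im hz)] with σ h2 h3
    exact hnear σ h2.le h3

lemma hasDerivAt_formW' {τ : ℂ} (h : 0 < τ.im) :
    HasDerivAt formW (2 * Real.pi * I *
      (logDerivA τ * formW τ + 10 * formA τ * formB τ + 64 * formB τ ^ 2)) τ := by
  have hd := fun {τ : ℂ} (h : 0 < τ.im) => differentiableAt_formW h
  have ha : ∀ τ ∈ {τ : ℂ | 0 < τ.im}, AnalyticAt ℂ formW τ := fun τ hτ =>
    analyticAt_of_upper (fun _ h => hd h) hτ
  have ht : Tendsto (fun y : ℝ => (y : ℂ) * I) atTop cuspFilter := by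
    rw [cuspFilter, tendsto_comap_iff]
    exact tendsto_id.congr fun y => by simp
  obtain ⟨y, hy, hy0⟩ := (((tendsto_formW_cusp.comp ht).eventually_ne one_ne_zero).and
    (eventually_gt_atTop 0)).exists
  have hz : (y : ℂ) * I ∈ {τ : ℂ | 0 < τ.im} := by simpa using hy0
  have key := AnalyticOnNhd.eqOn_of_preconnected_of_eventuallyEq (f := deriv formW)
    (g := fun τ => 2 * Real.pi * I *
      (logDerivA τ * formW τ + 10 * formA τ * formB τ + 64 * formB τ ^ 2))
    (fun τ hτ => (ha τ hτ).deriv) (fun τ hτ => analyticAt_of_upper (fun τ h => by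
      have h1 := hd h
      have h2 := (hasDerivAt_formA h).differentiableAt
      have h3 := (hasDerivAt_formB h).differentiableAt
      have h4 := (hasDerivAt_logDerivA h).differentiableAt
      fun_prop) hτ)
    (convex_halfSpace_im_gt 0).isPreconnected hz (by
      filter_upwards [(hd hz).continuousAt.eventually_ne hy, isOpen_upper.mem_nhds hz]
        with σ h2 h3
      exact (hasDerivAt_formW h3 h2).deriv) h
  have key' : deriv formW τ = 2 * Real.pi * I *
      (logDerivA τ * formW τ + 10 * formA τ * formB τ + 64 * formB τ ^ 2) := key
  rw [← key']
  exact (hd h).hasDerivAt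

lemma formA_ellPt : formA ellPt = -16 * formB ellPt := by
  simp only [formA, formB, eisTwoDil]
  push_cast
  rw [eisTwo_ellPt, eisTwo_two_ellPt, eisTwo_three_ellPt, eisTwo_six_ellPt]
  ring

lemma frickeT_ellPt : frickeT ellPt = 16 := by
  have := formB_ne_zero ellPt_im_pos
  rw [frickeT, formA_ellPt]
  field_simp

lemma frickeT_sub {τ : ℂ} (h : 0 < τ.im) (h4 : formA τ + 4 * formB τ ≠ 0) :
    frickeT τ - 16 = -formW τ ^ 2 / (formB τ * (formA τ + 4 * formB τ)) := by
  have := formB_ne_zero h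
  have hW : formW τ ^ 2 = (formA τ + 16 * formB τ) * (formA τ + 4 * formB τ) := by
    rw [formW_sq h]
  rw [hW, neg_div, mul_div_mul_right _ _ h4, frickeT]
  field_simp
  ring

lemma bananaInt_sixteen :
    Integrable (fun p => ((bananaPoly p : ℂ) - 16)⁻¹) haarOctant ∧
      bananaInt 16 = frickeInt ellPt := by
  have hp := ellPt_im_pos
  have hB0 := formB_ne_zero hp
  obtain ⟨b, hb⟩ : ∃ b : ℝ, formB ellPt = b :=
    ⟨(formB ellPt).re, by
      apply Complex.ext <;> simp [formB_im (nome_im_of_half ellPt_re)]⟩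
  have hb0 : b ≠ 0 := by rintro rfl; simp [hb] at hB0
  set v : ℂ := -1 + I with hv
  set s : ℕ → ℝ := fun n => 1 / ((n : ℝ) + 3) with hs
  have hs0 : ∀ n, 0 < s n := fun n => by positivity
  have hs1 : ∀ n, s n < 1 / 2 := fun n => by
    rw [hs]
    have : (0 : ℝ) ≤ n := by positivity
    exact one_div_lt_one_div_of_lt (by norm_num) (by linarith)
  have hslim : Tendsto s atTop (𝓝 0) := by
    have := tendsto_const_div_atTop_nhds_zero_nat (1 : ℝ)
    have h2 := (tendsto_add_atTop_iff_nat 3).2 this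
    refine h2.congr fun n => by simp [hs]
  set σ : ℕ → ℂ := fun n => ellPt + s n * v with hσ
  have hσlim : Tendsto σ atTop (𝓝 ellPt) := by
    have h1 : Tendsto (fun n => ((s n : ℝ) : ℂ)) atTop (𝓝 ((0 : ℝ) : ℂ)) :=
      (Complex.continuous_ofReal.tendsto 0).comp hslim
    have := (h1.mul_const v).const_add ellPt
    simpa using this
  have hσre : ∀ n, (σ n).re = 1 / 2 - s n := fun n => by
    simp [hσ, hv, ellPt_re]; ring
  have hσim : ∀ n, (σ n).im = ellPt.im + s n := fun n => by simp [hσ, hv]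
  have hmem : ∀ n, σ n ∈ contRegion := fun n => Or.inr
    ⟨⟨by rw [hσre]; linarith [hs1 n], by rw [hσre]; linarith [hs0 n]⟩,
      by rw [hσim]; linarith [hs0 n]⟩
  have him : ∀ n, 0 < (frickeT (σ n)).im := fun n =>
    frickeT_im_pos (by rw [hσre]; linarith [hs1 n]) (by rw [hσre]; linarith [hs0 n])
      (by rw [hσim]; linarith [hs0 n])
  have hlim : Tendsto (fun n => frickeT (σ n)) atTop (𝓝 16) := by
    have := (differentiableAt_frickeT hp).continuousAt.tendsto.comp hσlim
    rwa [frickeT_ellPt] at this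
  have hL : Tendsto (fun n => bananaInt (frickeT (σ n))) atTop (𝓝 (frickeInt ellPt)) := by
    refine ((differentiableAt_frickeInt hp).continuousAt.tendsto.comp hσlim).congr fun n => ?_
    exact (bananaInt_frickeT (hmem n)).symm
  have hW : Tendsto (fun n => formW (σ n) / s n) atTop
      (𝓝 (2 * Real.pi * I * (-96 * b ^ 2) * v)) := by
    have hd := hasDerivAt_formW' hp
    rw [formA_ellPt, formW_ellPt, hb] at hd
    have h1 : HasDerivAt (fun x : ℝ => formW (ellPt + x * v))
        (2 * Real.pi * I * (-96 * b ^ 2) * v) 0 := by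
      have hl : HasDerivAt (fun x : ℝ => ellPt + x * v) v 0 := by
        simpa using ((Complex.ofRealCLM.hasDerivAt (x := 0)).mul_const v).const_add ellPt
      have := HasDerivAt.scomp_of_eq (0 : ℝ) hd hl (by simp)
      refine this.congr_deriv ?_
      rw [smul_eq_mul]
      ring
    have h2 := h1.tendsto_slope_zero
    have h3 : Tendsto s atTop (𝓝[≠] 0) :=
      tendsto_nhdsWithin_iff.2 ⟨hslim, Eventually.of_forall fun n => (hs0 n).ne'⟩
    refine (h2.comp h3).congr fun n => ?_
    simp only [Function.comp_apply, zero_add, Complex.ofReal_zero, zero_mul, add_zero, formW_ellPt,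
      sub_zero, Complex.real_smul, hσ]
    push_cast
    ring
  have hquad : Tendsto (fun n => (frickeT (σ n) - 16) / s n ^ 2) atTop
      (𝓝 (((Real.pi ^ 2 * 6144 * b ^ 2 : ℝ) : ℂ) * I)) := by
    have hA := (hasDerivAt_formA hp).continuousAt.tendsto.comp hσlim
    have hBt := (hasDerivAt_formB hp).continuousAt.tendsto.comp hσlim
    rw [formA_ellPt, hb] at hA
    rw [hb] at hBt
    have hb' : (b : ℂ) ≠ 0 := by exact_mod_cast hb0
    have h4 := hA.add (hBt.const_mul 4)
    have h4ne : (-16 * b + 4 * b : ℂ) ≠ 0 := by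
      rw [show (-16 * b + 4 * b : ℂ) = -12 * b by ring]
      exact mul_ne_zero (by norm_num) hb'
    have h5 := (hW.pow 2).neg.div (hBt.mul h4) (mul_ne_zero hb' h4ne)
    have e : -(2 * Real.pi * I * (-96 * b ^ 2) * v) ^ 2 / (b * (-16 * b + 4 * b)) =
        ((Real.pi ^ 2 * 6144 * b ^ 2 : ℝ) : ℂ) * I := by
      rw [show (-16 * b + 4 * b : ℂ) = -12 * b by ring, hv]
      push_cast
      field_simp
      linear_combination (-73728 + 36864 * I) * I_sq
    rw [e] at h5
    refine h5.congr' ?_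
    filter_upwards [h4.eventually_ne h4ne] with n hn
    have := frickeT_sub (contRegion_im (hmem n)) hn
    rw [this]
    simp only [Pi.div_apply, Function.comp_apply]
    rw [div_pow, ← neg_div, div_div, div_div, mul_comm]
  have hev : ∀ᶠ n in atTop, |(frickeT (σ n)).re - 16| ≤ 1 * (frickeT (σ n)).im := by
    have hr := (Complex.continuous_re.tendsto _).comp hquad
    have hi := (Complex.continuous_im.tendsto _).comp hquad
    have hlt : |(((Real.pi ^ 2 * 6144 * b ^ 2 : ℝ) : ℂ) * I).re| <
        (((Real.pi ^ 2 * 6144 * b ^ 2 : ℝ) : ℂ) * I).im := by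
      have := Real.pi_pos
      have : 0 < Real.pi ^ 2 * 6144 * b ^ 2 := by positivity
      rw [Complex.re_ofReal_mul, Complex.im_ofReal_mul]
      simpa using this
    filter_upwards [hr.abs.eventually_lt hi hlt] with n hn
    have hs2 : 0 < s n ^ 2 := pow_pos (hs0 n) 2
    simp only [Function.comp_apply, ← Complex.ofReal_pow, Complex.div_ofReal_re,
      Complex.div_ofReal_im] at hn
    rw [abs_div, abs_of_pos hs2, div_lt_div_iff_of_pos_right hs2] at hn
    simp at hn
    linarith
  obtain ⟨N, hN⟩ := eventually_atTop.1 hev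
  exact bananaInt_boundary (C := 1) zero_le_one (t := fun n => frickeT (σ (n + N)))
    ((tendsto_add_atTop_iff_nat N).2 hlim) (fun n => him _) (fun n => hN _ (by omega))
    ((tendsto_add_atTop_iff_nat N).2 hL)

end ThreeBanana

namespace ThreeBanana

open Complex Filter Topology Set

lemma rt_I_im_pos : 0 < (rt * I).im := by simp [rt_re]

lemma neg_inv_rt_I : -1 / (rt * I) = rt * I / 3 := by
  have := rt_ne
  field_simp
  linear_combination -rt ^ 2 * I_sq + rt_sq

lemma neg_inv_half_rt_I : -1 / (rt * I / 2) = 2 * (rt * I / 3) := by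
  have := rt_ne
  field_simp
  linear_combination (-1 : ℂ) * rt ^ 2 * I_sq + rt_sq

lemma omega_sq : ((1 + rt * I) / 2) ^ 2 = (1 + rt * I) / 2 - 1 := by
  linear_combination (1 / 4) * I ^ 2 * rt_sq + 3 / 4 * I_sq

lemma eichler_omega : eichler ((1 + rt * I) / 2) = Real.pi ^ 3 * rt / 90 := by
  set w := (1 + rt * I) / 2 with hw
  have him : 0 < w.im := by simp [hw, rt_re, rt_im]
  have hne : w ≠ 0 := by rintro h; rw [h] at him; simp at him
  have hw2 : w ^ 2 = w - 1 := omega_sq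
  have h := eichler_inv him
  have e : 1 / w = 1 - w := by field_simp; linear_combination hw2
  have e' : -1 / w = w - 1 := by rw [neg_div, e]; ring
  have p := eichler_add_one (w - 1)
  rw [sub_add_cancel] at p
  rw [e', ← p, e] at h
  have h5 : (w - 2) * (eichler w - Real.pi ^ 3 * rt / 90) = 0 := by
    have e1 : I * Real.pi ^ 3 * w / 30 = (w - 2) * (Real.pi ^ 3 * rt / 90) := by
      rw [hw]
      linear_combination (Real.pi ^ 3 * I / 180) * -1 * rt_sq
        + (Real.pi ^ 3 * rt / 60) * I_sq
    linear_combination h + e1 + (-eichler w - I * Real.pi ^ 3 / 180 * (w + 1)) * hw2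
  rcases mul_eq_zero.1 h5 with h6 | h6
  · exfalso
    have := congrArg Complex.re h6
    simp [hw, rt_im, rt_re] at this
    norm_num at this
  · linear_combination h6

lemma ellPt_cube : ellPt ^ 3 = I * rt / 9 := by
  rw [ellPt]
  linear_combination ((rt * I ^ 3 + 9 * I ^ 2) / 216) * rt_sq + (3 * rt * I + 27 - 0) / 216 * I_sq

lemma eichler_ellPt : eichler ellPt = 7 * Real.pi ^ 3 * rt / 810 := by
  set w := (1 + rt * I) / 2 - 2 with hw
  have him : 0 < w.im := by simp [hw, rt_re, rt_im]
  have hne : w ≠ 0 := by rintro h; rw [h] at him; simp at him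
  have h := eichler_inv him
  have p1 := eichler_add_one ((1 + rt * I) / 2 - 1)
  have p2 := eichler_add_one w
  rw [sub_add_cancel] at p1
  rw [show w + 1 = (1 + rt * I) / 2 - 1 by rw [hw]; ring] at p2
  have e : 1 / w = -ellPt := by rw [← ellPt_inv]; ring
  rw [ellPt_inv, e, ← p2, ← p1, eichler_omega] at h
  refine mul_left_cancel₀ (pow_ne_zero 2 hne) (h.trans ?_)
  have h1 := rt_sq
  have h2 := I_sq
  rw [hw, ellPt]
  generalize (Real.pi : ℂ) = p
  generalize rt = r at *
  generalize I = i at *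
  grind

lemma eichler_third : eichler (rt * I / 3) =
    -1 / 3 * eichler (rt * I) + 5 / 324 * Real.pi ^ 3 * rt := by
  have h := eichler_inv rt_I_im_pos
  have e : 1 / (rt * I) = -(rt * I / 3) := by rw [← neg_inv_rt_I]; ring
  rw [neg_inv_rt_I, e] at h
  have h1 := rt_sq
  have h2 := I_sq
  generalize eichler (rt * I / 3) = x at *
  generalize eichler (rt * I) = y at *
  generalize (Real.pi : ℂ) = p at *
  generalize rt = r at *
  generalize I = i at *
  clear e
  grind

lemma eichler_two_thirds : eichler (2 * (rt * I / 3)) =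
    -4 / 3 * eichler (rt * I / 2) + 17 / 648 * Real.pi ^ 3 * rt := by
  have h := eichler_inv (τ := rt * I / 2) (by simp [rt_re])
  have e : 1 / (rt * I / 2) = -(2 * (rt * I / 3)) := by rw [← neg_inv_half_rt_I]; ring
  rw [neg_inv_half_rt_I, e] at h
  have h1 := rt_sq
  have h2 := I_sq
  generalize eichler (2 * (rt * I / 3)) = x at *
  generalize eichler (rt * I / 2) = y at *
  generalize (Real.pi : ℂ) = p at *
  generalize rt = r at *
  generalize I = i at *
  clear e
  grind

lemma eichler_half_omega : eichler ((rt * I + 1) / 2) = Real.pi ^ 3 * rt / 90 := by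
  rw [← eichler_omega]; congr 1; ring

lemma eichler_hecke_rt : eichler (rt * I / 2) =
    9 / 4 * eichler (rt * I) - Real.pi ^ 3 * rt / 90 - eichler (2 * (rt * I)) / 4 := by
  linear_combination eichler_hecke rt_I_im_pos - eichler_half_omega

lemma eisTwo_half_omega : eisTwo ((rt * I + 1) / 2) = 2 * rt / Real.pi := by
  rw [← eisTwo_omega]; congr 1; ring

lemma eisTwo_third : eisTwo (rt * I / 3) = -3 * eisTwo (rt * I) + 6 * rt / Real.pi := by
  rw [← eisTwo_two_ellPt, ← eisTwo_add_one]
  congr 1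
  rw [ellPt]
  ring

lemma eisTwo_two_thirds : eisTwo (2 * (rt * I / 3)) =
    -3 / 4 * eisTwo (rt * I / 2) + 3 * rt / Real.pi := by
  have h := eisTwo_inv (w := rt * I / 2) (by simp [rt_re])
  rw [neg_inv_half_rt_I, pi_I_inv] at h
  rw [h]
  have := pi_ne'
  field_simp
  linear_combination (4 * eisTwo (rt * I / 2) * Real.pi * I ^ 2) * rt_sq
    + (12 * eisTwo (rt * I / 2) * Real.pi - 48 * rt) * I_sq

lemma eisTwo_hecke_rt : eisTwo (rt * I / 2) =
    6 * eisTwo (rt * I) - 2 * rt / Real.pi - 4 * eisTwo (2 * (rt * I)) := by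
  linear_combination eisTwo_hecke rt_I_im_pos - eisTwo_half_omega

lemma formB_ellPt : formB ellPt = (rt / Real.pi - eisTwo (rt * I)) / 4 := by
  simp only [formB, eisTwoDil]
  push_cast
  rw [eisTwo_ellPt, eisTwo_two_ellPt, eisTwo_three_ellPt, eisTwo_six_ellPt]
  ring

lemma formB_third : formB (rt * I / 3) = (eisTwo (rt * I) - rt / Real.pi) / 16 := by
  simp only [formB, eisTwoDil]
  push_cast
  rw [show 3 * (rt * I / 3) = rt * I by ring, show 6 * (rt * I / 3) = 2 * (rt * I) by ring,
    eisTwo_third, eisTwo_two_thirds, eisTwo_hecke_rt]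
  ring

lemma formA_third : formA (rt * I / 3) = 32 * formB (rt * I / 3) := by
  rw [formB_third]
  simp only [formA, eisTwoDil]
  push_cast
  rw [show 3 * (rt * I / 3) = rt * I by ring, show 6 * (rt * I / 3) = 2 * (rt * I) by ring,
    eisTwo_third, eisTwo_two_thirds, eisTwo_hecke_rt]
  ring

lemma third_im_pos : 0 < (rt * I / 3).im := by
  have := sqrt_three_pos
  simp [rt_re]

lemma frickeT_third : frickeT (rt * I / 3) = -32 := by
  have := formB_ne_zero third_im_pos
  rw [frickeT, formA_third]
  field_simp

lemma third_mem_contRegion : rt * I / 3 ∈ contRegion :=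
  Or.inl ⟨by simp [rt_im], third_im_pos⟩

lemma feynmanI_neg32 : ((feynmanI (-32) : ℝ) : ℂ) = frickeInt (rt * I / 3) := by
  have h := feynmanI_eq_of_integrable (t := -32) (integrable_bananaInt (Or.inr (by
    rw [Complex.ofReal_re]; norm_num)))
  rw [h, ← bananaInt_frickeT third_mem_contRegion, frickeT_third]
  norm_num

lemma feynmanI_sixteen : ((feynmanI 16 : ℝ) : ℂ) = frickeInt ellPt := by
  obtain ⟨h1, h2⟩ := bananaInt_sixteen
  rw [← h2, feynmanI_eq_of_integrable (t := 16) (by simpa using h1)]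
  norm_num

lemma frickeInt_ellPt : frickeInt ellPt = formB ellPt * (-64 * eichler (rt * I)
    - 104 / 45 * Real.pi ^ 3 * rt - 48 * kap * ellPt ^ 2) := by
  have e6 : eichler (6 * ellPt) = eichler (rt * I) := by
    rw [← eichler_add_one (rt * I), ← eichler_add_one (rt * I + 1),
      ← eichler_add_one (rt * I + 1 + 1)]
    congr 1; rw [ellPt]; ring
  have e3 : eichler (3 * ellPt) = Real.pi ^ 3 * rt / 90 := by
    rw [← eichler_omega, ← eichler_add_one ((1 + rt * I) / 2)]
    congr 1; rw [ellPt]; ring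
  have e2 : eichler (2 * ellPt) = -1 / 3 * eichler (rt * I) + 5 / 324 * Real.pi ^ 3 * rt := by
    rw [← eichler_third, ← eichler_add_one (rt * I / 3)]
    congr 1; rw [ellPt]; ring
  rw [frickeInt, e6, e3, e2, eichler_ellPt, ellPt_cube]
  linear_combination formB ellPt * (32 / 9 * Real.pi ^ 3 * rt) * I_sq

lemma frickeInt_third : frickeInt (rt * I / 3) = formB (rt * I / 3) * (-256 * eichler (rt * I)
    + 304 / 45 * Real.pi ^ 3 * rt + 16 * kap) := by
  rw [frickeInt, show 3 * (rt * I / 3) = rt * I by ring,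
    show 6 * (rt * I / 3) = 2 * (rt * I) by ring, eichler_third, eichler_two_thirds,
    eichler_hecke_rt]
  have h1 := rt_sq
  have h2 := I_sq
  generalize formB (rt * I / 3) = b
  generalize eichler (rt * I) = x
  generalize eichler (2 * (rt * I)) = y
  generalize (Real.pi : ℂ) = p
  generalize (kap : ℂ) = k
  generalize rt = r at *
  generalize I = i at *
  grind

lemma kap_eq_zero : (kap : ℝ) = 0 := by
  have h := congrArg Complex.im feynmanI_sixteen
  have hb0 := formB_ne_zero ellPt_im_pos
  obtain ⟨b, hb⟩ : ∃ b : ℝ, formB ellPt = b :=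
    ⟨(formB ellPt).re, by
      apply Complex.ext <;> simp [formB_im (nome_im_of_half ellPt_re)]⟩
  obtain ⟨c, hc⟩ : ∃ c : ℝ, eichler (rt * I) = c :=
    ⟨(eichler (rt * I)).re, by
      apply Complex.ext <;> simp [eichler_im (nome_im_of_re (τ := rt * I) (by simp [rt_im]))]⟩
  have hb1 : b ≠ 0 := by rintro rfl; simp [hb] at hb0
  rw [frickeInt_ellPt, hb, hc, Complex.ofReal_im, Complex.im_ofReal_mul] at h
  have e : ellPt ^ 2 = (1 / 6 : ℝ) + (Real.sqrt 3 / 6 : ℝ) * I := by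
    rw [ellPt]
    push_cast
    rw [← rt]
    linear_combination (1 / 36) * I ^ 2 * rt_sq + (1 / 12) * I_sq
  have e2 : -64 * (c : ℂ) - 104 / 45 * Real.pi ^ 3 * rt - 48 * kap * ellPt ^ 2 =
      ((-64 * c - 104 / 45 * Real.pi ^ 3 * Real.sqrt 3 - 8 * kap : ℝ) : ℂ)
        + ((-8 * kap * Real.sqrt 3 : ℝ) : ℂ) * I := by
    rw [e, rt]
    push_cast
    ring
  rw [e2, Complex.add_im, Complex.ofReal_im, Complex.im_ofReal_mul, Complex.I_im] at h
  have h3 := sqrt_three_pos.ne'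
  have h4 : b * (kap * Real.sqrt 3) = 0 := by linarith
  rcases mul_eq_zero.1 h4 with h5 | h5
  · exact absurd h5 hb1
  · exact (mul_eq_zero.1 h5).resolve_right h3

lemma feynmanI_add : ((feynmanI (-32) + feynmanI 16 : ℝ) : ℂ) =
    -4 * Real.pi ^ 3 * rt * formB ellPt := by
  push_cast
  rw [feynmanI_neg32, feynmanI_sixteen, frickeInt_ellPt, frickeInt_third, kap_eq_zero, formB_third,
    formB_ellPt]
  push_cast
  ring

end ThreeBanana

namespace ThreeBanana

open Filter Topology

/-- The finite product `(1 - q) ⋯ (1 - q ^ m)`. -/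
noncomputable def qPoch (q : ℝ) (m : ℕ) : ℝ := ∏ i ∈ Finset.range m, (1 - q ^ (i + 1))

lemma qPoch_succ (q : ℝ) (m : ℕ) : qPoch q (m + 1) = qPoch q m * (1 - q ^ (m + 1)) :=
  Finset.prod_range_succ _ _

lemma qPoch_zero (q : ℝ) : qPoch q 0 = 1 := Finset.prod_range_zero _

lemma one_sub_pow_pos {q : ℝ} (h0 : 0 ≤ q) (h1 : q < 1) (i : ℕ) : 0 < 1 - q ^ (i + 1) :=
  sub_pos.2 (pow_lt_one₀ h0 h1 (by omega))

lemma qPoch_pos {q : ℝ} (h0 : 0 ≤ q) (h1 : q < 1) (m : ℕ) : 0 < qPoch q m :=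
  Finset.prod_pos fun i _ => one_sub_pow_pos h0 h1 i

/-- The Gaussian binomial coefficient `(a + b choose a)`. -/
noncomputable def gauss (q : ℝ) (a b : ℕ) : ℝ := qPoch q (a + b) / (qPoch q a * qPoch q b)

lemma gauss_succ {q : ℝ} (h0 : 0 ≤ q) (h1 : q < 1) (a b : ℕ) :
    gauss q (a + 1) (b + 1) = gauss q (a + 1) b + q ^ (b + 1) * gauss q a (b + 1) := by
  have ha := (qPoch_pos h0 h1 a).ne'
  have hb := (qPoch_pos h0 h1 b).ne'
  have ha1 := (one_sub_pow_pos h0 h1 a).ne'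
  have hb1 := (one_sub_pow_pos h0 h1 b).ne'
  rw [gauss, gauss, gauss, show a + 1 + (b + 1) = (a + b + 1) + 1 by ring,
    show a + 1 + b = a + b + 1 by ring, show a + (b + 1) = a + b + 1 by ring,
    qPoch_succ q (a + b + 1), qPoch_succ q a, qPoch_succ q b]
  field_simp
  ring

lemma gauss_zero_left {q : ℝ} (h0 : 0 ≤ q) (h1 : q < 1) (b : ℕ) : gauss q 0 b = 1 := by
  rw [gauss, zero_add, qPoch_zero, one_mul, div_self (qPoch_pos h0 h1 b).ne']

lemma gauss_zero_right {q : ℝ} (h0 : 0 ≤ q) (h1 : q < 1) (a : ℕ) : gauss q a 0 = 1 := by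
  rw [gauss, add_zero, qPoch_zero, mul_one, div_self (qPoch_pos h0 h1 a).ne']

lemma gauss_comm (q : ℝ) (a b : ℕ) : gauss q a b = gauss q b a := by
  rw [gauss, gauss, add_comm, mul_comm (qPoch q a)]

lemma choose_two_succ (a : ℕ) : (a + 1).choose 2 = a + a.choose 2 := by
  rw [Nat.choose_succ_succ' a 1, Nat.choose_one_right]

/-- The `q`-binomial theorem. -/
lemma prod_add_mul_pow {q : ℝ} (h0 : 0 ≤ q) (h1 : q < 1) (x y : ℝ) (N : ℕ) :
    ∏ i ∈ Finset.range N, (y + x * q ^ i) = ∑ p ∈ Finset.HasAntidiagonal.antidiagonal N,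
      q ^ (p.1.choose 2) * gauss q p.1 p.2 * x ^ p.1 * y ^ p.2 := by
  induction N with
  | zero => simp [gauss_zero_left h0 h1]
  | succ N ih =>
    rw [Finset.prod_range_succ, ih]
    set t : ℕ × ℕ → ℝ := fun p => q ^ (p.1.choose 2) * gauss q p.1 p.2 * x ^ p.1 * y ^ p.2 with ht
    set F : ℕ × ℕ → ℝ := fun p => match p with
      | (_, 0) => 0
      | (a, b + 1) => t (a, b) * y with hF
    set G : ℕ × ℕ → ℝ := fun p => match p with
      | (0, _) => 0
      | (a + 1, b) => t (a, b) * (x * q ^ N) with hG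
    have e1 : ∑ p ∈ Finset.HasAntidiagonal.antidiagonal (N + 1), F p =
        (∑ p ∈ Finset.HasAntidiagonal.antidiagonal N, t p) * y := by
      rw [Finset.Nat.sum_antidiagonal_succ', Finset.sum_mul]
      simp [hF]
    have e2 : ∑ p ∈ Finset.HasAntidiagonal.antidiagonal (N + 1), G p =
        (∑ p ∈ Finset.HasAntidiagonal.antidiagonal N, t p) * (x * q ^ N) := by
      rw [Finset.Nat.sum_antidiagonal_succ, Finset.sum_mul]
      simp [hG]
    rw [mul_add, ← e1, ← e2, ← Finset.sum_add_distrib]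
    refine Finset.sum_congr rfl fun p hp => ?_
    rw [Finset.HasAntidiagonal.mem_antidiagonal] at hp
    rcases p with ⟨_ | a, _ | b⟩
    · simp at hp
    · simp only [hF, hG, ht, gauss_zero_left h0 h1]
      ring
    · simp only [hF, hG, ht, gauss_zero_right h0 h1]
      rw [choose_two_succ, show N = a by simpa using hp.symm]
      ring
    · simp only [hF, hG, ht]
      rw [gauss_succ h0 h1, choose_two_succ, show N = a + (b + 1) by simp at hp; omega]
      ring

lemma prod_pow_sub_pow (q : ℝ) (n : ℕ) : ∏ i ∈ Finset.range n, (q ^ n - q ^ i) =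
    (-1) ^ n * q ^ (n.choose 2) * qPoch q n := by
  have e : ∀ n : ℕ, ∏ i ∈ Finset.range n, (-q ^ i) = (-1) ^ n * q ^ (n.choose 2) := by
    intro n
    induction n with
    | zero => simp
    | succ n ih => rw [Finset.prod_range_succ, ih, choose_two_succ]; ring
  rw [← e, qPoch, ← Finset.prod_range_reflect (fun i => 1 - q ^ (i + 1)), ← Finset.prod_mul_distrib]
  refine Finset.prod_congr rfl fun i hi => ?_
  rw [Finset.mem_range] at hi
  obtain ⟨d, rfl⟩ : ∃ d, n = i + 1 + d := ⟨n - (i + 1), by omega⟩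
  rw [show i + 1 + d - 1 - i + 1 = d + 1 by omega]
  ring

lemma sum_mul_antidiagonal {q : ℝ} (h0 : 0 < q) (h1 : q < 1) (n : ℕ) :
    ∑ p ∈ Finset.HasAntidiagonal.antidiagonal (2 * n + 1), ((p.1 : ℝ) - p.2) *
      (q ^ (p.1.choose 2) * gauss q p.1 p.2 * (-1) ^ p.1 * (q ^ n) ^ p.2) =
    2 * (-1) ^ (n + 1) * q ^ ((n + 1).choose 2 + n ^ 2) * qPoch q n ^ 2 := by
  have hid := fun x => prod_add_mul_pow h0.le h1 x (q ^ n) (2 * n + 1)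
  have hsplit : ∀ x : ℝ, ∏ i ∈ Finset.range (2 * n + 1), (q ^ n + x * q ^ i) =
      (∏ i ∈ Finset.range n, (q ^ n + x * q ^ i)) * (q ^ n + x * q ^ n) *
        ∏ i ∈ Finset.range n, (q ^ n + x * q ^ (n + 1 + i)) := fun x => by
    rw [show 2 * n + 1 = (n + 1) + n by ring, Finset.prod_range_add, Finset.prod_range_succ]
  set R : ℝ → ℝ := fun x => (∏ i ∈ Finset.range n, (q ^ n + x * q ^ i)) *
    ∏ i ∈ Finset.range n, (q ^ n + x * q ^ (n + 1 + i)) with hR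
  have hRd : DifferentiableAt ℝ R (-1) := by rw [hR]; fun_prop
  have hRval : R (-1) = (-1) ^ n * q ^ (n.choose 2) * qPoch q n * (q ^ (n ^ 2) * qPoch q n) := by
    rw [← prod_pow_sub_pow]
    change _ * _ = _
    congr 1
    · exact Finset.prod_congr rfl fun i _ => by ring
    · rw [Finset.prod_congr rfl fun i _ => show q ^ n + -1 * q ^ (n + 1 + i) =
          q ^ n * (1 - q ^ (i + 1)) by ring, Finset.prod_mul_distrib, Finset.prod_const,
        Finset.card_range, ← pow_mul, ← pow_two, qPoch]
  have hval : ∑ p ∈ Finset.HasAntidiagonal.antidiagonal (2 * n + 1),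
      q ^ (p.1.choose 2) * gauss q p.1 p.2 * (-1) ^ p.1 * (q ^ n) ^ p.2 = 0 := by
    rw [← hid, hsplit]; ring
  have hd1 : HasDerivAt (fun x => (q ^ n + x * q ^ n) * R x) (q ^ n * R (-1)) (-1) := by
    have := (((hasDerivAt_id (-1 : ℝ)).mul_const (q ^ n)).const_add (q ^ n)).mul hRd.hasDerivAt
    refine this.congr_deriv ?_
    simp
  have hd2 : HasDerivAt (fun x => (q ^ n + x * q ^ n) * R x)
      (∑ p ∈ Finset.HasAntidiagonal.antidiagonal (2 * n + 1), q ^ (p.1.choose 2) * gauss q p.1 p.2 *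
        (p.1 * (-1) ^ (p.1 - 1)) * (q ^ n) ^ p.2) (-1) := by
    have : (fun x => (q ^ n + x * q ^ n) * R x) = fun x => ∑ p ∈ Finset.HasAntidiagonal.antidiagonal (2 * n + 1),
        q ^ (p.1.choose 2) * gauss q p.1 p.2 * x ^ p.1 * (q ^ n) ^ p.2 := by
      funext x
      rw [← hid, hsplit, hR]
      ring
    rw [this]
    exact HasDerivAt.fun_sum fun p _ => ((hasDerivAt_pow p.1 (-1 : ℝ)).const_mul _).mul_const _
  have hkey := hd2.unique hd1
  have e : ∑ p ∈ Finset.HasAntidiagonal.antidiagonal (2 * n + 1), ((p.1 : ℝ) - p.2) *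
      (q ^ (p.1.choose 2) * gauss q p.1 p.2 * (-1) ^ p.1 * (q ^ n) ^ p.2) =
      -2 * (∑ p ∈ Finset.HasAntidiagonal.antidiagonal (2 * n + 1), q ^ (p.1.choose 2) * gauss q p.1 p.2 *
        (p.1 * (-1) ^ (p.1 - 1)) * (q ^ n) ^ p.2) - (2 * n + 1) *
      ∑ p ∈ Finset.HasAntidiagonal.antidiagonal (2 * n + 1),
      q ^ (p.1.choose 2) * gauss q p.1 p.2 * (-1) ^ p.1 * (q ^ n) ^ p.2 := by
    rw [Finset.mul_sum, Finset.mul_sum, ← Finset.sum_sub_distrib]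
    refine Finset.sum_congr rfl fun p hp => ?_
    rw [Finset.HasAntidiagonal.mem_antidiagonal] at hp
    have h2 : (p.2 : ℝ) = 2 * n + 1 - p.1 := by
      rw [eq_sub_iff_add_eq']; exact_mod_cast hp
    rw [h2]
    rcases p with ⟨_ | a, b⟩
    · simp
      ring
    · simp only [Nat.add_sub_cancel]
      push_cast
      ring
  rw [e, hval, hkey, hRval, choose_two_succ]
  ring

lemma jacobi_finite {q : ℝ} (h0 : 0 < q) (h1 : q < 1) (n : ℕ) :
    ∑ k ∈ Finset.range (n + 1), (-1) ^ k * (2 * k + 1 : ℝ) * q ^ ((k + 1).choose 2) *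
      gauss q (n - k) (n + 1 + k) = qPoch q n ^ 2 := by
  have h := sum_mul_antidiagonal h0 h1 n
  rw [Finset.Nat.sum_antidiagonal_eq_sum_range_succ_mk,
    show (2 * n + 1).succ = (n + 1) + (n + 1) by omega, Finset.sum_range_add,
    ← Finset.sum_range_reflect, ← Finset.sum_add_distrib] at h
  have hc : (2 * (-1) ^ (n + 1) * q ^ ((n + 1).choose 2 + n ^ 2) : ℝ) ≠ 0 := by positivity
  refine mul_left_cancel₀ hc ?_
  rw [← h, Finset.mul_sum]
  refine Finset.sum_congr rfl fun k hk => ?_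
  rw [Finset.mem_range] at hk
  obtain ⟨b, rfl⟩ : ∃ b, n = b + k := ⟨n - k, by omega⟩
  simp only [show b + k + 1 - 1 - k = b by omega, show b + k - k = b by omega,
    show 2 * (b + k) + 1 - b = b + k + 1 + k by omega,
    show 2 * (b + k) + 1 - (b + k + 1 + k) = b by omega]
  rw [gauss_comm q (b + k + 1 + k) b]
  have hch : ∀ m : ℕ, 2 * m.choose 2 + m = m * m := fun m => by
    induction m with
    | zero => rfl
    | succ m ih => rw [choose_two_succ]; nlinarith
  have x1 : b.choose 2 + (b + k) * (b + k + 1 + k) =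
      (k + 1).choose 2 + (b + k + 1).choose 2 + (b + k) ^ 2 := by
    have := hch b
    have := hch (k + 1)
    have := hch (b + k + 1)
    nlinarith
  have x2 : (b + k + 1 + k).choose 2 + (b + k) * b =
      (k + 1).choose 2 + (b + k + 1).choose 2 + (b + k) ^ 2 := by
    have := hch (b + k + 1 + k)
    have := hch (k + 1)
    have := hch (b + k + 1)
    nlinarith
  have y1 : q ^ b.choose 2 * (q ^ (b + k)) ^ (b + k + 1 + k) =
      q ^ (k + 1).choose 2 * q ^ ((b + k + 1).choose 2 + (b + k) ^ 2) := by
    rw [← pow_mul, ← pow_add, ← pow_add, x1, add_assoc]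
  have y2 : q ^ (b + k + 1 + k).choose 2 * (q ^ (b + k)) ^ b =
      q ^ (k + 1).choose 2 * q ^ ((b + k + 1).choose 2 + (b + k) ^ 2) := by
    rw [← pow_mul, ← pow_add, ← pow_add, x2, add_assoc]
  have s1 : ((-1 : ℝ) ^ k) ^ 2 = 1 := by rw [← pow_mul, mul_comm, pow_mul]; simp
  have s2 : (-1 : ℝ) ^ (b + k + 1) = -(-1) ^ b * (-1) ^ k := by ring
  have s3 : (-1 : ℝ) ^ (b + k + 1 + k) = -(-1) ^ b * ((-1) ^ k) ^ 2 := by ring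
  rw [s3, s2, s1]
  push_cast
  linear_combination (-(((b : ℝ) - (b + k + 1 + k)) * gauss q b (b + k + 1 + k) * (-1) ^ b)) * y1 +
    (((b : ℝ) + k + 1 + k - b) * gauss q b (b + k + 1 + k) * (-1) ^ b) * y2 -
    (2 * (-1) ^ b * q ^ ((b + k + 1).choose 2 + (b + k) ^ 2) * (2 * k + 1) * q ^ (k + 1).choose 2 *
      gauss q b (b + k + 1 + k)) * s1

end ThreeBanana

namespace ThreeBanana

open Filter Topology

lemma multipliable_qPoch {q : ℝ} (h0 : 0 ≤ q) (h1 : q < 1) :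
    Multipliable fun n : ℕ => 1 - q ^ (n + 1) := by
  have h : Summable fun n : ℕ => ‖-q ^ (n + 1)‖ := by
    simpa [abs_of_nonneg h0] using (summable_nat_add_iff 1).2 (summable_geometric_of_lt_one h0 h1)
  exact (multipliable_one_add_of_summable h).congr fun n => (sub_eq_add_neg _ _).symm

/-- The infinite product `∏ (1 - q ^ n)`. -/
noncomputable def eulerProd (q : ℝ) : ℝ := ∏' n : ℕ, (1 - q ^ (n + 1))

lemma tendsto_qPoch {q : ℝ} (h0 : 0 ≤ q) (h1 : q < 1) :
    Tendsto (qPoch q) atTop (𝓝 (eulerProd q)) :=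
  (multipliable_qPoch h0 h1).tendsto_prod_tprod_nat

lemma qPoch_antitone {q : ℝ} (h0 : 0 ≤ q) (h1 : q < 1) : Antitone (qPoch q) :=
  antitone_nat_of_succ_le fun n => by
    rw [qPoch_succ]
    exact mul_le_of_le_one_right (qPoch_pos h0 h1 n).le (sub_le_self _ (by positivity))

lemma eulerProd_le {q : ℝ} (h0 : 0 ≤ q) (h1 : q < 1) (n : ℕ) : eulerProd q ≤ qPoch q n :=
  (qPoch_antitone h0 h1).le_of_tendsto (tendsto_qPoch h0 h1) n

lemma eulerProd_pos {q : ℝ} (h0 : 0 ≤ q) (h1 : q < 1) : 0 < eulerProd q := by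
  refine lt_of_le_of_ne (ge_of_tendsto' (tendsto_qPoch h0 h1) fun n => (qPoch_pos h0 h1 n).le) ?_
  have h : Summable fun n : ℕ => ‖-q ^ (n + 1)‖ := by
    simpa [abs_of_nonneg h0] using (summable_nat_add_iff 1).2 (summable_geometric_of_lt_one h0 h1)
  have := tprod_one_add_ne_zero_of_summable (f := fun n : ℕ => -q ^ (n + 1))
    (fun n => by rw [← sub_eq_add_neg]; exact (one_sub_pow_pos h0 h1 n).ne') h
  simp only [← sub_eq_add_neg] at this
  exact this.symm

lemma gauss_le {q : ℝ} (h0 : 0 ≤ q) (h1 : q < 1) (a b : ℕ) :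
    gauss q a b ≤ 1 / eulerProd q ^ 2 := by
  have h := eulerProd_pos h0 h1
  rw [gauss, pow_two]
  exact div_le_div₀ zero_le_one ((qPoch_antitone h0 h1 (Nat.zero_le _)).trans_eq (qPoch_zero q))
    (by positivity) (mul_le_mul (eulerProd_le h0 h1 a) (eulerProd_le h0 h1 b) h.le
      (qPoch_pos h0 h1 a).le)

lemma gauss_nonneg {q : ℝ} (h0 : 0 ≤ q) (h1 : q < 1) (a b : ℕ) : 0 ≤ gauss q a b := by
  have := qPoch_pos h0 h1 a
  have := qPoch_pos h0 h1 b
  have := qPoch_pos h0 h1 (a + b)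
  rw [gauss]
  positivity

lemma summable_jacobi_bound {q : ℝ} (h0 : 0 ≤ q) (h1 : q < 1) :
    Summable fun k : ℕ => (2 * k + 1 : ℝ) * q ^ k := by
  have h : ‖q‖ < 1 := by rwa [Real.norm_of_nonneg h0]
  refine (((summable_pow_mul_geometric_of_norm_lt_one 1 h).mul_left 2).add
    (summable_geometric_of_norm_lt_one h)).congr fun k => by rw [pow_one]; ring

lemma le_choose_two (k : ℕ) : k ≤ (k + 1).choose 2 := by
  rw [choose_two_succ]; omega

/-- Jacobi's identity for the cube of the Euler product. -/
lemma jacobi_cube {q : ℝ} (h0 : 0 < q) (h1 : q < 1) :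
    ∑' k : ℕ, (-1) ^ k * (2 * k + 1 : ℝ) * q ^ ((k + 1).choose 2) = eulerProd q ^ 3 := by
  have hP := eulerProd_pos h0.le h1
  set f : ℕ → ℕ → ℝ := fun n k => if k < n + 1 then (-1) ^ k * (2 * k + 1 : ℝ) *
    q ^ ((k + 1).choose 2) * gauss q (n - k) (n + 1 + k) else 0 with hf
  have hsum : ∀ n, ∑' k, f n k = qPoch q n ^ 2 := fun n => by
    rw [← jacobi_finite h0 h1 n, tsum_eq_sum (s := Finset.range (n + 1))]
    · exact Finset.sum_congr rfl fun k hk => if_pos (Finset.mem_range.1 hk)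
    · exact fun k hk => if_neg fun h => hk (Finset.mem_range.2 h)
  have hlim : Tendsto (fun n => ∑' k, f n k) atTop
      (𝓝 (∑' k : ℕ, (-1) ^ k * (2 * k + 1 : ℝ) * q ^ ((k + 1).choose 2) * (1 / eulerProd q))) := by
    refine tendsto_tsum_of_dominated_convergence
      ((summable_jacobi_bound h0.le h1).mul_right (1 / eulerProd q ^ 2)) (fun k => ?_) ?_
    · have ht := tendsto_qPoch h0.le h1
      have hg : Tendsto (fun n => gauss q (n - k) (n + 1 + k)) atTop (𝓝 (1 / eulerProd q)) := by
        have e1 : Tendsto (fun n : ℕ => n - k) atTop atTop := tendsto_sub_atTop_nat k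
        have e2 : Tendsto (fun n : ℕ => n + 1 + k) atTop atTop := by
          simpa only [add_assoc] using tendsto_add_atTop_nat (1 + k)
        have e3 : Tendsto (fun n : ℕ => n - k + (n + 1 + k)) atTop atTop :=
          tendsto_atTop_mono (fun n => Nat.le_add_left _ _) e2
        have := (ht.comp e3).div ((ht.comp e1).mul (ht.comp e2)) (by positivity)
        rwa [show eulerProd q / (eulerProd q * eulerProd q) = 1 / eulerProd q by field_simp] at this
      refine (hg.const_mul _).congr' ?_
      filter_upwards [eventually_ge_atTop k] with n hn
      exact (if_pos (by omega)).symm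
    · refine Eventually.of_forall fun n k => ?_
      simp only [hf]
      split_ifs
      · rw [norm_mul, norm_mul, norm_mul, norm_pow, norm_neg, norm_one, one_pow, one_mul,
          Real.norm_of_nonneg (by positivity), Real.norm_of_nonneg (by positivity),
          Real.norm_of_nonneg (gauss_nonneg h0.le h1 _ _)]
        exact mul_le_mul (mul_le_mul_of_nonneg_left
          (pow_le_pow_of_le_one h0.le h1.le (le_choose_two k)) (by positivity))
          (gauss_le h0.le h1 _ _) (gauss_nonneg h0.le h1 _ _) (by positivity)
      · rw [norm_zero]; positivity
  simp only [hsum] at hlim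
  have := tendsto_nhds_unique hlim ((tendsto_qPoch h0.le h1).pow 2)
  rw [tsum_mul_right] at this
  field_simp at this
  linarith

end ThreeBanana

namespace ThreeBanana

open Filter Topology

/-- The odd theta series `∑ (-1)^k (2 * k + 1) exp(-π (2 * k + 1)² x)`. -/
noncomputable def thetaOdd (x : ℝ) : ℝ :=
  ∑' k : ℕ, (-1) ^ k * (2 * k + 1 : ℝ) * Real.exp (-Real.pi * (2 * k + 1) ^ 2 * x)

lemma choose_two_cast (k : ℕ) : (((k + 1).choose 2 : ℕ) : ℝ) = k * (k + 1) / 2 := by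
  induction k with
  | zero => simp
  | succ k ih => rw [choose_two_succ, Nat.cast_add, ih]; push_cast; ring

lemma thetaOdd_term {s : ℝ} (k : ℕ) : Real.exp (-Real.pi * s / 4) *
    ((-1) ^ k * (2 * k + 1 : ℝ) * Real.exp (-(2 * Real.pi * s)) ^ ((k + 1).choose 2)) =
    (-1) ^ k * (2 * k + 1 : ℝ) * Real.exp (-Real.pi * (2 * k + 1) ^ 2 * (s / 4)) := by
  rw [← Real.exp_nat_mul, choose_two_cast, mul_left_comm, ← Real.exp_add]
  congr 2
  ring

lemma exp_neg_two_pi_mul_lt_one {s : ℝ} (hs : 0 < s) : Real.exp (-(2 * Real.pi * s)) < 1 :=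
  Real.exp_lt_one_iff.2 (neg_lt_zero.2 (by have := Real.pi_pos; positivity))

lemma dedekindEta_cube {s : ℝ} (hs : 0 < s) :
    dedekindEta (Complex.I * s) ^ 3 = (thetaOdd (s / 4) : ℂ) := by
  have h1 := exp_neg_two_pi_mul_lt_one hs
  have h0 := Real.exp_pos (-(2 * Real.pi * s))
  have e1 : Complex.exp (Real.pi * Complex.I * (Complex.I * s) / 12) =
      (Real.exp (-Real.pi * s / 12) : ℂ) := by
    rw [Complex.ofReal_exp]
    congr 1
    push_cast
    linear_combination (Real.pi * s / 12 : ℂ) * Complex.I_sq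
  have e2 : ∏' n : ℕ, (1 - Complex.exp (2 * Real.pi * Complex.I * ((n : ℂ) + 1) * (Complex.I * s))) =
      (eulerProd (Real.exp (-(2 * Real.pi * s))) : ℂ) := by
    have := ((multipliable_qPoch h0.le h1).hasProd.map Complex.ofRealHom Complex.continuous_ofReal).tprod_eq
    rw [eulerProd]
    refine Eq.trans (tprod_congr fun n => ?_) this
    simp only [Function.comp, Complex.ofRealHom_eq_coe]
    rw [← Real.exp_nat_mul]
    push_cast
    congr 2
    linear_combination (2 * Real.pi * (n + 1) * s : ℂ) * Complex.I_sq
  rw [dedekindEta, e1, e2, ← Complex.ofReal_mul, ← Complex.ofReal_pow, mul_pow,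
    ← jacobi_cube h0 h1, ← Real.exp_nat_mul, ← tsum_mul_left, thetaOdd]
  congr 1
  refine tsum_congr fun k => ?_
  rw [← thetaOdd_term]
  congr 2
  push_cast
  ring

lemma summable_thetaOdd_norm {x : ℝ} (hx : 0 < x) : Summable fun k : ℕ =>
    (2 * k + 1 : ℝ) * Real.exp (-Real.pi * (2 * k + 1) ^ 2 * x) := by
  have h1 := exp_neg_two_pi_mul_lt_one (s := 4 * x) (by positivity)
  have h0 := Real.exp_pos (-(2 * Real.pi * (4 * x)))
  refine Summable.of_nonneg_of_le (fun k => by positivity) (fun k => ?_)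
    ((summable_jacobi_bound h0.le h1).mul_left (Real.exp (-Real.pi * (4 * x) / 4)))
  have := thetaOdd_term (s := 4 * x) k
  have h2 : ((-1 : ℝ) ^ k) ^ 2 = 1 := by rw [← pow_mul, mul_comm, pow_mul]; simp
  have h3 : (2 * k + 1 : ℝ) * Real.exp (-Real.pi * (2 * k + 1) ^ 2 * x) =
      Real.exp (-Real.pi * (4 * x) / 4) * ((2 * k + 1 : ℝ) *
        Real.exp (-(2 * Real.pi * (4 * x))) ^ ((k + 1).choose 2)) := by
    rw [show 4 * x / 4 = x by ring] at this
    linear_combination (-(-1 : ℝ) ^ k) * this + ((Real.exp (-Real.pi * (4 * x) / 4) * ((2 * k + 1 : ℝ) *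
        Real.exp (-(2 * Real.pi * (4 * x))) ^ ((k + 1).choose 2))) - (2 * k + 1 : ℝ) * Real.exp (-Real.pi * (2 * k + 1) ^ 2 * x)) * h2
  rw [h3]
  exact mul_le_mul_of_nonneg_left (mul_le_mul_of_nonneg_left
    (pow_le_pow_of_le_one h0.le h1.le (le_choose_two k)) (by positivity)) (Real.exp_pos _).le

lemma hasSum_thetaOdd {x : ℝ} (hx : 0 < x) : HasSum (fun k : ℕ =>
    (-1) ^ k * (2 * k + 1 : ℝ) * Real.exp (-Real.pi * (2 * k + 1) ^ 2 * x)) (thetaOdd x) := by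
  refine Summable.hasSum (Summable.of_norm ((summable_thetaOdd_norm hx).congr fun k => ?_))
  rw [norm_mul, norm_mul, norm_pow, norm_neg, norm_one, one_pow, one_mul,
    Real.norm_of_nonneg (by positivity), Real.norm_of_nonneg (by positivity)]

lemma oddKernel_quarter {x : ℝ} (hx : 0 < x) :
    HurwitzZeta.oddKernel ((1 / 4 : ℝ) : UnitAddCircle) x = thetaOdd (x / 16) / 4 := by
  have he := (HurwitzZeta.hasSum_int_oddKernel (1 / 4) hx).nat_add_neg_add_one
  have ht := hasSum_thetaOdd (x := x / 16) (by positivity)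
  have i1 : Function.Injective fun k : ℕ => 2 * k := fun a b h => by simpa using h
  have i2 : Function.Injective fun k : ℕ => 2 * k + 1 := fun a b h => by simpa using h
  have s1 := (ht.summable.comp_injective i1).hasSum
  have s2 := (ht.summable.comp_injective i2).hasSum
  have hs := ht.unique (s1.even_add_odd s2)
  rw [hs]
  refine he.unique (((s1.add s2).div_const 4).congr_fun fun k => ?_)
  simp only [Function.comp]
  rw [pow_add, pow_mul, neg_one_sq, one_pow]
  push_cast
  rw [show -Real.pi * ((k : ℝ) + 1 / 4) ^ 2 * x = -Real.pi * (2 * (2 * k) + 1) ^ 2 * (x / 16) by ring,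
    show -Real.pi * (-((k : ℝ) + 1) + 1 / 4) ^ 2 * x =
      -Real.pi * (2 * (2 * k + 1) + 1) ^ 2 * (x / 16) by ring]
  ring

lemma sinKernel_quarter {t : ℝ} (ht : 0 < t) :
    HurwitzZeta.sinKernel ((1 / 4 : ℝ) : UnitAddCircle) t = 2 * thetaOdd t := by
  refine (HurwitzZeta.hasSum_nat_sinKernel (1 / 4) ht).unique ?_
  set f : ℕ → ℝ := fun n => 2 * n * Real.sin (2 * Real.pi * (1 / 4) * n) *
    Real.exp (-Real.pi * n ^ 2 * t) with hf
  have h1 : HasSum (fun k : ℕ => f (2 * k)) 0 := by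
    refine (hasSum_zero (α := ℝ) (β := ℕ)).congr_fun fun k => ?_
    simp only [hf]
    rw [show 2 * Real.pi * (1 / 4) * ((2 * k : ℕ) : ℝ) = k * Real.pi by push_cast; ring,
      Real.sin_nat_mul_pi, mul_zero, zero_mul]
  have h2 : HasSum (fun k : ℕ => f (2 * k + 1)) (2 * thetaOdd t) := by
    refine ((hasSum_thetaOdd ht).mul_left 2).congr_fun fun k => ?_
    simp only [hf]
    rw [show 2 * Real.pi * (1 / 4) * ((2 * k + 1 : ℕ) : ℝ) = k * Real.pi + Real.pi / 2 by
      push_cast; ring, Real.sin_add_pi_div_two, Real.cos_nat_mul_pi]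
    push_cast
    ring
  have := h1.even_add_odd h2
  rwa [zero_add] at this

lemma thetaOdd_inv {x : ℝ} (hx : 0 < x) :
    thetaOdd x = 8 / (16 * x) ^ (3 / 2 : ℝ) * thetaOdd (1 / (16 * x)) := by
  have h := HurwitzZeta.oddKernel_functional_equation ((1 / 4 : ℝ) : UnitAddCircle) (16 * x)
  rw [oddKernel_quarter (by positivity), sinKernel_quarter (by positivity),
    show 16 * x / 16 = x by ring] at h
  linear_combination 4 * h

end ThreeBanana

namespace ThreeBanana

open Filter Topology Set

/-- The Gaussian error integral. -/
noncomputable def gaussInt (x : ℝ) : ℝ := ∫ t in (0 : ℝ)..x, Real.exp (-t ^ 2)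

lemma hasDerivAt_gaussInt (x : ℝ) : HasDerivAt gaussInt (Real.exp (-x ^ 2)) x :=
  have hc : Continuous fun t : ℝ => Real.exp (-t ^ 2) := by fun_prop
  intervalIntegral.integral_hasDerivAt_right (hc.intervalIntegrable _ _)
    (hc.stronglyMeasurableAtFilter _ _) hc.continuousAt

lemma gaussInt_neg (x : ℝ) : gaussInt (-x) = -gaussInt x := by
  have := intervalIntegral.integral_comp_neg (fun t : ℝ => Real.exp (-t ^ 2)) (a := 0) (b := x)
  simp only [neg_sq, neg_zero] at this
  rw [gaussInt, gaussInt, this, intervalIntegral.integral_symm]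

lemma tendsto_gaussInt_atTop : Tendsto gaussInt atTop (𝓝 (Real.sqrt Real.pi / 2)) := by
  have hi : Integrable fun t : ℝ => Real.exp (-t ^ 2) := by
    simpa using integrable_exp_neg_mul_sq (b := 1) one_pos
  have h := intervalIntegral_tendsto_integral_Ioi 0 hi.integrableOn tendsto_id
  have e := integral_gaussian_Ioi 1
  simp only [neg_mul, one_mul, div_one] at e
  rwa [e] at h

lemma tendsto_gaussInt_atBot : Tendsto gaussInt atBot (𝓝 (-(Real.sqrt Real.pi / 2))) := by
  refine ((tendsto_gaussInt_atTop.comp tendsto_neg_atBot_atTop).neg).congr fun x => ?_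
  simp [gaussInt_neg]

/-- An antiderivative of `u ↦ 2 α exp (-α² u² - β² / u²)`. -/
noncomputable def besselPrim (α β u : ℝ) : ℝ :=
  Real.exp (2 * α * β) * gaussInt (α * u + β / u) + Real.exp (-(2 * α * β)) * gaussInt (α * u - β / u)

lemma hasDerivAt_besselPrim (α β : ℝ) {u : ℝ} (hu : u ≠ 0) :
    HasDerivAt (besselPrim α β) (2 * α * Real.exp (-α ^ 2 * u ^ 2 - β ^ 2 / u ^ 2)) u := by
  have hd : HasDerivAt (fun u : ℝ => β / u) (-(β / u ^ 2)) u := by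
    simpa [div_eq_mul_inv] using (hasDerivAt_inv hu).const_mul β
  have hl : HasDerivAt (fun u : ℝ => α * u) α u := by
    simpa using (hasDerivAt_id u).const_mul α
  have h1 := ((hasDerivAt_gaussInt _).comp u (hl.add hd)).const_mul (Real.exp (2 * α * β))
  have h2 := ((hasDerivAt_gaussInt _).comp u (hl.sub hd)).const_mul (Real.exp (-(2 * α * β)))
  refine (h1.add h2).congr_deriv ?_
  simp only [Pi.add_apply, Pi.sub_apply]
  rw [← mul_assoc, ← mul_assoc, ← Real.exp_add, ← Real.exp_add,
    show 2 * α * β + -(α * u + β / u) ^ 2 = -α ^ 2 * u ^ 2 - β ^ 2 / u ^ 2 by field_simp; ring,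
    show -(2 * α * β) + -(α * u - β / u) ^ 2 = -α ^ 2 * u ^ 2 - β ^ 2 / u ^ 2 by field_simp; ring]
  ring

lemma tendsto_besselPrim_atTop {α : ℝ} (hα : 0 < α) (β : ℝ) : Tendsto (besselPrim α β) atTop
    (𝓝 (Real.exp (2 * α * β) * (Real.sqrt Real.pi / 2) +
      Real.exp (-(2 * α * β)) * (Real.sqrt Real.pi / 2))) := by
  have h1 : Tendsto (fun u : ℝ => α * u) atTop atTop := tendsto_id.const_mul_atTop hα
  have h2 : Tendsto (fun u : ℝ => β / u) atTop (𝓝 0) := tendsto_const_nhds.div_atTop tendsto_id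
  exact ((tendsto_gaussInt_atTop.comp (h1.atTop_add h2)).const_mul _).add
    ((tendsto_gaussInt_atTop.comp ((h1.atTop_add h2.neg).congr fun u => (sub_eq_add_neg _ _).symm)).const_mul _)

lemma tendsto_besselPrim_zero (α : ℝ) {β : ℝ} (hβ : 0 < β) : Tendsto (besselPrim α β) (𝓝[>] 0)
    (𝓝 (Real.exp (2 * α * β) * (Real.sqrt Real.pi / 2) +
      Real.exp (-(2 * α * β)) * (-(Real.sqrt Real.pi / 2)))) := by
  have h1 : Tendsto (fun u : ℝ => α * u) (𝓝[>] 0) (𝓝 0) := by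
    have : ContinuousAt (fun u : ℝ => α * u) 0 := by fun_prop
    simpa using this.tendsto.mono_left (nhdsWithin_le_nhds (s := Ioi 0))
  have h2 : Tendsto (fun u : ℝ => β / u) (𝓝[>] 0) atTop := by
    simpa [div_eq_mul_inv] using tendsto_inv_nhdsGT_zero.const_mul_atTop hβ
  have h3 : Tendsto (fun u : ℝ => -(β / u)) (𝓝[>] 0) atBot := tendsto_neg_atTop_atBot.comp h2
  exact ((tendsto_gaussInt_atTop.comp (h1.add_atTop h2)).const_mul _).add
    ((tendsto_gaussInt_atBot.comp ((h1.add_atBot h3).congr fun u => (sub_eq_add_neg _ _).symm)).const_mul _)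

lemma bessel_half {α β : ℝ} (hα : 0 < α) (hβ : 0 < β) :
    IntegrableOn (fun y : ℝ => Real.exp (-α ^ 2 * y - β ^ 2 / y) / Real.sqrt y) (Ioi 0) ∧
      ∫ y in Ioi (0 : ℝ), Real.exp (-α ^ 2 * y - β ^ 2 / y) / Real.sqrt y =
        Real.sqrt Real.pi / α * Real.exp (-(2 * α * β)) := by
  set L := Real.exp (2 * α * β) * (Real.sqrt Real.pi / 2) +
      Real.exp (-(2 * α * β)) * (-(Real.sqrt Real.pi / 2)) with hL
  set G : ℝ → ℝ := Function.update (fun y => besselPrim α β (Real.sqrt y) / α) 0 (L / α) with hG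
  have hs0 : Tendsto Real.sqrt (𝓝[>] 0) (𝓝[>] 0) := by
    refine tendsto_nhdsWithin_iff.2 ⟨?_, ?_⟩
    · simpa using Real.continuous_sqrt.continuousAt.tendsto.mono_left
        (nhdsWithin_le_nhds (s := Ioi 0) (a := (0 : ℝ)))
    · filter_upwards [self_mem_nhdsWithin] with y hy using Real.sqrt_pos.2 hy
  have hcont : ContinuousWithinAt G (Ici 0) 0 := by
    rw [hG, continuousWithinAt_update_same, Ici_sdiff_left]
    exact ((tendsto_besselPrim_zero α hβ).comp hs0).div_const α
  have hderiv : ∀ y ∈ Ioi (0 : ℝ),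
      HasDerivAt G (Real.exp (-α ^ 2 * y - β ^ 2 / y) / Real.sqrt y) y := fun y hy => by
    have hy : 0 < y := hy
    have hsy := Real.sqrt_pos.2 hy
    have := ((hasDerivAt_besselPrim α β hsy.ne').comp y (Real.hasDerivAt_sqrt hy.ne')).div_const α
    rw [Real.sq_sqrt hy.le] at this
    refine (this.congr_of_eventuallyEq ?_).congr_deriv ?_
    · filter_upwards [lt_mem_nhds hy] with z hz
      exact Function.update_of_ne hz.ne' _ _
    · field_simp
  have hpos : ∀ y ∈ Ioi (0 : ℝ), 0 ≤ Real.exp (-α ^ 2 * y - β ^ 2 / y) / Real.sqrt y :=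
    fun y _ => by positivity
  have hlim := ((tendsto_besselPrim_atTop hα β).comp Real.tendsto_sqrt_atTop).div_const α
  have hlim' : Tendsto G atTop _ := hlim.congr' (by
    filter_upwards [eventually_gt_atTop 0] with z hz
    simp only [hG, Function.update_of_ne hz.ne', Function.comp])
  refine ⟨integrableOn_Ioi_deriv_of_nonneg hcont hderiv hpos hlim', ?_⟩
  rw [integral_Ioi_of_hasDerivAt_of_nonneg hcont hderiv hpos hlim', hG, Function.update_self, hL]
  ring

end ThreeBanana

namespace ThreeBanana

open Filter Topology Set

/-- The real nome `exp (-π √3 / 2)`. -/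
noncomputable def cuspNome : ℝ := Real.exp (-(Real.pi * Real.sqrt 3 / 2))

lemma cuspNome_pos : 0 < cuspNome := Real.exp_pos _

lemma cuspNome_lt_one : cuspNome < 1 :=
  Real.exp_lt_one_iff.2 (neg_lt_zero.2 (by have := Real.pi_pos; positivity))

/-- The terms of the double series for the `L`-value. -/
noncomputable def cuspTerm (p : ℕ × ℕ) : ℝ :=
  (-1) ^ p.1 * (-1) ^ p.2 * (2 * p.1 + 1) * cuspNome ^ ((2 * p.1 + 1) * (2 * p.2 + 1))

lemma summable_cuspTerm_bound : Summable fun p : ℕ × ℕ =>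
    (2 * p.1 + 1 : ℝ) * cuspNome ^ ((2 * p.1 + 1) * (2 * p.2 + 1)) := by
  have h0 := cuspNome_pos
  have hg := summable_geometric_of_lt_one h0.le cuspNome_lt_one
  refine Summable.of_nonneg_of_le (fun p => by positivity) (fun p => ?_)
    ((summable_jacobi_bound h0.le cuspNome_lt_one).mul_of_nonneg hg
      (fun k => by simp only [Pi.zero_apply]; positivity) (fun k => by simp only [Pi.zero_apply]; positivity))
  rw [mul_assoc, ← pow_add]
  exact mul_le_mul_of_nonneg_left (pow_le_pow_of_le_one h0.le cuspNome_lt_one.le (by nlinarith))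
    (by positivity)

lemma norm_cuspTerm (p : ℕ × ℕ) : ‖cuspTerm p‖ =
    (2 * p.1 + 1 : ℝ) * cuspNome ^ ((2 * p.1 + 1) * (2 * p.2 + 1)) := by
  have h0 := cuspNome_pos
  rw [cuspTerm, norm_mul, norm_mul, norm_mul, norm_pow, norm_pow, norm_neg, norm_one, one_pow,
    one_pow, one_mul, one_mul, Real.norm_of_nonneg (by positivity),
    Real.norm_of_nonneg (by positivity)]

lemma summable_cuspTerm : Summable cuspTerm :=
  Summable.of_norm (summable_cuspTerm_bound.congr fun p => (norm_cuspTerm p).symm)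

/-- The terms of the integrand after inverting one of the theta series. -/
noncomputable def cuspInt (p : ℕ × ℕ) (y : ℝ) : ℝ :=
  (-1) ^ p.1 * (-1) ^ p.2 * (2 * p.1 + 1) * (2 * p.2 + 1) / Real.sqrt 8 *
    (Real.exp (-(Real.sqrt (3 * Real.pi / 2) * (2 * p.2 + 1)) ^ 2 * y -
      (Real.sqrt (Real.pi / 8) * (2 * p.1 + 1)) ^ 2 / y) / Real.sqrt y)

lemma rpow_three_halves {x : ℝ} (hx : 0 < x) : x ^ (3 / 2 : ℝ) = x * Real.sqrt x := by
  rw [show (3 / 2 : ℝ) = 1 + 1 / 2 by norm_num, Real.rpow_add hx, Real.rpow_one, Real.sqrt_eq_rpow]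

lemma thetaOdd_mul {y : ℝ} (hy : 0 < y) :
    thetaOdd (y / 2) * thetaOdd (3 * y / 2) * y = ∑' p, cuspInt p y := by
  have h1 := hasSum_thetaOdd (x := 1 / (8 * y)) (by positivity)
  have h2 := hasSum_thetaOdd (x := 3 * y / 2) (by positivity)
  have hpi := Real.pi_pos
  rw [thetaOdd_inv (by positivity), rpow_three_halves (by positivity),
    show 16 * (y / 2) = 8 * y by ring, ← h1.tsum_eq, ← h2.tsum_eq, Real.sqrt_mul (by norm_num),
    mul_assoc (8 / _ : ℝ), tsum_mul_tsum_of_summable_norm h1.summable.norm h2.summable.norm,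
    ← tsum_mul_left, ← tsum_mul_right]
  refine tsum_congr fun p => ?_
  rw [cuspInt, mul_pow, mul_pow, Real.sq_sqrt (by positivity), Real.sq_sqrt (by positivity),
    sub_eq_add_neg, Real.exp_add,
    show -Real.pi * (2 * (p.1 : ℝ) + 1) ^ 2 * (1 / (8 * y)) =
      -(Real.pi / 8 * (2 * p.1 + 1) ^ 2 / y) by field_simp,
    show -Real.pi * (2 * (p.2 : ℝ) + 1) ^ 2 * (3 * y / 2) =
      -(3 * Real.pi / 2 * (2 * p.2 + 1) ^ 2) * y by ring]
  have := Real.sqrt_pos.2 hy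
  have : 0 < Real.sqrt 8 := by positivity
  field_simp

lemma sqrt_const : Real.sqrt Real.pi / Real.sqrt 8 / Real.sqrt (3 * Real.pi / 2) =
    1 / Real.sqrt 12 := by
  have hpi := Real.pi_pos
  rw [← Real.sqrt_div hpi.le, ← Real.sqrt_div (by positivity), ← Real.sqrt_one,
    ← Real.sqrt_div zero_le_one]
  congr 1
  field_simp
  norm_num

lemma sqrt_exponent : 2 * Real.sqrt (3 * Real.pi / 2) * Real.sqrt (Real.pi / 8) =
    Real.pi * Real.sqrt 3 / 2 := by
  have hpi := Real.pi_pos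
  rw [mul_assoc, ← Real.sqrt_mul (by positivity), show 3 * Real.pi / 2 * (Real.pi / 8) =
    (Real.pi / 4) ^ 2 * 3 by ring, Real.sqrt_mul (by positivity), Real.sqrt_sq (by positivity)]
  ring

lemma cuspInt_integral (p : ℕ × ℕ) : IntegrableOn (cuspInt p) (Ioi 0) ∧
    ∫ y in Ioi (0 : ℝ), cuspInt p y = cuspTerm p / Real.sqrt 12 := by
  have hpi := Real.pi_pos
  obtain ⟨hi, he⟩ := bessel_half (α := Real.sqrt (3 * Real.pi / 2) * (2 * p.2 + 1))
    (β := Real.sqrt (Real.pi / 8) * (2 * p.1 + 1)) (by positivity) (by positivity)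
  refine ⟨hi.const_mul _, ?_⟩
  simp only [cuspInt]
  rw [integral_const_mul, he, show 2 * (Real.sqrt (3 * Real.pi / 2) * (2 * p.2 + 1)) *
    (Real.sqrt (Real.pi / 8) * (2 * p.1 + 1)) = (2 * Real.sqrt (3 * Real.pi / 2) *
      Real.sqrt (Real.pi / 8)) * ((2 * p.1 + 1) * (2 * p.2 + 1)) by ring, sqrt_exponent, cuspTerm,
    cuspNome, ← Real.exp_nat_mul, ← mul_one_div _ (Real.sqrt 12), ← sqrt_const]
  have : Real.sqrt (3 * Real.pi / 2) ≠ 0 := by positivity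
  push_cast
  rw [show ((2 * p.1 + 1) * (2 * p.2 + 1) : ℝ) * -(Real.pi * Real.sqrt 3 / 2) =
    -(Real.pi * Real.sqrt 3 / 2 * ((2 * p.1 + 1) * (2 * p.2 + 1))) by ring]
  field_simp

lemma norm_cuspInt (p : ℕ × ℕ) (y : ℝ) : ‖cuspInt p y‖ = (-1) ^ p.1 * (-1) ^ p.2 * cuspInt p y := by
  have h : ∀ k : ℕ, ((-1 : ℝ) ^ k) ^ 2 = 1 := fun k => by rw [← pow_mul, mul_comm, pow_mul]; simp
  have e : (-1) ^ p.1 * (-1) ^ p.2 * cuspInt p y = ((2 * p.1 + 1) * (2 * p.2 + 1) / Real.sqrt 8 *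
    (Real.exp (-(Real.sqrt (3 * Real.pi / 2) * (2 * p.2 + 1)) ^ 2 * y -
      (Real.sqrt (Real.pi / 8) * (2 * p.1 + 1)) ^ 2 / y) / Real.sqrt y)) := by
    rw [cuspInt]
    linear_combination (((2 * p.1 + 1) * (2 * p.2 + 1) / Real.sqrt 8 *
      (Real.exp (-(Real.sqrt (3 * Real.pi / 2) * (2 * p.2 + 1)) ^ 2 * y -
      (Real.sqrt (Real.pi / 8) * (2 * p.1 + 1)) ^ 2 / y) / Real.sqrt y))) *
      ((((-1 : ℝ) ^ p.1) ^ 2) * h p.2 + h p.1)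
  have e2 : ‖cuspInt p y‖ = ‖(-1) ^ p.1 * (-1) ^ p.2 * cuspInt p y‖ := by
    rw [norm_mul, norm_mul, norm_pow, norm_pow, norm_neg, norm_one, one_pow, one_pow, one_mul,
      one_mul]
  rw [e2, e, Real.norm_of_nonneg (by positivity)]

lemma integral_thetaOdd_mul :
    ∫ y in Ioi (0 : ℝ), thetaOdd (y / 2) * thetaOdd (3 * y / 2) * y =
      (∑' p, cuspTerm p) / Real.sqrt 12 := by
  have hs : Summable fun p => ∫ y in Ioi (0 : ℝ), ‖cuspInt p y‖ := by
    refine (summable_cuspTerm.norm.div_const (Real.sqrt 12)).congr fun p => ?_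
    simp only [norm_cuspInt]
    rw [integral_const_mul, (cuspInt_integral p).2, norm_cuspTerm, cuspTerm]
    have h : ∀ k : ℕ, ((-1 : ℝ) ^ k) ^ 2 = 1 := fun k => by rw [← pow_mul, mul_comm, pow_mul]; simp
    linear_combination (-(2 * p.1 + 1 : ℝ) * cuspNome ^ ((2 * p.1 + 1) * (2 * p.2 + 1)) /
      Real.sqrt 12) * ((((-1 : ℝ) ^ p.1) ^ 2) * h p.2 + h p.1)
  have := hasSum_integral_of_summable_integral_norm (fun p => (cuspInt_integral p).1) hs
  rw [setIntegral_congr_fun measurableSet_Ioi fun y hy => thetaOdd_mul hy, ← this.tsum_eq,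
    ← tsum_div_const]
  exact tsum_congr fun p => (cuspInt_integral p).2

lemma Lg2_eq : Lg2 = ((4 * Real.pi ^ 2 * ((∑' p, cuspTerm p) / Real.sqrt 12) : ℝ) : ℂ) := by
  rw [Lg2, ← integral_thetaOdd_mul, Complex.ofReal_mul, ← integral_complex_ofReal]
  push_cast
  congr 1
  refine setIntegral_congr_fun measurableSet_Ioi fun y hy => ?_
  have hy : 0 < y := hy
  simp only [cuspFormG]
  rw [show (2 * (Complex.I * y) : ℂ) = Complex.I * ((2 * y : ℝ) : ℂ) by push_cast; ring,
    show (6 * (Complex.I * y) : ℂ) = Complex.I * ((6 * y : ℝ) : ℂ) by push_cast; ring,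
    dedekindEta_cube (by positivity), dedekindEta_cube (by positivity),
    show 2 * y / 4 = y / 2 by ring, show 6 * y / 4 = 3 * y / 2 by ring]

end ThreeBanana

namespace ThreeBanana

open Complex Filter Topology Set

/-- The Lambert series `∑ n zⁿ / (1 - zⁿ)`. -/
noncomputable def lambert (z : ℂ) : ℂ := ∑' n : ℕ, (n : ℂ) * z ^ n / (1 - z ^ n)

lemma hasSum_odd_lambert {z : ℂ} (hz : ‖z‖ < 1) :
    HasSum (fun n : ℕ => ((2 * n + 1 : ℕ) : ℂ) * z ^ (2 * n + 1) / (1 - z ^ (2 * n + 1)))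
      (lambert z - 2 * lambert (z ^ 2)) := by
  rw [lambert, lambert, lambert_sub hz]
  have h := (summable_lam (z := -z) (by rwa [norm_neg])).hasSum.neg
  refine h.congr_fun fun n => ?_
  rw [odd_term, neg_neg, neg_neg]

lemma hasSum_odd_lambert_sq {z : ℂ} (hz : ‖z‖ < 1) :
    HasSum (fun n : ℕ => ((2 * n + 1 : ℕ) : ℂ) * (z ^ (2 * n + 1) / (1 - (z ^ (2 * n + 1)) ^ 2)))
      (lambert z - 3 * lambert (z ^ 2) + 2 * lambert (z ^ 4)) := by
  have hz2 : ‖z ^ 2‖ < 1 := by rw [norm_pow]; exact pow_lt_one₀ (norm_nonneg _) hz two_ne_zero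
  have h := (hasSum_odd_lambert hz).sub (hasSum_odd_lambert hz2)
  rw [show lambert z - 2 * lambert (z ^ 2) - (lambert (z ^ 2) - 2 * lambert ((z ^ 2) ^ 2)) =
    lambert z - 3 * lambert (z ^ 2) + 2 * lambert (z ^ 4) by rw [← pow_mul]; ring] at h
  refine h.congr_fun fun n => ?_
  rw [pow_right_comm z 2 (2 * n + 1)]
  have hn : ‖z ^ (2 * n + 1)‖ < 1 := by
    rw [norm_pow]; exact pow_lt_one₀ (norm_nonneg _) hz (by omega)
  set w := z ^ (2 * n + 1)
  have h1 : 1 - w ≠ 0 := fun h => by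
    rw [← sub_eq_zero.1 h, norm_one] at hn; exact lt_irrefl _ hn
  have h2 : 1 - w ^ 2 ≠ 0 := fun h => by
    have : ‖w ^ 2‖ < 1 := by rw [norm_pow]; exact pow_lt_one₀ (norm_nonneg _) hn two_ne_zero
    rw [← sub_eq_zero.1 h, norm_one] at this; exact lt_irrefl _ this
  clear_value w
  field_simp
  ring

lemma nome_cusp : nome ((1 + rt * I) / 4) = I * (cuspNome : ℂ) := by
  rw [nome, show (2 * Real.pi * I * ((1 + rt * I) / 4) : ℂ) = Real.pi / 2 * I +
    ((-(Real.pi * Real.sqrt 3 / 2) : ℝ) : ℂ) by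
      rw [rt]; push_cast; linear_combination (Real.pi * (Real.sqrt 3 : ℂ) / 2) * I_sq,
    Complex.exp_add, Complex.exp_pi_div_two_mul_I, ← Complex.ofReal_exp, cuspNome]

lemma cuspTerm_eq (p : ℕ × ℕ) : (cuspTerm p : ℂ) = -I * (((2 * p.1 + 1 : ℕ) : ℂ) *
    (nome ((1 + rt * I) / 4) ^ (2 * p.1 + 1)) ^ (2 * p.2 + 1)) := by
  rw [nome_cusp, ← pow_mul, mul_pow I, cuspTerm]
  have e : (I : ℂ) ^ ((2 * p.1 + 1) * (2 * p.2 + 1)) = I * ((-1) ^ p.1 * (-1) ^ p.2) := by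
    rw [show (2 * p.1 + 1) * (2 * p.2 + 1) = 4 * (p.1 * p.2) + (2 * p.1 + (2 * p.2 + 1)) by ring,
      pow_add, pow_mul, I_pow_four, one_pow, pow_add, pow_mul, I_sq, pow_add, pow_mul, I_sq]
    ring
  rw [e]
  push_cast
  linear_combination ((-1 : ℂ) ^ p.1 * (-1) ^ p.2 * (2 * p.1 + 1) *
    (cuspNome : ℂ) ^ ((2 * p.1 + 1) * (2 * p.2 + 1))) * I_sq

lemma rt_cusp_im_pos : 0 < ((1 + rt * I) / 4).im := by
  have := sqrt_three_pos
  rw [rt, show ((1 + (Real.sqrt 3 : ℝ) * I) / 4 : ℂ) =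
    ((1 / 4 : ℝ) : ℂ) + ((Real.sqrt 3 / 4 : ℝ) : ℂ) * I by push_cast; ring]
  simp only [Complex.add_im, Complex.ofReal_im, Complex.im_ofReal_mul, Complex.I_im]
  linarith

lemma tsum_cuspTerm_lambert : ((∑' p, cuspTerm p : ℝ) : ℂ) =
    -I * (lambert (nome ((1 + rt * I) / 4)) - 3 * lambert (nome ((1 + rt * I) / 4) ^ 2) +
      2 * lambert (nome ((1 + rt * I) / 4) ^ 4)) := by
  have hz := norm_nome_lt_one rt_cusp_im_pos
  have hs : Summable fun p => (cuspTerm p : ℂ) := by exact_mod_cast summable_cuspTerm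
  rw [Complex.ofReal_tsum, hs.tsum_prod, ← (hasSum_odd_lambert_sq hz).tsum_eq, ← tsum_mul_left]
  refine tsum_congr fun k => ?_
  simp only [cuspTerm_eq]
  have hw : ‖nome ((1 + rt * I) / 4) ^ (2 * k + 1)‖ < 1 := by
    rw [norm_pow]; exact pow_lt_one₀ (norm_nonneg _) hz (by omega)
  set w := nome ((1 + rt * I) / 4) ^ (2 * k + 1)
  have hw2 : ‖w ^ 2‖ < 1 := by rw [norm_pow]; exact pow_lt_one₀ (norm_nonneg _) hw two_ne_zero
  have hl : ∀ l : ℕ, w ^ (2 * l + 1) = w * (w ^ 2) ^ l := fun l => by ring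
  simp only [hl, tsum_mul_left, tsum_geometric_of_norm_lt_one hw2, div_eq_mul_inv]

lemma lambert_nome {τ : ℂ} (h : 0 < τ.im) : lambert (nome τ) = (1 - eisTwo τ) / 24 := by
  rw [eisTwo_lambert h, lambert]; ring

lemma eisTwo_cusp : eisTwo ((1 + rt * I) / 4) =
    -4 * ((1 + rt * I) / 2) * eisTwo (rt * I) + 12 * I * (1 - (1 + rt * I) / 2) / Real.pi := by
  have h := eisTwo_inv rt_cusp_im_pos
  have hsq := omega_sq
  have e : -1 / ((1 + rt * I) / 4) = rt * I - 1 := by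
    have : (1 + rt * I) / 4 ≠ 0 := fun h => by
      have := rt_cusp_im_pos
      rw [h] at this
      simp at this
    rw [div_eq_iff this]
    linear_combination (-1 / 4) * I ^ 2 * rt_sq - 3 / 4 * I_sq
  have p := eisTwo_add_one (rt * I - 1)
  rw [sub_add_cancel] at p
  rw [e, ← p, pi_I_inv] at h
  have hr := rt_sq
  have hI := I_sq
  have hpi := pi_ne'
  have key : ((1 + rt * I) / 2) ^ 3 = -1 := by
    linear_combination ((1 + rt * I) / 2 + 1) * hsq
  set ω := (1 + rt * I) / 2 with hω
  rw [show (1 + rt * I) / 4 = ω / 2 by rw [hω]; ring] at h ⊢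
  linear_combination (4 * ω) * h + eisTwo (ω / 2) * key - 12 * I / Real.pi * hsq

lemma tsum_cuspTerm : ((∑' p, cuspTerm p : ℝ) : ℂ) =
    (rt * eisTwo (rt * I) - 3 / Real.pi) / 12 := by
  have h2 := nome_nat_mul 2 ((1 + rt * I) / 4)
  have h4 := nome_nat_mul 4 ((1 + rt * I) / 4)
  have i := rt_cusp_im_pos
  have i2 : 0 < ((1 + rt * I) / 2).im := by
    rw [show (1 + rt * I) / 2 = (1 + rt * I) / 4 + (1 + rt * I) / 4 by ring, Complex.add_im]
    linarith
  have i4 : 0 < (rt * I + 1).im := by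
    rw [show rt * I + 1 = (1 + rt * I) / 2 + (1 + rt * I) / 2 by ring, Complex.add_im]
    linarith
  push_cast at h2 h4
  rw [show 2 * ((1 + rt * I) / 4) = (1 + rt * I) / 2 by ring] at h2
  rw [show 4 * ((1 + rt * I) / 4) = rt * I + 1 by ring] at h4
  rw [tsum_cuspTerm_lambert, ← h2, ← h4, lambert_nome i, lambert_nome i2, lambert_nome i4,
    eisTwo_omega, eisTwo_add_one, eisTwo_cusp]
  have hr := rt_sq
  have hI := I_sq
  have hpi := pi_ne'
  field_simp
  grind

end ThreeBanana

theorem feynmanI_neg32_add_feynmanI_16 :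
    ((feynmanI (-32) + feynmanI 16 : ℝ) : ℂ) = ((36 * Real.pi / Real.sqrt 12 : ℝ) : ℂ) * Lg2 := by
  rw [ThreeBanana.feynmanI_add, ThreeBanana.Lg2_eq, ThreeBanana.formB_ellPt, ← Complex.ofReal_mul,
    show 36 * Real.pi / Real.sqrt 12 * (4 * Real.pi ^ 2 *
      ((∑' p, ThreeBanana.cuspTerm p) / Real.sqrt 12)) =
      12 * Real.pi ^ 3 * ∑' p, ThreeBanana.cuspTerm p by
        have h : Real.sqrt 12 ^ 2 = 12 := Real.sq_sqrt (by norm_num)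
        have h' : Real.sqrt 12 ≠ 0 := by positivity
        field_simp
        rw [h]
        ring, Complex.ofReal_mul, ThreeBanana.tsum_cuspTerm]
  have hr := ThreeBanana.rt_sq
  have hpi := ThreeBanana.pi_ne'
  push_cast
  field_simp
  linear_combination (-1 : ℂ) * hr
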